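/- arXiv:2203.05030 — 2 statements merged into one kernel-verified Lean document; each statement's English description precedes it below -/
import Mathlib

section
/- The Riemann Hypothesis holds if and only if the linear span 𝒩 of the functions {h_k : k ≥ 2} is dense in the Hardy space H², i.e., the closure of 𝒩 in L²(𝕋, m) equals the whole subspace of functions with vanishing negative Fourier coefficients. -/
open MeasureTheory Complex

noncomputable section

/-- Normalized Lebesgue (arc-length) measure on the unit circle, as a measure on `ℂ`. -/
def mCirc : Measure ℂ :=
  (ENNReal.ofReal (2 * Real.pi))⁻¹ •
    Measure.map (fun θ : ℝ => Complex.exp (θ * Complex.I))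
      (volume.restrict (Set.Ioc 0 (2 * Real.pi)))

/-- `g_k(z) = Log(1 - z^k) - Log(1 - z) - log k`. -/
def gFun (k : ℕ) (z : ℂ) : ℂ :=
  Complex.log (1 - z ^ k) - Complex.log (1 - z) - (Real.log k : ℂ)

/-- `h_k(z) = g_k(z) / (1 - z)`. -/
def hFun (k : ℕ) (z : ℂ) : ℂ := gFun k z / (1 - z)

/-- The Hardy space `H²`, viewed as the set of elements of `L²(𝕋, m)` whose negative
Fourier coefficients vanish. -/
def H2 : Set (Lp ℂ 2 mCirc) :=
  {f | ∀ n : ℤ, n < 0 → (∫ ω : ℂ, f ω * ω ^ (-n) ∂mCirc) = 0}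

end

namespace HardyRH
open Filter Topology Asymptotics Set

/-- The entire-type regularisation `(s - 1) ζ(s)` of the zeta function (holomorphic off `0`). -/
noncomputable def regZeta (s : ℂ) : ℂ :=
  ((s - 1) * completedRiemannZeta₀ s + 1 / s) * (Gammaℝ s)⁻¹

lemma regZeta_eq {s : ℂ} (h0 : s ≠ 0) (h1 : s ≠ 1) : regZeta s = (s - 1) * riemannZeta s := by
  have h1' : s - 1 ≠ 0 := sub_ne_zero.2 h1
  have h2 : (1 : ℂ) - s ≠ 0 := sub_ne_zero.2 h1.symm
  rw [riemannZeta_def_of_ne_zero h0, completedRiemannZeta_eq, regZeta, div_eq_mul_inv _ (Gammaℝ s),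
    ← mul_assoc]
  congr 1
  field_simp
  ring

lemma regZeta_one : regZeta 1 = 1 := by simp [regZeta]

lemma differentiableAt_regZeta {s : ℂ} (h0 : s ≠ 0) : DifferentiableAt ℂ regZeta s := by
  have h1 := differentiable_completedZeta₀ s
  have h2 := differentiable_Gammaℝ_inv s
  unfold regZeta
  exact ((((differentiableAt_id.sub_const 1).mul h1).add
    ((differentiableAt_const 1).div differentiableAt_id h0))).mul h2

lemma ne_zero_of_re_pos' {s : ℂ} (h : 0 < s.re) : s ≠ 0 := by
  rintro rfl; simp at h

/-- The truncated Mellin-type integral of a function decaying like a power is holomorphic. -/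
lemma differentiableAt_tailIntegral {g : ℝ → ℂ} (hg : Measurable g) {C a : ℝ}
    (hC : ∀ t, 1 < t → ‖g t‖ ≤ C * t ^ (-a)) {s : ℂ} (hs : 1 - a < s.re) :
    DifferentiableAt ℂ (fun s : ℂ => ∫ t in Ioi (1 : ℝ), g t * (t : ℂ) ^ (-s)) s := by
  set f : ℝ → ℂ := (Ioi (1 : ℝ)).indicator g with hf
  have hfm : Measurable f := hg.indicator measurableSet_Ioi
  have hkey : (fun s : ℂ => ∫ t in Ioi (1 : ℝ), g t * (t : ℂ) ^ (-s)) =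
      fun s => mellin f (1 - s) := by
    funext z
    unfold mellin
    symm
    rw [setIntegral_eq_of_subset_of_forall_sdiff_eq_zero measurableSet_Ioi
      (Ioi_subset_Ioi zero_le_one)]
    · refine setIntegral_congr_fun measurableSet_Ioi fun t ht => ?_
      simp only [hf, indicator_of_mem ht, smul_eq_mul]
      rw [mul_comm]; congr 2; ring
    · intro t ht
      simp [hf, indicator_of_notMem ht.2]
  have hbd : ∀ t, ‖f t‖ ≤ |C| * (Ioi (1 : ℝ)).indicator (fun t => t ^ (-a)) t := by
    intro t
    by_cases ht : t ∈ Ioi (1 : ℝ)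
    · simp only [hf, indicator_of_mem ht]
      refine (hC t ht).trans ?_
      gcongr
      · exact Real.rpow_nonneg (zero_le_one.trans (le_of_lt ht)) _
      · exact le_abs_self C
    · simp [hf, indicator_of_notMem ht]
  have hloc : LocallyIntegrableOn f (Ioi 0) := by
    have hcont : ContinuousOn (fun t : ℝ => |C| * t ^ (-a)) (Ioi 0) := fun t ht =>
      ((continuousAt_const).mul (Real.continuousAt_rpow_const t (-a)
        (Or.inl (ne_of_gt ht)))).continuousWithinAt
    refine (hcont.locallyIntegrableOn measurableSet_Ioi).mono hfm.aestronglyMeasurable ?_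
    refine Eventually.of_forall fun t => (hbd t).trans ?_
    by_cases ht : t ∈ Ioi (1 : ℝ)
    · rw [indicator_of_mem ht]; exact le_abs_self _
    · rw [indicator_of_notMem ht, mul_zero]; exact norm_nonneg _
  rw [hkey]
  have hd : DifferentiableAt ℂ (mellin f) (1 - s) := by
    refine mellin_differentiableAt_of_isBigO_rpow (a := a) (b := (1 - s.re) - 1) hloc ?_ ?_ ?_ ?_
    · refine IsBigO.of_bound |C| ?_
      filter_upwards [eventually_gt_atTop (1 : ℝ)] with t ht
      refine (hbd t).trans ?_
      rw [indicator_of_mem (show t ∈ Ioi (1:ℝ) from ht)]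
      gcongr
      exact le_abs_self _
    · simp; linarith
    · refine IsBigO.of_bound 0 ?_
      have : Iio (1 : ℝ) ∈ 𝓝[>] (0 : ℝ) := mem_nhdsWithin_of_mem_nhds (Iio_mem_nhds one_pos)
      filter_upwards [this] with t ht
      have ht' : t < 1 := ht
      have : t ∉ Ioi (1 : ℝ) := notMem_Ioi.2 ht'.le
      simp [hf, indicator_of_notMem this]
    · simp
  exact hd.comp s ((differentiableAt_const 1).sub differentiableAt_id)

lemma eqOn_re_pos_of_eqOn_re_gt_one {f g : ℂ → ℂ}
    (hf : ∀ s : ℂ, 0 < s.re → DifferentiableAt ℂ f s)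
    (hg : ∀ s : ℂ, 0 < s.re → DifferentiableAt ℂ g s)
    (h : ∀ s : ℂ, 1 < s.re → f s = g s) {s : ℂ} (hs : 0 < s.re) : f s = g s := by
  have ho : IsOpen {s : ℂ | 0 < s.re} := isOpen_lt continuous_const continuous_re
  have hfa : AnalyticOnNhd ℂ f {s : ℂ | 0 < s.re} :=
    DifferentiableOn.analyticOnNhd (fun z hz => (hf z hz).differentiableWithinAt) ho
  have hga : AnalyticOnNhd ℂ g {s : ℂ | 0 < s.re} :=
    DifferentiableOn.analyticOnNhd (fun z hz => (hg z hz).differentiableWithinAt) ho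
  refine hfa.eqOn_of_preconnected_of_eventuallyEq hga (convex_halfSpace_re_gt 0).isPreconnected
    (z₀ := 2) (by simp) ?_ hs
  filter_upwards [(isOpen_lt continuous_const continuous_re).mem_nhds
    (show (2 : ℂ) ∈ {s : ℂ | 1 < s.re} by simp)] with z hz using h z hz

lemma regZeta_eq_sub_integral_fract {s : ℂ} (hs : 0 < s.re) :
    regZeta s = s - s * (s - 1) *
      ∫ t in Ioi (1 : ℝ), ((Int.fract t : ℝ) : ℂ) * (t : ℂ) ^ (-(s + 1)) := by
  have hm : Measurable (fun t : ℝ => ((Int.fract t : ℝ) : ℂ)) :=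
    measurable_ofReal.comp measurable_fract
  have hb : ∀ t : ℝ, 1 < t → ‖((Int.fract t : ℝ) : ℂ)‖ ≤ 1 * t ^ (-(0 : ℝ)) := by
    intro t _
    simp [abs_of_nonneg (Int.fract_nonneg t), (Int.fract_lt_one t).le]
  refine eqOn_re_pos_of_eqOn_re_gt_one (g := fun s => s - s * (s - 1) *
      ∫ t in Ioi (1 : ℝ), ((Int.fract t : ℝ) : ℂ) * (t : ℂ) ^ (-(s + 1)))
    (fun z hz => differentiableAt_regZeta (ne_zero_of_re_pos' hz)) (fun z hz => ?_) ?_ hs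
  · have := (differentiableAt_tailIntegral hm hb (s := z + 1) (by simp; linarith)).comp z
      (differentiableAt_id.add_const 1)
    exact differentiableAt_id.sub
      ((differentiableAt_id.mul (differentiableAt_id.sub_const 1)).mul this)
  · intro z hz
    have hz1 : z ≠ 1 := by rintro rfl; simp at hz
    have hz0 : z ≠ 0 := ne_zero_of_re_pos' (by linarith)
    have hz1' : z - 1 ≠ 0 := sub_ne_zero.2 hz1
    rw [regZeta_eq hz0 hz1, ← LSeries_one_eq_riemannZeta hz,
      LSeries_eq_mul_integral 1 zero_le_one hz (LSeriesSummable_one_iff.2 hz) (by simpa using isBigO_of_le _ (by simp))]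
    have hi1 : IntegrableOn (fun t : ℝ => (t : ℂ) ^ (-z)) (Ioi 1) :=
      integrableOn_Ioi_cpow_of_lt (by simpa using hz) one_pos
    have hi2 : IntegrableOn (fun t : ℝ => ((Int.fract t : ℝ) : ℂ) * (t : ℂ) ^ (-(z + 1))) (Ioi 1) := by
      refine Integrable.bdd_mul (c := 1) (integrableOn_Ioi_cpow_of_lt (by simp; linarith) one_pos)
        hm.aestronglyMeasurable (Eventually.of_forall fun t => ?_)
      simp [abs_of_nonneg (Int.fract_nonneg t), (Int.fract_lt_one t).le]
    have : ∫ t in Ioi (1 : ℝ), (∑ k ∈ Finset.Icc 1 ⌊t⌋₊, (1 : ℕ → ℂ) k) * (t : ℂ) ^ (-(z + 1)) =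
        (∫ t in Ioi (1 : ℝ), (t : ℂ) ^ (-z)) -
        ∫ t in Ioi (1 : ℝ), ((Int.fract t : ℝ) : ℂ) * (t : ℂ) ^ (-(z + 1)) := by
      rw [← integral_sub hi1 hi2]
      refine setIntegral_congr_fun measurableSet_Ioi fun t ht => ?_
      have ht0 : (0 : ℝ) < t := one_pos.trans ht
      have htc : (t : ℂ) ≠ 0 := ofReal_ne_zero.2 ht0.ne'
      have h1 : (t : ℂ) ^ (-z) = t * (t : ℂ) ^ (-(z + 1)) := by
        rw [show -z = 1 + -(z + 1) by ring, cpow_add _ _ htc, cpow_one]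
      have h2 : ((Int.fract t : ℝ) : ℂ) = t - (⌊t⌋₊ : ℂ) := by
        rw [← Int.self_sub_floor, ← natCast_floor_eq_intCast_floor ht0.le]
        push_cast; rfl
      simp only [Pi.one_apply, Finset.sum_const, Nat.card_Icc, Nat.add_sub_cancel, nsmul_eq_mul,
        mul_one]
      rw [h1, h2]; ring
    rw [this, integral_Ioi_cpow_of_lt (by simpa using hz) one_pos]
    simp only [ofReal_one, one_cpow]
    have hz2 : -z + 1 ≠ 0 := by contrapose! hz1'; linear_combination -hz1'
    field_simp
    ring

lemma norm_regZeta_le {δ : ℝ} (hδ : 0 < δ) : ∃ C : ℝ, 0 < C ∧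
    ∀ s : ℂ, δ ≤ s.re → ‖regZeta s‖ ≤ C * (1 + ‖s‖) ^ 2 := by
  refine ⟨1 + 1 / δ, by positivity, fun s hs => ?_⟩
  rw [regZeta_eq_sub_integral_fract (hδ.trans_le hs)]
  set T := ∫ t in Ioi (1 : ℝ), ((Int.fract t : ℝ) : ℂ) * (t : ℂ) ^ (-(s + 1))
  have hT : ‖T‖ ≤ 1 / δ := by
    have h1 : ‖T‖ ≤ ∫ t in Ioi (1 : ℝ), t ^ (-(δ + 1)) := by
      refine norm_integral_le_of_norm_le (integrableOn_Ioi_rpow_of_lt (by linarith) one_pos) ?_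
      filter_upwards [ae_restrict_mem measurableSet_Ioi] with t ht
      have ht1 : (1 : ℝ) < t := ht
      rw [norm_mul, norm_cpow_eq_rpow_re_of_pos (one_pos.trans ht1)]
      have h2 : ‖((Int.fract t : ℝ) : ℂ)‖ ≤ 1 := by
        simp [abs_of_nonneg (Int.fract_nonneg t), (Int.fract_lt_one t).le]
      calc _ ≤ 1 * t ^ (-(s + 1)).re := by gcongr
        _ ≤ _ := by
          rw [one_mul]
          exact Real.rpow_le_rpow_of_exponent_le ht1.le (by simp; linarith)
    rw [integral_Ioi_rpow_of_lt (by linarith) one_pos] at h1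
    refine h1.trans (le_of_eq ?_)
    rw [Real.one_rpow, show -(δ + 1) + 1 = -δ by ring]
    field_simp
  have h1 : ‖s - 1‖ ≤ 1 + ‖s‖ := by
    simpa [add_comm] using norm_sub_le s 1
  calc ‖s - s * (s - 1) * T‖ ≤ ‖s‖ + ‖s‖ * ‖s - 1‖ * ‖T‖ := by
        simpa using norm_sub_le s (s * (s - 1) * T)
    _ ≤ (1 + ‖s‖) ^ 2 + (1 + ‖s‖) * (1 + ‖s‖) * (1 / δ) := by
        gcongr
        · nlinarith [norm_nonneg s]
        · linarith
    _ = _ := by ring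

lemma norm_le_mul_exp_of_ne_zero_of_norm_le {r R : ℝ} (hr : 0 < r) (hrR : r < R) :
    ∃ K : ℝ, 0 < K ∧ ∀ (f : ℂ → ℂ) (c : ℂ) (M : ℝ), 0 < M →
      DifferentiableOn ℂ f (Metric.ball c R) → (∀ z ∈ Metric.ball c R, f z ≠ 0) →
      (∀ z ∈ Metric.ball c R, ‖f z‖ ≤ Real.exp M * ‖f c‖) →
      ∀ s ∈ Metric.closedBall c r, ∀ s' ∈ Metric.closedBall c r,
        ‖f s‖ ≤ ‖f s'‖ * Real.exp (K * M * ‖s - s'‖) := by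
  set ρ := (r + R) / 2 with hρ
  have hρR : 0 < R - ρ := by simp only [hρ]; linarith
  have hρr : 0 < ρ - r := by simp only [hρ]; linarith
  have hρ0 : 0 < ρ := by simp only [hρ]; linarith
  refine ⟨2 * ρ / (R - ρ) / (ρ - r), by positivity, ?_⟩
  intro f c M hM hf hne hbd s hs s' hs'
  have hR : 0 < R := hr.trans hrR
  have hopen : IsOpen (Metric.ball c R) := Metric.isOpen_ball
  have hcm : c ∈ Metric.ball c R := Metric.mem_ball_self hR
  have hlog : DifferentiableOn ℂ (fun z => deriv f z / f z) (Metric.ball c R) :=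
    (hf.deriv hopen).div hf hne
  obtain ⟨G₀, hG₀⟩ := hlog.isExactOn_ball
  set G : ℂ → ℂ := fun z => G₀ z - G₀ c with hGdef
  have hG : ∀ z ∈ Metric.ball c R, HasDerivAt G (deriv f z / f z) z := fun z hz =>
    (hG₀ z hz).sub_const _
  have hGc : G c = 0 := by simp [hGdef]
  have hconst : ∀ z ∈ Metric.ball c R, f z = f c * exp (G z) := by
    have hd : ∀ z ∈ Metric.ball c R, HasDerivAt (fun z => f z * exp (-G z)) 0 z := by
      intro z hz
      have h1 : HasDerivAt f (deriv f z) z := (hf.differentiableAt (hopen.mem_nhds hz)).hasDerivAt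
      have h2 := h1.mul ((hG z hz).neg.cexp)
      refine h2.congr_deriv ?_
      have := hne z hz
      field_simp
      ring
    intro z hz
    have hc := (Metric.isOpen_ball (x := c) (ε := R)).is_const_of_deriv_eq_zero
      (convex_ball c R).isPreconnected
      (fun z hz => (hd z hz).differentiableAt.differentiableWithinAt)
      (fun z hz => (hd z hz).deriv) hz hcm
    simp only [hGc, neg_zero, Complex.exp_zero, mul_one] at hc
    rw [← hc, mul_assoc, ← Complex.exp_add]
    simp
  have hre : ∀ z ∈ Metric.ball c R, (G z).re ≤ M := by
    intro z hz
    have h1 := hbd z hz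
    rw [hconst z hz, norm_mul, Complex.norm_exp, mul_comm] at h1
    have h2 : 0 < ‖f c‖ := norm_pos_iff.2 (hne c hcm)
    exact Real.exp_le_exp.1 (le_of_mul_le_mul_right h1 h2)
  have hGd : DifferentiableOn ℂ G (Metric.ball c R) := fun z hz =>
    (hG z hz).differentiableAt.differentiableWithinAt
  have hBC : ∀ z ∈ Metric.closedBall c ρ, ‖G z‖ ≤ M * (2 * ρ / (R - ρ)) := by
    intro z hz
    have hz' : ‖z - c‖ ≤ ρ := by simpa [dist_eq_norm] using hz
    have h1 := Complex.borelCaratheodory_zero (f := fun u => G (c + u)) (R := R) (M := M)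
      (z := z - c) hM ?_ ?_ hR ?_ ?_
    · simp only [add_sub_cancel] at h1
      refine h1.trans ?_
      rw [mul_div_assoc, show M * (2 * ρ / (R - ρ)) = 2 * M * (ρ / (R - ρ)) by ring]
      gcongr 2 * M * ?_
      apply div_le_div₀ hρ0.le hz' hρR
      linarith
    · intro u hu
      have hu' : c + u ∈ Metric.ball c R := by simpa [dist_eq_norm] using hu
      have := (hG _ hu').differentiableAt
      exact (this.comp u (by fun_prop)).differentiableWithinAt
    · intro u hu
      have hu' : c + u ∈ Metric.ball c R := by simpa [dist_eq_norm] using hu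
      exact hre _ hu'
    · simp only [Metric.mem_ball, dist_zero_right]; linarith
    · simpa using hGc
  have hder : ∀ z ∈ Metric.closedBall c r, ‖deriv G z‖ ≤ M * (2 * ρ / (R - ρ)) / (ρ - r) := by
    intro z hz
    have hsub : Metric.closedBall z (ρ - r) ⊆ Metric.closedBall c ρ :=
      Metric.closedBall_subset_closedBall' (by
        have : dist z c ≤ r := hz
        linarith)
    refine Complex.norm_deriv_le_of_forall_mem_sphere_norm_le hρr ?_ ?_
    · refine (hGd.mono ?_).diffContOnCl
      rw [closure_ball _ hρr.ne']
      exact hsub.trans (Metric.closedBall_subset_ball (by linarith))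
    · intro u hu
      exact hBC u (hsub (Metric.sphere_subset_closedBall hu))
  have hmv := Convex.norm_image_sub_le_of_norm_deriv_le (𝕜 := ℂ) (f := G)
    (s := Metric.closedBall c r) (x := s') (y := s)
    (fun z hz => (hG z (Metric.closedBall_subset_ball hrR hz)).differentiableAt) hder
    (convex_closedBall c r) hs' hs
  rw [hconst s (Metric.closedBall_subset_ball hrR hs),
    hconst s' (Metric.closedBall_subset_ball hrR hs'), norm_mul, norm_mul, mul_assoc,
    Complex.norm_exp, Complex.norm_exp, ← Real.exp_add]
  gcongr
  have h3 := (Complex.re_le_norm (G s - G s')).trans hmv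
  rw [Complex.sub_re] at h3
  have : M * (2 * ρ / (R - ρ)) / (ρ - r) * ‖s - s'‖ =
    2 * ρ / (R - ρ) / (ρ - r) * M * ‖s - s'‖ := by ring
  linarith

lemma regZeta_ne_zero (hRH : RiemannHypothesis) {s : ℂ} (hs : 1 / 2 < s.re) : regZeta s ≠ 0 := by
  by_cases h1 : s = 1
  · simp [h1, regZeta_one]
  have h0 : s ≠ 0 := ne_zero_of_re_pos' (by linarith)
  rw [regZeta_eq h0 h1]
  refine mul_ne_zero (sub_ne_zero.2 h1) fun hz => ?_
  have := hRH s hz ?_ h1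
  · linarith
  · rintro ⟨n, rfl⟩
    simp at hs
    have : (0 : ℝ) ≤ n := n.cast_nonneg
    linarith

lemma exists_norm_inv_riemannZeta_le {σ : ℝ} (hσ : 1 < σ) :
    ∃ C : ℝ, 0 < C ∧ ∀ s : ℂ, σ ≤ s.re → ‖(riemannZeta s)⁻¹‖ ≤ C := by
  set F : ℕ → ℂ := fun n => ((ArithmeticFunction.moebius n : ℤ) : ℂ) with hF
  have hsum : LSeriesSummable F (σ : ℂ) :=
    ArithmeticFunction.LSeriesSummable_moebius_iff.2 (by simpa using hσ)
  refine ⟨∑' n, ‖LSeries.term F (σ : ℂ) n‖ + 1, ?_, ?_⟩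
  · have : 0 ≤ ∑' n, ‖LSeries.term F (σ : ℂ) n‖ := tsum_nonneg fun _ => norm_nonneg _
    linarith
  · intro s hs
    have hs1 : 1 < s.re := hσ.trans_le hs
    have h1 : riemannZeta s * LSeries F s = 1 := by
      rw [← LSeries_one_eq_riemannZeta hs1]
      exact LSeries_one_mul_Lseries_moebius hs1
    rw [inv_eq_of_mul_eq_one_right h1]
    have hsum' : Summable fun n => ‖LSeries.term F (σ : ℂ) n‖ := hsum.norm
    have hle : ∀ n, ‖LSeries.term F s n‖ ≤ ‖LSeries.term F (σ : ℂ) n‖ := fun n =>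
      LSeries.norm_term_le_of_re_le_re F (by simpa using hs) n
    have h2 : ‖LSeries F s‖ ≤ ∑' n, ‖LSeries.term F (σ : ℂ) n‖ :=
      tsum_of_norm_bounded hsum'.hasSum hle
    linarith

lemma exists_le_norm_regZeta_of_two_le :
    ∃ c : ℝ, 0 < c ∧ ∀ s : ℂ, 2 ≤ s.re → c ≤ ‖regZeta s‖ := by
  obtain ⟨C, hC, h⟩ := exists_norm_inv_riemannZeta_le (σ := 2) (by norm_num)
  refine ⟨C⁻¹, by positivity, fun s hs => ?_⟩
  have h0 : s ≠ 0 := ne_zero_of_re_pos' (by linarith)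
  have h1 : s ≠ 1 := by rintro rfl; simp at hs
  have hz : riemannZeta s ≠ 0 := riemannZeta_ne_zero_of_one_le_re (by linarith)
  have h2 := h s hs
  rw [norm_inv] at h2
  have h3 : C⁻¹ ≤ ‖riemannZeta s‖ := inv_le_of_inv_le₀ (norm_pos_iff.2 hz) h2
  have h4 : 1 ≤ ‖s - 1‖ := by
    have := Complex.re_le_norm (s - 1)
    simp at this
    linarith
  rw [regZeta_eq h0 h1, norm_mul]
  nlinarith [inv_pos.2 hC]

/-- Under the Riemann hypothesis, `regZeta` varies by at most a small power of the height over
small distances. -/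
lemma exists_norm_regZeta_le_mul_rpow (hRH : RiemannHypothesis) {δ : ℝ} (hδ : 0 < δ)
    (hδ' : δ < 3 / 2) :
    ∃ K : ℝ, 0 < K ∧ ∀ t : ℝ, ∀ s ∈ Metric.closedBall (2 + t * I : ℂ) (3 / 2 - δ),
      ∀ s' ∈ Metric.closedBall (2 + t * I : ℂ) (3 / 2 - δ),
        ‖regZeta s‖ ≤ ‖regZeta s'‖ * (2 + |t|) ^ (K * ‖s - s'‖) := by
  obtain ⟨K, hK, hA⟩ := norm_le_mul_exp_of_ne_zero_of_norm_le (r := 3 / 2 - δ) (R := 3 / 2)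
    (by linarith) (by linarith)
  obtain ⟨C, hC, hub⟩ := norm_regZeta_le (δ := 1 / 2) (by norm_num)
  obtain ⟨c, hc, hlb⟩ := exists_le_norm_regZeta_of_two_le
  set D := 16 * C / c + 1 with hD
  have hD1 : 1 ≤ D := by
    have : 0 ≤ 16 * C / c := by positivity
    linarith
  refine ⟨K * (2 + Real.log D / Real.log 2), ?_, ?_⟩
  · have : 0 ≤ Real.log D / Real.log 2 := div_nonneg (Real.log_nonneg hD1) (Real.log_nonneg (by norm_num))
    positivity
  intro t s hs s' hs'
  have hX : (2 : ℝ) ≤ 2 + |t| := by linarith [abs_nonneg t]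
  set X := 2 + |t| with hXdef
  have hX0 : 0 < X := by linarith
  have hlogX : Real.log 2 ≤ Real.log X := Real.log_le_log (by norm_num) hX
  have hlog2 : 0 < Real.log 2 := Real.log_pos (by norm_num)
  have hreball : ∀ z ∈ Metric.ball (2 + t * I : ℂ) (3 / 2), 1 / 2 < z.re := by
    intro z hz
    have h1 : ‖z - (2 + t * I)‖ < 3 / 2 := by simpa [dist_eq_norm] using hz
    have h2 := (abs_le.1 (Complex.abs_re_le_norm (z - (2 + t * I)))).1
    simp at h2
    linarith
  set M := (2 + Real.log D / Real.log 2) * Real.log X with hM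
  have hDX : D * X ^ 2 ≤ Real.exp M := by
    have h1 : Real.log D ≤ Real.log D / Real.log 2 * Real.log X := by
      rw [div_mul_eq_mul_div, le_div_iff₀ hlog2]
      exact mul_le_mul_of_nonneg_left hlogX (Real.log_nonneg hD1)
    have h2 : D * X ^ 2 = Real.exp (Real.log D + 2 * Real.log X) := by
      rw [Real.exp_add, Real.exp_log (by linarith), two_mul, Real.exp_add, Real.exp_log hX0, pow_two]
    rw [h2]
    apply Real.exp_le_exp.2
    rw [hM]; linarith
  have hMpos : 0 < M := by
    have : 0 ≤ Real.log D / Real.log 2 := div_nonneg (Real.log_nonneg hD1) hlog2.le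
    have : 0 < Real.log X := hlog2.trans_le hlogX
    positivity
  have key := hA regZeta (2 + t * I) M hMpos ?_ ?_ ?_ s hs s' hs'
  · refine key.trans_eq ?_
    rw [Real.rpow_def_of_pos hX0, hM]
    ring_nf
  · intro z hz
    exact (differentiableAt_regZeta (ne_zero_of_re_pos' (by linarith [hreball z hz]))).differentiableWithinAt
  · intro z hz
    exact regZeta_ne_zero hRH (hreball z hz)
  · intro z hz
    have h1 : ‖z - (2 + t * I)‖ < 3 / 2 := by simpa [dist_eq_norm] using hz
    have h2 : ‖z‖ ≤ 3 / 2 + (2 + |t|) := by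
      calc ‖z‖ = ‖(z - (2 + t * I)) + (2 + t * I)‖ := by ring_nf
        _ ≤ ‖z - (2 + t * I)‖ + (‖(2 : ℂ)‖ + ‖t * I‖) :=
          (norm_add_le _ _).trans (by gcongr; exact norm_add_le _ _)
        _ ≤ 3 / 2 + (2 + |t|) := by simp; linarith
    have h3 := hub z (hreball z hz).le
    have h4 := hlb (2 + t * I) (by simp)
    calc ‖regZeta z‖ ≤ C * (1 + ‖z‖) ^ 2 := h3
      _ ≤ C * (4 * X) ^ 2 := by gcongr; linarith
      _ = (16 * C / c) * X ^ 2 * c := by field_simp; ring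
      _ ≤ D * X ^ 2 * c := by gcongr; linarith
      _ ≤ Real.exp M * ‖regZeta (2 + t * I)‖ := by gcongr

lemma exists_le_norm_regZeta (hRH : RiemannHypothesis) {δ : ℝ} (hδ : 0 < δ) (hδ' : δ < 3 / 2) :
    ∃ c K : ℝ, 0 < c ∧ 0 < K ∧ ∀ s : ℂ, 1 / 2 + δ ≤ s.re →
      c * (2 + |s.im|) ^ (-K) ≤ ‖regZeta s‖ := by
  obtain ⟨K, hK, hA⟩ := exists_norm_regZeta_le_mul_rpow hRH hδ hδ'
  obtain ⟨c, hc, hlb⟩ := exists_le_norm_regZeta_of_two_le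
  refine ⟨c, K * (3 / 2), hc, by positivity, fun s hs => ?_⟩
  have hX : (1 : ℝ) ≤ 2 + |s.im| := by linarith [abs_nonneg s.im]
  rcases le_total 2 s.re with h2 | h2
  · refine le_trans ?_ (hlb s h2)
    have : (2 + |s.im|) ^ (-(K * (3 / 2))) ≤ 1 :=
      Real.rpow_le_one_of_one_le_of_nonpos hX (by linarith)
    nlinarith
  · have hd : ‖(2 + s.im * I : ℂ) - s‖ = 2 - s.re := by
      have : (2 + s.im * I : ℂ) - s = ((2 - s.re : ℝ) : ℂ) := by
        apply Complex.ext <;> simp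
      rw [this, Complex.norm_real, Real.norm_of_nonneg (by linarith)]
    have h3 := hA s.im (2 + s.im * I) (Metric.mem_closedBall_self (by linarith)) s
      (by rw [Metric.mem_closedBall, dist_comm, dist_eq_norm, hd]; linarith)
    rw [hd] at h3
    have h4 : (2 + |s.im|) ^ (K * (2 - s.re)) ≤ (2 + |s.im|) ^ (K * (3 / 2)) :=
      Real.rpow_le_rpow_of_exponent_le hX (by gcongr; linarith)
    have h5 := hlb (2 + s.im * I) (by simp)
    rw [Real.rpow_neg (by linarith), ← div_eq_mul_inv, div_le_iff₀ (by positivity)]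
    calc c ≤ _ := h5
      _ ≤ _ := h3
      _ ≤ _ := by gcongr

lemma exists_norm_Gamma_le_mul_norm_Gamma_add {x₀ a : ℝ} (hx₀ : 0 < x₀) (ha : 0 < a) :
    ∃ C : ℝ, 0 < C ∧ ∀ u : ℂ, x₀ ≤ u.re → ‖Gamma u‖ ≤ C * ‖Gamma (u + a)‖ := by
  set C := ∫ x in (0 : ℝ)..1, ‖(x : ℂ) ^ ((x₀ : ℂ) - 1) * (1 - x : ℂ) ^ ((a : ℂ) - 1)‖ with hC
  have hC0 : 0 ≤ C := intervalIntegral.integral_nonneg (by norm_num) fun _ _ => norm_nonneg _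
  have hGa : 0 < Real.Gamma a := Real.Gamma_pos_of_pos ha
  have h_integrable := (Complex.betaIntegral_convergent (u := x₀) (v := a) (by simpa) (by simpa)).norm
  refine ⟨(C + 1) / Real.Gamma a, by positivity, fun u hu => ?_⟩
  have hu0 : 0 < u.re := hx₀.trans_le hu
  have h1 := Complex.Gamma_mul_Gamma_eq_betaIntegral (s := u) (t := a) hu0 (by simpa)
  have h2 : ‖betaIntegral u a‖ ≤ C := by
    rw [betaIntegral]
    refine intervalIntegral.norm_integral_le_of_norm_le (by norm_num) ?_ h_integrable
    filter_upwards with x hx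
    rw [norm_mul, norm_mul]
    gcongr ?_ * _
    rw [Complex.norm_cpow_eq_rpow_re_of_pos hx.1, Complex.norm_cpow_eq_rpow_re_of_pos hx.1]
    apply Real.rpow_le_rpow_of_exponent_ge hx.1 hx.2
    simpa using hu
  have h3 : ‖Gamma u‖ * Real.Gamma a = ‖Gamma (u + a)‖ * ‖betaIntegral u a‖ := by
    rw [← norm_mul, ← h1, norm_mul, Complex.Gamma_ofReal, Complex.norm_real,
      Real.norm_of_nonneg hGa.le]
  rw [div_mul_eq_mul_div, le_div_iff₀ hGa, h3, mul_comm]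
  gcongr
  linarith

lemma concaveOn_log_sq_add_sq {X y : ℝ} (hX : 0 < X) (hy : |y| ≤ X) :
    ConcaveOn ℝ (Ici X) fun s : ℝ => Real.log (s ^ 2 + y ^ 2) := by
  have hpos : ∀ s, X ≤ s → 0 < s ^ 2 + y ^ 2 := fun s hs => by
    have : 0 < s := hX.trans_le hs
    positivity
  have hder : ∀ s, X ≤ s → HasDerivAt (fun s : ℝ => Real.log (s ^ 2 + y ^ 2))
      (2 * s / (s ^ 2 + y ^ 2)) s := fun s hs => by
    have h := (((hasDerivAt_pow 2 s).add_const (y ^ 2)).log (hpos s hs).ne')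
    simpa using h
  refine AntitoneOn.concaveOn_of_deriv (convex_Ici X)
    (fun s hs => (hder s hs).continuousAt.continuousWithinAt) ?_ ?_
  · rw [interior_Ici]
    exact fun s hs => (hder s (le_of_lt hs)).differentiableAt.differentiableWithinAt
  · rw [interior_Ici]
    intro s hs t ht hst
    have hs' : X ≤ s := le_of_lt hs
    have ht' : X ≤ t := le_of_lt ht
    rw [(hder s hs').deriv, (hder t ht').deriv, div_le_div_iff₀ (hpos t ht') (hpos s hs')]
    have h1 : y ^ 2 ≤ X * X := by nlinarith [sq_abs y, abs_nonneg y]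
    have h2 : X * X ≤ s * t := mul_le_mul hs' ht' hX.le (by linarith)
    nlinarith [mul_nonneg (sub_nonneg.2 hst) (sub_nonneg.2 (h1.trans h2))]

lemma rpow_mul_rpow_le_norm_add {v : ℂ} (hv : 0 < v.re) (hv' : |v.im| ≤ v.re) {a : ℝ}
    (ha0 : 0 ≤ a) (ha1 : a ≤ 1) : ‖v‖ ^ (1 - a) * ‖v + 1‖ ^ a ≤ ‖v + a‖ := by
  have key := (concaveOn_log_sq_add_sq hv hv').2 (x := v.re) (y := v.re + 1) (by simp) (by simp)
    (sub_nonneg.2 ha1) ha0 (by ring)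
  have hn : ∀ b : ℝ, 0 ≤ b → 0 < ‖v + b‖ ∧ Real.log ((v.re + b) ^ 2 + v.im ^ 2) =
      2 * Real.log ‖v + b‖ := fun b hb => by
    have h1 : (v.re + b) ^ 2 + v.im ^ 2 = ‖v + b‖ ^ 2 := by
      rw [← Complex.normSq_eq_norm_sq, Complex.normSq_apply]; simp; ring
    refine ⟨norm_pos_iff.2 (ne_zero_of_re_pos' (by simp; linarith)), ?_⟩
    rw [h1, Real.log_pow]; simp
  have h0 := hn 0 le_rfl
  have h1 := hn 1 zero_le_one
  have h2 := hn a ha0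
  have e : (1 - a) • v.re + a • (v.re + 1) = v.re + a := by simp; ring
  simp only [e, h1.2, h2.2] at key
  simp only [ofReal_zero, add_zero, ofReal_one] at h0 h1 key
  rw [h0.2] at key
  simp only [smul_eq_mul] at key
  rw [Real.rpow_def_of_pos h0.1, Real.rpow_def_of_pos h1.1, ← Real.exp_add, ← Real.le_log_iff_exp_le h2.1]
  linarith

lemma norm_Gamma_add_le {u : ℂ} (hu : 0 < u.re) {J : ℕ} (hJ : |u.im| ≤ u.re + J) {a : ℝ}
    (ha0 : 0 ≤ a) (ha1 : a ≤ 1) : ‖Gamma (u + a)‖ ≤ ‖Gamma u‖ * ‖u + J‖ ^ a := by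
  have hpos : ∀ b : ℝ, 0 ≤ b → 0 < ‖u + b‖ := fun b hb =>
    norm_pos_iff.2 (ne_zero_of_re_pos' (by simp; linarith))
  have hposn : ∀ n : ℕ, 0 < ‖u + n‖ := fun n => by simpa using hpos n n.cast_nonneg
  have hratio1 : ∀ j : ℕ, ‖u + j‖ / ‖u + a + j‖ ≤ 1 := fun j => by
    have h1 : ‖u + j‖ ≤ ‖u + a + j‖ := by
      rw [← sq_le_sq₀ (norm_nonneg _) (norm_nonneg _), ← Complex.normSq_eq_norm_sq,
        ← Complex.normSq_eq_norm_sq, Complex.normSq_apply, Complex.normSq_apply]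
      simp
      have : (0 : ℝ) ≤ j := j.cast_nonneg
      nlinarith
    exact div_le_one_of_le₀ h1 (norm_nonneg _)
  have hratio2 : ∀ j : ℕ, J ≤ j → ‖u + j‖ / ‖u + a + j‖ ≤ ‖u + j‖ ^ a / ‖u + (j + 1 : ℕ)‖ ^ a := by
    intro j hj
    have hj' : (J : ℝ) ≤ j := by exact_mod_cast hj
    have h1 := rpow_mul_rpow_le_norm_add (v := u + j) (by simp; positivity) (by simp; linarith) ha0 ha1
    have e1 : u + j + a = u + a + j := by ring
    have e2 : u + j + 1 = u + (j + 1 : ℕ) := by push_cast; ring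
    rw [e1, e2] at h1
    have hp := hposn j
    have hp1 := hposn (j + 1)
    have hp2 : 0 < ‖u + a + j‖ := by
      rw [← e1]
      have := hpos (j + a) (by positivity)
      push_cast at this
      rwa [← add_assoc] at this
    rw [div_le_div_iff₀ hp2 (by positivity)]
    calc ‖u + j‖ * ‖u + (j + 1 : ℕ)‖ ^ a
        = ‖u + j‖ ^ a * (‖u + j‖ ^ (1 - a) * ‖u + (j + 1 : ℕ)‖ ^ a) := by
          rw [← mul_assoc, ← Real.rpow_add hp]; simp
      _ ≤ _ := by gcongr
  have hprod : ∀ n : ℕ, ∏ j ∈ Finset.range (J + n), ‖u + j‖ / ‖u + a + j‖ ≤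
      ‖u + J‖ ^ a / ‖u + (J + n : ℕ)‖ ^ a := by
    intro n
    induction n with
    | zero =>
      rw [add_zero, div_self (Real.rpow_pos_of_pos (hposn J) a).ne']
      exact Finset.prod_le_one (fun j _ => by positivity) fun j _ => hratio1 j
    | succ n ih =>
      rw [← add_assoc, Finset.prod_range_succ]
      have hp := Real.rpow_pos_of_pos (hposn (J + n)) a
      calc _ ≤ ‖u + J‖ ^ a / ‖u + (J + n : ℕ)‖ ^ a *
            (‖u + (J + n : ℕ)‖ ^ a / ‖u + (J + n + 1 : ℕ)‖ ^ a) := by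
            exact mul_le_mul ih (hratio2 (J + n) (by omega)) (by positivity) (by positivity)
        _ = _ := by field_simp
  have hseq : ∀ n : ℕ, J + 1 ≤ n → ‖GammaSeq (u + a) n‖ ≤ ‖GammaSeq u n‖ * ‖u + J‖ ^ a := by
    intro n hn
    obtain ⟨m, hm⟩ : ∃ m, n + 1 = J + m := ⟨n + 1 - J, by omega⟩
    have hn0 : (0 : ℝ) < n := by exact_mod_cast (by omega : 0 < n)
    have hp := hprod m
    rw [← hm] at hp
    simp only [GammaSeq, norm_div, norm_mul, norm_prod]
    have e1 : ‖(n : ℂ) ^ (u + a)‖ = ‖(n : ℂ) ^ u‖ * (n : ℝ) ^ a := by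
      have := Complex.norm_cpow_eq_rpow_re_of_pos hn0
      rw [show (n : ℂ) = ((n : ℝ) : ℂ) by simp, this, this, ← Real.rpow_add hn0]; simp
    rw [Finset.prod_div_distrib] at hp
    set P := ∏ j ∈ Finset.range (n + 1), ‖u + j‖ with hP
    set P' := ∏ j ∈ Finset.range (n + 1), ‖u + a + j‖ with hP'
    have hPpos : 0 < P := Finset.prod_pos fun j _ => hposn j
    have hp1 := hposn (n + 1)
    have hle : (n : ℝ) ^ a / ‖u + (n + 1 : ℕ)‖ ^ a ≤ 1 := by
      apply div_le_one_of_le₀ _ (by positivity)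
      gcongr
      have := Complex.re_le_norm (u + (n + 1 : ℕ))
      simp at this ⊢
      linarith
    rw [e1]
    calc ‖(n : ℂ) ^ u‖ * (n : ℝ) ^ a * ‖(n.factorial : ℂ)‖ / P'
        = ‖(n : ℂ) ^ u‖ * ‖(n.factorial : ℂ)‖ / P * ((n : ℝ) ^ a * (P / P')) := by field_simp
      _ ≤ ‖(n : ℂ) ^ u‖ * ‖(n.factorial : ℂ)‖ / P *
          ((n : ℝ) ^ a * (‖u + J‖ ^ a / ‖u + (n + 1 : ℕ)‖ ^ a)) := by gcongr
      _ = ‖(n : ℂ) ^ u‖ * ‖(n.factorial : ℂ)‖ / P *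
          (‖u + J‖ ^ a * ((n : ℝ) ^ a / ‖u + (n + 1 : ℕ)‖ ^ a)) := by ring
      _ ≤ ‖(n : ℂ) ^ u‖ * ‖(n.factorial : ℂ)‖ / P * (‖u + J‖ ^ a * 1) := by gcongr
      _ = _ := by ring
  refine le_of_tendsto_of_tendsto (GammaSeq_tendsto_Gamma (u + a)).norm
    ((GammaSeq_tendsto_Gamma u).norm.mul_const _) ?_
  filter_upwards [eventually_ge_atTop (J + 1)] with n hn using hseq n hn

/-- The Riemann `ξ`-function `s (s - 1) Λ(s)`. -/
noncomputable def riemannXi (s : ℂ) : ℂ := s * (s - 1) * completedRiemannZeta₀ s + 1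

lemma differentiable_riemannXi : Differentiable ℂ riemannXi := fun s => by
  have := differentiable_completedZeta₀ s
  unfold riemannXi
  fun_prop

lemma riemannXi_one_sub (s : ℂ) : riemannXi (1 - s) = riemannXi s := by
  rw [riemannXi, completedRiemannZeta₀_one_sub, riemannXi]; ring

lemma riemannXi_eq {s : ℂ} (hs : 0 < s.re) : riemannXi s = s * Gammaℝ s * regZeta s := by
  have h0 := ne_zero_of_re_pos' hs
  have hG := Gammaℝ_ne_zero_of_re_pos hs
  rw [riemannXi, regZeta]
  field_simp

lemma norm_riemannXi {s : ℂ} (hs : 0 < s.re) :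
    ‖riemannXi s‖ = ‖s‖ * Real.pi ^ (-s.re / 2) * ‖Gamma (s / 2)‖ * ‖regZeta s‖ := by
  have h : (-s / 2).re = -s.re / 2 := by simp
  rw [riemannXi_eq hs, norm_mul, norm_mul, Gammaℝ_def, norm_mul,
    Complex.norm_cpow_eq_rpow_re_of_pos Real.pi_pos, h]
  ring

lemma norm_regZeta_conj {s : ℂ} (hs : 0 < s.re) : ‖regZeta (star s)‖ = ‖regZeta s‖ := by
  by_cases h1 : s = 1
  · simp [h1]
  have h0 := ne_zero_of_re_pos' hs
  rw [regZeta_eq h0 h1, regZeta_eq (by simpa using h0) ?_]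
  · change ‖((starRingEnd ℂ) s - 1) * riemannZeta ((starRingEnd ℂ) s)‖ = _
    rw [riemannZeta_conj, ← RCLike.norm_conj ((s - 1) * riemannZeta s)]
    simp
  · intro h
    apply h1
    rw [← star_star s, h, star_one]

lemma norm_riemannXi_conj {s : ℂ} (hs : 0 < s.re) : ‖riemannXi (star s)‖ = ‖riemannXi s‖ := by
  have h : (star s).re = s.re := by simp
  rw [norm_riemannXi hs, norm_riemannXi (by rwa [h]), norm_regZeta_conj hs, h, norm_star]
  have : star s / 2 = (starRingEnd ℂ) (s / 2) := by
    rw [map_div₀, Complex.conj_ofNat]; rfl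
  rw [this, Complex.Gamma_conj, RCLike.norm_conj]

lemma riemannXi_ne_zero (hRH : RiemannHypothesis) {s : ℂ} (hs : 1 / 2 < s.re) :
    riemannXi s ≠ 0 := by
  have hs0 : 0 < s.re := by linarith
  rw [riemannXi_eq hs0]
  exact mul_ne_zero (mul_ne_zero (ne_zero_of_re_pos' hs0) (Gammaℝ_ne_zero_of_re_pos hs0))
    (regZeta_ne_zero hRH hs)

lemma exists_norm_riemannZeta_le {σ : ℝ} (hσ : 1 < σ) :
    ∃ C : ℝ, 0 < C ∧ ∀ s : ℂ, σ ≤ s.re → ‖riemannZeta s‖ ≤ C := by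
  have hsum : LSeriesSummable 1 (σ : ℂ) := LSeriesSummable_one_iff.2 (by simpa using hσ)
  refine ⟨∑' n, ‖LSeries.term 1 (σ : ℂ) n‖ + 1, ?_, ?_⟩
  · have : 0 ≤ ∑' n, ‖LSeries.term 1 (σ : ℂ) n‖ := tsum_nonneg fun _ => norm_nonneg _
    linarith
  · intro s hs
    rw [← LSeries_one_eq_riemannZeta (hσ.trans_le hs)]
    have h2 : ‖LSeries 1 s‖ ≤ ∑' n, ‖LSeries.term 1 (σ : ℂ) n‖ :=
      tsum_of_norm_bounded hsum.norm.hasSum fun n =>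
        LSeries.norm_term_le_of_re_le_re 1 (by simpa using hs) n
    linarith

/-- `|ξ(w)| ≤ |ξ(w + 2 a)|` to the right of the line `Re w = 1/2 - a`, under RH. -/
lemma norm_riemannXi_sub_le (hRH : RiemannHypothesis) {a : ℝ} (ha : 0 < a) (ha' : a < 1 / 2)
    {z : ℂ} (hz : 1 / 2 ≤ z.re) : ‖riemannXi (z - a)‖ ≤ ‖riemannXi (z + a)‖ := by
  obtain ⟨C₁, hC₁, hΓ⟩ := exists_norm_Gamma_le_mul_norm_Gamma_add (x₀ := (1 / 2 - a) / 2) (a := a)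
    (by linarith) ha
  obtain ⟨C₂, hC₂, hub⟩ := norm_regZeta_le (δ := 1 / 2 - a) (by linarith)
  obtain ⟨c, K, hc, hK, hlb⟩ := exists_le_norm_regZeta hRH (δ := a) ha (by linarith)
  obtain ⟨C₃, hC₃, hζ⟩ := exists_norm_riemannZeta_le (σ := 2) (by norm_num)
  obtain ⟨C₄, hC₄, hζinv⟩ := exists_norm_inv_riemannZeta_le (σ := 2) (by norm_num)
  set f : ℂ → ℂ := fun u => riemannXi (u + 1 / 2 - a) / riemannXi (u + 1 / 2 + a) with hf
  have hne : ∀ u : ℂ, 0 ≤ u.re → riemannXi (u + 1 / 2 + a) ≠ 0 := fun u hu =>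
    riemannXi_ne_zero hRH (by simp; linarith)
  have hpi : (1 : ℝ) ≤ Real.pi := by linarith [Real.pi_gt_three]
  have hcomp : ∀ u : ℂ, 0 ≤ u.re → ‖f u‖ ≤
      Real.pi ^ a * C₁ * (‖regZeta (u + 1 / 2 - a)‖ / ‖regZeta (u + 1 / 2 + a)‖) := by
    intro u hu
    have h1 : 0 < (u + 1 / 2 - a).re := by simp; linarith
    have h2 : 0 < (u + 1 / 2 + a).re := by simp; linarith
    have hZ : 0 < ‖regZeta (u + 1 / 2 + a)‖ :=
      norm_pos_iff.2 (regZeta_ne_zero hRH (by simp; linarith))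
    have hn : 0 < ‖u + 1 / 2 + a‖ := norm_pos_iff.2 (ne_zero_of_re_pos' h2)
    have hg : 0 < ‖Gamma ((u + 1 / 2 + a) / 2)‖ := norm_pos_iff.2 (Gamma_ne_zero_of_re_pos (by
      simp at h2 ⊢; linarith))
    have e1 : ‖u + 1 / 2 - a‖ ≤ ‖u + 1 / 2 + a‖ := by
      rw [← sq_le_sq₀ (norm_nonneg _) (norm_nonneg _), ← Complex.normSq_eq_norm_sq,
        ← Complex.normSq_eq_norm_sq, Complex.normSq_apply, Complex.normSq_apply]
      simp
      nlinarith
    have e2 : Real.pi ^ (-(u + 1 / 2 - a).re / 2) = Real.pi ^ a * Real.pi ^ (-(u + 1 / 2 + a).re / 2) := by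
      rw [← Real.rpow_add Real.pi_pos]
      congr 1
      simp; ring
    have e3 : ‖Gamma ((u + 1 / 2 - a) / 2)‖ ≤ C₁ * ‖Gamma ((u + 1 / 2 + a) / 2)‖ := by
      have := hΓ ((u + 1 / 2 - a) / 2) (by simp; linarith)
      rwa [show (u + 1 / 2 - a) / 2 + a = (u + 1 / 2 + a) / 2 by ring] at this
    rw [hf, norm_div, norm_riemannXi h1, norm_riemannXi h2, e2]
    have hp : 0 < Real.pi ^ (-(u + 1 / 2 + a).re / 2) := Real.rpow_pos_of_pos Real.pi_pos _
    rw [div_le_iff₀ (by positivity)]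
    calc _ ≤ ‖u + 1 / 2 + a‖ * (Real.pi ^ a * Real.pi ^ (-(u + 1 / 2 + a).re / 2)) *
          (C₁ * ‖Gamma ((u + 1 / 2 + a) / 2)‖) * ‖regZeta (u + 1 / 2 - a)‖ := by gcongr
      _ = _ := by
        generalize ‖regZeta (u + 1 / 2 + a)‖ = A at hZ
        generalize ‖regZeta (u + 1 / 2 - a)‖ = B
        generalize ‖Gamma ((u + 1 / 2 + a) / 2)‖ = D
        field_simp
  have hbound : ∀ y : ℝ, ‖f (y * I)‖ ≤ 1 := by
    intro y
    rw [hf, norm_div]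
    apply div_le_one_of_le₀ _ (norm_nonneg _)
    rw [← riemannXi_one_sub (y * I + 1 / 2 + a)]
    have e : 1 - (y * I + 1 / 2 + a) = star (y * I + 1 / 2 - a : ℂ) := by
      apply Complex.ext <;> simp
      ring
    rw [e, norm_riemannXi_conj (by simp; linarith)]
  have hPL := PhragmenLindelof.right_half_plane_of_bounded_on_real (f := f) (C := 1)
    (z := z - 1 / 2) ?_ ?_ ?_ hbound (by simp; linarith)
  · simp only [hf, sub_add_cancel, norm_div] at hPL
    have := hne (z - 1 / 2) (by simp; linarith)
    rw [sub_add_cancel] at this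
    rwa [div_le_one (norm_pos_iff.2 this)] at hPL
  · apply DifferentiableOn.diffContOnCl
    rw [Complex.closure_setOfPred_lt_re]
    intro u hu
    apply DifferentiableAt.differentiableWithinAt
    have h1 : DifferentiableAt ℂ (fun u : ℂ => riemannXi (u + 1 / 2 - a)) u :=
      (differentiable_riemannXi _).comp u (by fun_prop)
    have h2 : DifferentiableAt ℂ (fun u : ℂ => riemannXi (u + 1 / 2 + a)) u :=
      (differentiable_riemannXi _).comp u (by fun_prop)
    exact h1.div h2 (hne u hu)
  · refine ⟨1, by norm_num, 1, ?_⟩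
    set N := ⌈2 + K⌉₊ with hN
    refine IsBigO.of_bound (Real.pi ^ a * C₁ * (C₂ / c) * (N.factorial * Real.exp 2)) ?_
    rw [eventually_inf_principal]
    refine Eventually.of_forall fun u hu => ?_
    have hu0 : 0 ≤ u.re := le_of_lt hu
    have hY : 1 ≤ 2 + ‖u‖ := by linarith [norm_nonneg u]
    have h1 := hub (u + 1 / 2 - a) (by simp; linarith)
    have h2 := hlb (u + 1 / 2 + a) (by simp; linarith)
    have him : (u + 1 / 2 + a).im = u.im := by simp
    rw [him] at h2
    have e1 : ‖u + 1 / 2 - a‖ ≤ ‖u‖ + 1 := by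
      calc ‖u + 1 / 2 - a‖ = ‖u + ((1 / 2 - a : ℝ) : ℂ)‖ := by push_cast; ring_nf
        _ ≤ ‖u‖ + ‖((1 / 2 - a : ℝ) : ℂ)‖ := norm_add_le _ _
        _ ≤ ‖u‖ + 1 := by
          rw [Complex.norm_real, Real.norm_of_nonneg (by linarith)]; linarith
    have h3 : ‖regZeta (u + 1 / 2 - a)‖ ≤ C₂ * (2 + ‖u‖) ^ (2 : ℝ) := by
      refine h1.trans ?_
      rw [Real.rpow_two]
      exact mul_le_mul_of_nonneg_left (pow_le_pow_left₀ (by positivity) (by linarith) 2) hC₂.le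
    have h4 : c * (2 + ‖u‖) ^ (-K) ≤ ‖regZeta (u + 1 / 2 + a)‖ := by
      refine le_trans ?_ h2
      gcongr ?_ * ?_
      apply Real.rpow_le_rpow_of_nonpos (by positivity) _ (by linarith)
      gcongr
      exact Complex.abs_im_le_norm u
    have h5 : ‖regZeta (u + 1 / 2 - a)‖ / ‖regZeta (u + 1 / 2 + a)‖ ≤
        C₂ / c * (2 + ‖u‖) ^ (2 + K) := by
      calc _ ≤ C₂ * (2 + ‖u‖) ^ (2 : ℝ) / (c * (2 + ‖u‖) ^ (-K)) := by gcongr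
        _ = _ := by
          rw [Real.rpow_add (by linarith), Real.rpow_neg (by linarith)]
          field_simp
    have h6 : (2 + ‖u‖) ^ (2 + K) ≤ N.factorial * Real.exp 2 * Real.exp ‖u‖ := by
      calc (2 + ‖u‖) ^ (2 + K) ≤ (2 + ‖u‖) ^ (N : ℝ) :=
            Real.rpow_le_rpow_of_exponent_le hY (Nat.le_ceil _)
        _ = (2 + ‖u‖) ^ N := Real.rpow_natCast _ _
        _ ≤ N.factorial * Real.exp (2 + ‖u‖) := by
          have := Real.pow_div_factorial_le_exp (2 + ‖u‖) (by linarith) N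
          rwa [div_le_iff₀ (by positivity), mul_comm] at this
        _ = _ := by rw [Real.exp_add]; ring
    rw [one_mul, Real.rpow_one, Real.norm_of_nonneg (Real.exp_pos _).le]
    calc ‖f u‖ ≤ _ := hcomp u hu0
      _ ≤ Real.pi ^ a * C₁ * (C₂ / c * (N.factorial * Real.exp 2 * Real.exp ‖u‖)) := by
        gcongr
        exact h5.trans (by gcongr)
      _ = _ := by ring
  · refine ⟨Real.pi ^ a * C₁ * (C₃ * C₄), ?_⟩
    simp only [eventually_map]
    filter_upwards [eventually_ge_atTop 3] with x hx
    refine (hcomp x (by simp; linarith)).trans ?_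
    gcongr
    have e1 : (x : ℂ) + 1 / 2 - a = ((x + 1 / 2 - a : ℝ) : ℂ) := by push_cast; ring
    have e2 : (x : ℂ) + 1 / 2 + a = ((x + 1 / 2 + a : ℝ) : ℂ) := by push_cast; ring
    have hne1 : ∀ y : ℝ, 2 ≤ y → regZeta y = ((y - 1 : ℝ) : ℂ) * riemannZeta y := fun y hy => by
      rw [regZeta_eq]
      · push_cast; ring
      · exact_mod_cast (by linarith : y ≠ 0)
      · exact_mod_cast (by linarith : y ≠ 1)
    rw [e1, e2, hne1 _ (by linarith), hne1 _ (by linarith), norm_mul, norm_mul, mul_div_mul_comm,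
      Complex.norm_real, Complex.norm_real, Real.norm_of_nonneg (by linarith),
      Real.norm_of_nonneg (by linarith), div_eq_mul_inv ‖riemannZeta _‖, ← norm_inv]
    have h1 := hζ ((x + 1 / 2 - a : ℝ) : ℂ) (by rw [ofReal_re]; linarith)
    have h2 := hζinv ((x + 1 / 2 + a : ℝ) : ℂ) (by rw [ofReal_re]; linarith)
    have h3 : (x + 1 / 2 - a - 1) / (x + 1 / 2 + a - 1) ≤ 1 :=
      div_le_one_of_le₀ (by linarith) (by linarith)
    calc _ ≤ 1 * (C₃ * C₄) := by gcongr
      _ = _ := one_mul _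

/-- A bound for `ζ` on the critical line in terms of `regZeta` to its right, under RH. -/
lemma norm_riemannZeta_le_regZeta_add (hRH : RiemannHypothesis) {ε : ℝ} (hε : 0 < ε)
    (hε' : ε < 1) {w : ℂ} (hw : w.re = 1 / 2) :
    ‖riemannZeta w‖ ≤ 15 * (2 + |w.im|) ^ (ε / 2 - 1) * ‖regZeta (w + ε)‖ := by
  have hw0 : 0 < w.re := by rw [hw]; norm_num
  have hw1 : w ≠ 1 := by rintro rfl; norm_num at hw
  have key := norm_riemannXi_sub_le hRH (a := ε / 2) (z := w + ε / 2) (by linarith) (by linarith)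
    (by simp [hw]; linarith)
  have ea : w + ε / 2 - (ε / 2 : ℝ) = w := by push_cast; ring
  have eb : w + ε / 2 + (ε / 2 : ℝ) = w + ε := by push_cast; ring
  rw [ea, eb, norm_riemannXi hw0, norm_riemannXi (by simp [hw]; linarith),
    regZeta_eq (ne_zero_of_re_pos' hw0) hw1, norm_mul] at key
  set X := 2 + |w.im| with hX
  have hX0 : 0 < X := by have := abs_nonneg w.im; linarith
  set J := ⌈|w.im| / 2⌉₊ with hJ
  have hJ1 : |w.im| / 2 ≤ J := Nat.le_ceil _
  have hJ2 : (J : ℝ) ≤ |w.im| / 2 + 1 := (Nat.ceil_lt_add_one (by positivity)).le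
  have hG := norm_Gamma_add_le (u := w / 2) (by simp; linarith) (J := J) (a := ε / 2)
    (by simp [abs_div, hw]; linarith) (by linarith) (by linarith)
  have eg : w / 2 + (ε / 2 : ℝ) = (w + ε) / 2 := by push_cast; ring
  rw [eg] at hG
  have hwJ : ‖w / 2 + J‖ ≤ X := by
    refine (Complex.norm_le_abs_re_add_abs_im _).trans ?_
    simp [abs_div, hw]
    rw [abs_of_nonneg (by positivity)]
    linarith
  have hwlow : 1 / 2 ≤ ‖w‖ := by
    have := Complex.re_le_norm w; rwa [hw] at this
  have hXw : X ≤ 5 * ‖w‖ := by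
    have := Complex.abs_im_le_norm w
    rw [hX]; linarith
  have hw1n : ‖w - 1‖ = ‖w‖ := by
    rw [← sq_eq_sq₀ (norm_nonneg _) (norm_nonneg _), ← Complex.normSq_eq_norm_sq,
      ← Complex.normSq_eq_norm_sq, Complex.normSq_apply, Complex.normSq_apply]
    simp [hw]; norm_num
  have hwe : ‖w + ε‖ ≤ 3 * ‖w‖ := by
    refine (norm_add_le _ _).trans ?_
    rw [Complex.norm_real, Real.norm_of_nonneg hε.le]; linarith
  have hpi : Real.pi ^ (-(w + ε).re / 2) ≤ Real.pi ^ (-w.re / 2) := by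
    apply Real.rpow_le_rpow_of_exponent_le (by linarith [Real.pi_gt_three])
    simp; linarith
  have hΓ : 0 < ‖Gamma (w / 2)‖ := norm_pos_iff.2 (Gamma_ne_zero_of_re_pos (by simp; linarith))
  have hp : 0 < Real.pi ^ (-w.re / 2) := Real.rpow_pos_of_pos Real.pi_pos _
  have hwpos : 0 < ‖w‖ := by linarith
  rw [hw1n] at key
  have h1 : ‖w‖ * Real.pi ^ (-w.re / 2) * ‖Gamma (w / 2)‖ * (‖w‖ * ‖riemannZeta w‖) ≤
      ‖w‖ * Real.pi ^ (-w.re / 2) * ‖Gamma (w / 2)‖ * (3 * X ^ (ε / 2) * ‖regZeta (w + ε)‖) :=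
    calc _ ≤ _ := key
      _ ≤ (3 * ‖w‖) * Real.pi ^ (-w.re / 2) * (‖Gamma (w / 2)‖ * X ^ (ε / 2)) *
          ‖regZeta (w + ε)‖ := by
        gcongr
        exact hG.trans (by gcongr)
      _ = _ := by ring
  have h2 := le_of_mul_le_mul_left h1 (by positivity)
  have h3 : X * ‖riemannZeta w‖ ≤ 15 * X ^ (ε / 2) * ‖regZeta (w + ε)‖ := by
    nlinarith [norm_nonneg (riemannZeta w)]
  rw [Real.rpow_sub_one hX0.ne', ← mul_div_assoc, div_mul_eq_mul_div, le_div_iff₀ hX0]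
  linarith

/-- The derivative of a family of holomorphic functions with an integrable bound: integrals depend
holomorphically on the parameter. -/
lemma differentiableOn_integral_of_dominated {α : Type*} [MeasurableSpace α] {μ : Measure α}
    {f : ℂ → α → ℂ} {c : ℂ} {R : ℝ} {bound : α → ℝ}
    (hdiff : ∀ a, DifferentiableOn ℂ (f · a) (Metric.ball c R))
    (hmeas : ∀ s ∈ Metric.ball c R, AEStronglyMeasurable (f s) μ)
    (hbound : ∀ s ∈ Metric.ball c R, ∀ a, ‖f s a‖ ≤ bound a) (h_integrable : Integrable bound μ) :
    DifferentiableOn ℂ (fun s => ∫ a, f s a ∂μ) (Metric.ball c R) := by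
  intro s hs
  apply DifferentiableAt.differentiableWithinAt
  obtain ⟨r, hr, hrs⟩ := Metric.isOpen_iff.1 Metric.isOpen_ball s hs
  have hat : ∀ a, ∀ x ∈ Metric.ball s r, HasDerivAt (f · a) (deriv (f · a) x) x := fun a x hx =>
    ((hdiff a).differentiableAt (Metric.isOpen_ball.mem_nhds (hrs hx))).hasDerivAt
  have hball : ∀ x ∈ Metric.ball s (r / 2), Metric.closedBall x (r / 3) ⊆ Metric.ball s r := by
    intro x hx y hy
    have h1 : dist x s < r / 2 := hx
    have h2 : dist y x ≤ r / 3 := hy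
    have := dist_triangle y x s
    show dist y s < r
    linarith
  have hder : ∀ a, ∀ x ∈ Metric.ball s (r / 2), ‖deriv (f · a) x‖ ≤ bound a / (r / 3) := by
    intro a x hx
    refine Complex.norm_deriv_le_of_forall_mem_sphere_norm_le (by positivity) ?_ ?_
    · refine ((hdiff a).mono ?_).diffContOnCl
      rw [closure_ball _ (by positivity)]
      exact (hball x hx).trans hrs
    · intro y hy
      exact hbound y (hrs (hball x hx (Metric.sphere_subset_closedBall hy))) a
  have hdm : AEStronglyMeasurable (fun a => deriv (f · a) s) μ := by
    set u : ℕ → ℂ := fun n => ((r / 2 * (1 / ((n : ℝ) + 1)) : ℝ) : ℂ) with hu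
    have hu0 : ∀ n : ℕ, 0 < r / 2 * (1 / ((n : ℝ) + 1)) := fun n => by positivity
    have hu1 : ∀ n : ℕ, r / 2 * (1 / ((n : ℝ) + 1)) ≤ r / 2 := fun n => by
      have : 1 / ((n : ℝ) + 1) ≤ 1 := by
        apply div_le_one_of_le₀ _ (by positivity)
        linarith [(n.cast_nonneg : (0 : ℝ) ≤ n)]
      nlinarith
    have hlim : Tendsto u atTop (𝓝[≠] 0) := by
      rw [tendsto_nhdsWithin_iff]
      refine ⟨?_, Eventually.of_forall fun n => ?_⟩
      · have := (tendsto_one_div_add_atTop_nhds_zero_nat (𝕜 := ℝ)).const_mul (r / 2)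
        rw [mul_zero] at this
        exact (Complex.continuous_ofReal.tendsto' _ _ (by simp)).comp this
      · exact Complex.ofReal_ne_zero.2 (hu0 n).ne'
    refine aestronglyMeasurable_of_tendsto_ae atTop
      (f := fun n a => (u n)⁻¹ • (f (s + u n) a - f s a)) (fun n => ?_) (ae_of_all _ fun a => ?_)
    · refine ((hmeas (s + u n) (hrs ?_)).sub (hmeas s hs)).const_smul (u n)⁻¹
      rw [Metric.mem_ball, dist_eq_norm, add_sub_cancel_left, hu, Complex.norm_real,
        Real.norm_of_nonneg (hu0 n).le]
      linarith [hu1 n]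
    · exact ((hat a s (Metric.mem_ball_self hr)).tendsto_slope_zero).comp hlim
  refine (hasDerivAt_integral_of_dominated_loc_of_deriv_le (F := f)
    (F' := fun x a => deriv (f · a) x) (bound := fun a => bound a / (r / 3))
    (Metric.ball_mem_nhds s (half_pos hr)) ?_ ?_ hdm (ae_of_all _ fun a x hx => hder a x hx)
    (h_integrable.div_const _) (ae_of_all _ fun a x hx =>
      hat a x (Metric.ball_subset_ball (by linarith) hx))).2.differentiableAt
  · filter_upwards [Metric.isOpen_ball.mem_nhds hs] with x hx using hmeas x hx
  · exact h_integrable.mono' (hmeas s hs) (ae_of_all _ fun a => hbound s hs a)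

/-- The point `1/2 + 2πiξ` of the critical line. -/
noncomputable def critPt (ξ : ℝ) : ℂ := 1 / 2 + (2 * Real.pi * ξ : ℝ) * I

@[simp] lemma critPt_re (ξ : ℝ) : (critPt ξ).re = 1 / 2 := by simp [critPt]

@[simp] lemma critPt_im (ξ : ℝ) : (critPt ξ).im = 2 * Real.pi * ξ := by simp [critPt]

lemma continuous_critPt : Continuous critPt := by unfold critPt; fun_prop

lemma critPt_ne_zero (ξ : ℝ) : critPt ξ ≠ 0 := ne_zero_of_re_pos' (by simp)

/-- The height `2 + 2π|ξ|`. -/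
noncomputable def critHt (ξ : ℝ) : ℝ := 2 + |(1 - critPt ξ).im|

lemma two_le_critHt (ξ : ℝ) : 2 ≤ critHt ξ := by
  unfold critHt; linarith [abs_nonneg (1 - critPt ξ).im]

lemma continuous_critHt : Continuous critHt := by
  have := continuous_critPt
  unfold critHt; fun_prop

lemma critHt_le (ξ : ℝ) : critHt ξ ≤ 5 * ‖critPt ξ‖ := by
  have h1 := Complex.re_le_norm (critPt ξ)
  have h2 := Complex.abs_im_le_norm (critPt ξ)
  have h3 : (1 - critPt ξ).im = -(critPt ξ).im := by simp
  rw [critHt, h3, abs_neg]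
  rw [critPt_re] at h1
  linarith

lemma memLp_critHt_rpow {e : ℝ} (he : e < -(1 / 2)) :
    MemLp (fun ξ => critHt ξ ^ e) 2 volume := by
  have hcont : Continuous fun ξ => critHt ξ ^ e :=
    continuous_critHt.rpow_const fun ξ => Or.inl (by linarith [two_le_critHt ξ])
  rw [memLp_two_iff_integrable_sq hcont.aestronglyMeasurable]
  have h := integrable_one_add_norm (E := ℝ) (μ := volume) (r := -(2 * e)) (by simp; linarith)
  refine h.mono' (hcont.pow 2).aestronglyMeasurable (ae_of_all _ fun ξ => ?_)
  have h2 := two_le_critHt ξ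
  rw [Real.norm_of_nonneg (by positivity), ← Real.rpow_mul_natCast (by linarith), neg_neg]
  rw [show e * (2 : ℕ) = 2 * e by push_cast; ring]
  apply Real.rpow_le_rpow_of_nonpos (by positivity) _ (by linarith)
  simp only [critHt, Complex.sub_im, Complex.one_im, critPt_im, zero_sub, abs_neg, abs_mul,
    Real.norm_eq_abs, abs_two, abs_of_pos Real.pi_pos]
  nlinarith [Real.pi_gt_three, abs_nonneg ξ]

lemma integrable_norm_mul_critHt_rpow {F : ℝ → ℂ} (hF : MemLp F 2 volume) {e : ℝ}
    (he : e < -(1 / 2)) : Integrable (fun ξ => ‖F ξ‖ * critHt ξ ^ e) volume :=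
  hF.norm.integrable_mul (memLp_critHt_rpow he)

lemma one_sub_critPt_re (ξ : ℝ) : (1 - critPt ξ).re = 1 / 2 := by simp; norm_num

lemma one_sub_critPt_ne_one (ξ : ℝ) : 1 - critPt ξ ≠ 1 := fun h => critPt_ne_zero ξ (by simpa using h)

lemma continuous_riemannZeta_critPt : Continuous fun ξ => riemannZeta (1 - critPt ξ) := by
  rw [continuous_iff_continuousAt]
  intro ξ
  exact (differentiableAt_riemannZeta (one_sub_critPt_ne_one ξ)).continuousAt.comp
    (f := fun ξ => 1 - critPt ξ) (continuous_const.sub continuous_critPt).continuousAt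

lemma ae_riemannZeta_critPt_ne_zero : ∀ᵐ ξ : ℝ, riemannZeta (1 - critPt ξ) ≠ 0 := by
  have han : AnalyticOnNhd ℝ (fun ξ : ℝ => riemannXi (1 - critPt ξ)) univ := by
    intro ξ _
    have h1 : AnalyticAt ℝ riemannXi (1 - critPt ξ) :=
      (differentiable_riemannXi.analyticAt _).restrictScalars
    have h2 : AnalyticAt ℝ (fun ξ : ℝ => 1 - critPt ξ) ξ := by
      unfold critPt
      have : AnalyticAt ℝ (fun ξ : ℝ => ((2 * Real.pi * ξ : ℝ) : ℂ)) ξ :=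
        (Complex.ofRealCLM.analyticAt _).comp (analyticAt_const.mul analyticAt_id)
      exact analyticAt_const.sub (analyticAt_const.add (this.mul analyticAt_const))
    exact AnalyticAt.comp (f := fun ξ : ℝ => 1 - critPt ξ) h1 h2
  have hex : ∃ ξ : ℝ, riemannXi (1 - critPt ξ) ≠ 0 := by
    by_contra! hall
    have hz : ∀ s, riemannXi s = 0 := by
      have hon := (differentiable_riemannXi.differentiableOn (s := univ)).analyticOnNhd isOpen_univ
      have hfr : ∃ᶠ s in 𝓝[≠] (1 / 2 : ℂ), riemannXi s = 0 := by
        have hlim : Tendsto (fun n : ℕ => 1 - critPt (1 / ((n : ℝ) + 1))) atTop (𝓝[≠] (1 / 2 : ℂ)) := by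
          rw [tendsto_nhdsWithin_iff]
          refine ⟨?_, Eventually.of_forall fun n => ?_⟩
          · have := tendsto_one_div_add_atTop_nhds_zero_nat (𝕜 := ℝ)
            refine ((continuous_const.sub continuous_critPt).tendsto' 0 _ ?_).comp this
            simp [critPt]; norm_num
          · intro h
            have := congrArg Complex.im h
            have hn : (n : ℝ) + 1 ≠ 0 := by positivity
            simp [Real.pi_ne_zero, hn] at this
        exact hlim.frequently (Eventually.of_forall fun n => hall _).frequently
      have := hon.eqOn_zero_of_preconnected_of_frequently_eq_zero isPreconnected_univ
        (mem_univ (1 / 2 : ℂ)) hfr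
      exact fun s => this (mem_univ s)
    have := hz 0
    simp [riemannXi] at this
  obtain ⟨ξ₀, hξ₀⟩ := hex
  have hcod := han.preimage_zero_mem_codiscrete hξ₀
  have hae := ae_restrict_le_codiscreteWithin (μ := (volume : Measure ℝ)) MeasurableSet.univ hcod
  rw [Measure.restrict_univ] at hae
  filter_upwards [hae] with ξ hξ h0
  apply hξ
  have hre : 0 < (1 - critPt ξ).re := by rw [one_sub_critPt_re]; norm_num
  rw [mem_singleton_iff]
  simp only
  rw [riemannXi_eq hre,
    regZeta_eq (ne_zero_of_re_pos' hre) (one_sub_critPt_ne_one ξ), h0]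
  simp

/-- `ζ(w) / ζ(w + ε)` at the point `w = 1/2 - 2πiξ`. -/
noncomputable def zetaRatio (ε : ℂ) (ξ : ℝ) : ℂ :=
  riemannZeta (1 - critPt ξ) * ((1 - critPt ξ + ε - 1) / regZeta (1 - critPt ξ + ε))

lemma regZeta_critPt_add_ne_zero (hRH : RiemannHypothesis) {ε : ℂ} (hε : 0 < ε.re) (ξ : ℝ) :
    regZeta (1 - critPt ξ + ε) ≠ 0 :=
  regZeta_ne_zero hRH (by rw [Complex.add_re, one_sub_critPt_re]; linarith)

lemma differentiableAt_zetaRatio (hRH : RiemannHypothesis) {ε : ℂ} (hε : 0 < ε.re) (ξ : ℝ) :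
    DifferentiableAt ℂ (fun ε => zetaRatio ε ξ) ε := by
  have h0 : 1 - critPt ξ + ε ≠ 0 :=
    ne_zero_of_re_pos' (by rw [Complex.add_re, one_sub_critPt_re]; linarith)
  have h1 : DifferentiableAt ℂ (fun ε => regZeta (1 - critPt ξ + ε)) ε :=
    (differentiableAt_regZeta h0).comp ε (by fun_prop)
  have h2 := regZeta_critPt_add_ne_zero hRH hε ξ
  unfold zetaRatio
  fun_prop (disch := exact h2)

lemma continuous_zetaRatio (hRH : RiemannHypothesis) {ε : ℂ} (hε : 0 < ε.re) :
    Continuous (zetaRatio ε) := by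
  have hw : Continuous fun ξ => 1 - critPt ξ + ε :=
    (continuous_const.sub continuous_critPt).add continuous_const
  have hZ : Continuous fun ξ => regZeta (1 - critPt ξ + ε) := by
    rw [continuous_iff_continuousAt]
    intro ξ
    have h0 : 1 - critPt ξ + ε ≠ 0 :=
      ne_zero_of_re_pos' (by rw [Complex.add_re, one_sub_critPt_re]; linarith)
    exact (differentiableAt_regZeta h0).continuousAt.comp (f := fun ξ => 1 - critPt ξ + ε)
      hw.continuousAt
  exact continuous_riemannZeta_critPt.mul ((hw.sub continuous_const).div hZ
    (regZeta_critPt_add_ne_zero hRH hε))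

lemma norm_critPt_add_sub_le {ε : ℝ} (hε : 0 < ε) (hε' : ε < 1) (ξ : ℝ) :
    ‖1 - critPt ξ + ε - 1‖ ≤ critHt ξ := by
  refine (Complex.norm_le_abs_re_add_abs_im _).trans ?_
  have h1 : |(1 - critPt ξ + ε - 1).re| ≤ 1 := by
    simp only [Complex.sub_re, Complex.add_re, Complex.ofReal_re, critPt_re, Complex.one_re]
    rw [abs_le]; constructor <;> linarith
  have h2 : (1 - critPt ξ + ε - 1).im = (1 - critPt ξ).im := by simp
  rw [h2, critHt]
  linarith

lemma norm_zetaRatio_le (hRH : RiemannHypothesis) {ε : ℝ} (hε : 0 < ε) (hε' : ε < 1) (ξ : ℝ) :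
    ‖zetaRatio ε ξ‖ ≤ 15 * critHt ξ ^ (ε / 2) := by
  have hX := two_le_critHt ξ
  have hZ := norm_pos_iff.2 (regZeta_critPt_add_ne_zero hRH (ε := ε) (by simpa) ξ)
  have h1 := norm_riemannZeta_le_regZeta_add hRH hε hε' (one_sub_critPt_re ξ)
  rw [← critHt] at h1
  have h2 := norm_critPt_add_sub_le hε hε' ξ
  rw [zetaRatio, norm_mul, norm_div, ← mul_div_assoc, div_le_iff₀ hZ]
  calc _ ≤ 15 * critHt ξ ^ (ε / 2 - 1) * ‖regZeta (1 - critPt ξ + ε)‖ * critHt ξ := by gcongr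
    _ = _ := by
      rw [Real.rpow_sub_one (by linarith)]
      field_simp

lemma exists_norm_zetaRatio_le_of_mem_ball (hRH : RiemannHypothesis) {ε₀ : ℝ} (hε : 0 < ε₀)
    (hε' : ε₀ < 1) : ∃ η e C : ℝ, 0 < η ∧ e < 1 / 2 ∧ ∀ ε ∈ Metric.ball (ε₀ : ℂ) η,
      0 < ε.re ∧ ∀ ξ, ‖zetaRatio ε ξ‖ ≤ C * critHt ξ ^ e := by
  obtain ⟨K, hK, hA⟩ := exists_norm_regZeta_le_mul_rpow hRH (δ := ε₀ / 2) (by linarith) (by linarith)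
  set η := min (ε₀ / 2) ((1 - ε₀) / (4 * K)) with hη
  have hη0 : 0 < η := lt_min (by linarith) (div_pos (by linarith) (by positivity))
  have hη1 : η ≤ ε₀ / 2 := min_le_left _ _
  have hη2 : K * η ≤ (1 - ε₀) / 4 := by
    have : η ≤ (1 - ε₀) / (4 * K) := min_le_right _ _
    rw [le_div_iff₀ (by positivity)] at this
    linarith
  refine ⟨η, 1 / 4 + ε₀ / 4, 30, hη0, by linarith, fun ε hball => ?_⟩
  have hd : ‖ε - ε₀‖ < η := by simpa [dist_eq_norm] using hball
  have hre : 0 < ε.re := by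
    have := (abs_le.1 ((Complex.abs_re_le_norm (ε - ε₀)).trans hd.le)).1
    simp at this
    linarith
  refine ⟨hre, fun ξ => ?_⟩
  have hX := two_le_critHt ξ
  have hZ := norm_pos_iff.2 (regZeta_critPt_add_ne_zero hRH hre ξ)
  have h1 := norm_riemannZeta_le_regZeta_add hRH hε hε' (one_sub_critPt_re ξ)
  rw [← critHt] at h1
  have h2 := norm_critPt_add_sub_le hε hε' ξ
  have h3 : ‖1 - critPt ξ + ε - 1‖ ≤ 2 * critHt ξ := by
    calc ‖1 - critPt ξ + ε - 1‖ = ‖(1 - critPt ξ + ε₀ - 1) + (ε - ε₀)‖ := by ring_nf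
      _ ≤ critHt ξ + η := (norm_add_le _ _).trans (by gcongr)
      _ ≤ 2 * critHt ξ := by linarith
  have hcen : ∀ e : ℂ, 1 - critPt ξ + e - (2 + (1 - critPt ξ).im * I) = ((-(3 / 2) : ℝ) : ℂ) + e := by
    intro e
    have : 1 - critPt ξ = ((1 / 2 : ℝ) : ℂ) + (1 - critPt ξ).im * I := by
      conv_lhs => rw [← Complex.re_add_im (1 - critPt ξ), one_sub_critPt_re]
    rw [this]
    push_cast
    simp
    ring
  have hb0 : ‖((-(3 / 2) : ℝ) : ℂ) + ε₀‖ = 3 / 2 - ε₀ := by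
    rw [← Complex.ofReal_add, Complex.norm_real, Real.norm_eq_abs, abs_of_nonpos (by linarith)]
    ring
  have h4 := hA (1 - critPt ξ).im (1 - critPt ξ + ε₀)
    (by rw [Metric.mem_closedBall, dist_eq_norm, hcen, hb0]; linarith) (1 - critPt ξ + ε)
    (by
      rw [Metric.mem_closedBall, dist_eq_norm, hcen]
      calc ‖((-(3 / 2) : ℝ) : ℂ) + ε‖ = ‖(((-(3 / 2) : ℝ) : ℂ) + ε₀) + (ε - ε₀)‖ := by ring_nf
        _ ≤ (3 / 2 - ε₀) + η := (norm_add_le _ _).trans (by rw [hb0]; gcongr)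
        _ ≤ _ := by linarith)
  rw [← critHt] at h4
  have h5 : ‖1 - critPt ξ + ε₀ - (1 - critPt ξ + ε)‖ ≤ η := by
    rw [add_sub_add_left_eq_sub, norm_sub_rev]; exact hd.le
  have h6 : critHt ξ ^ (K * ‖1 - critPt ξ + ε₀ - (1 - critPt ξ + ε)‖) ≤
      critHt ξ ^ ((1 - ε₀) / 4) := by
    apply Real.rpow_le_rpow_of_exponent_le (by linarith)
    exact (mul_le_mul_of_nonneg_left h5 hK.le).trans hη2
  rw [zetaRatio, norm_mul, norm_div, ← mul_div_assoc, div_le_iff₀ hZ]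
  calc _ ≤ 15 * critHt ξ ^ (ε₀ / 2 - 1) * (‖regZeta (1 - critPt ξ + ε)‖ *
        critHt ξ ^ ((1 - ε₀) / 4)) * (2 * critHt ξ) := by
        gcongr
        exact h1.trans (by gcongr; exact h4.trans (by gcongr))
    _ = 30 * (critHt ξ ^ (ε₀ / 2 - 1) * critHt ξ ^ ((1 - ε₀) / 4) * critHt ξ ^ (1 : ℝ)) *
        ‖regZeta (1 - critPt ξ + ε)‖ := by rw [Real.rpow_one]; ring
    _ = _ := by
      rw [← Real.rpow_add (by linarith), ← Real.rpow_add (by linarith)]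
      ring_nf

lemma tendsto_zetaRatio {ξ : ℝ} (h0 : riemannZeta (1 - critPt ξ) ≠ 0) :
    Tendsto (fun ε : ℝ => zetaRatio ε ξ) (𝓝 0) (𝓝 1) := by
  have hre : 0 < (1 - critPt ξ).re := by rw [one_sub_critPt_re]; norm_num
  have hw0 := ne_zero_of_re_pos' hre
  have hw1 := one_sub_critPt_ne_one ξ
  have hZ : ContinuousAt (fun ε : ℝ => regZeta (1 - critPt ξ + ε)) 0 :=
    ContinuousAt.comp (g := regZeta) (f := fun ε : ℝ => 1 - critPt ξ + (ε : ℂ)) (x := 0)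
      (by simpa using (differentiableAt_regZeta hw0).continuousAt) (by fun_prop)
  have hval : zetaRatio ((0 : ℝ) : ℂ) ξ = 1 := by
    rw [zetaRatio, ofReal_zero, add_zero, regZeta_eq hw0 hw1]
    have := sub_ne_zero.2 hw1
    field_simp
  have hc : ContinuousAt (fun ε : ℝ => zetaRatio ε ξ) 0 := by
    unfold zetaRatio
    refine continuousAt_const.mul (ContinuousAt.div (by fun_prop) hZ ?_)
    rw [ofReal_zero, add_zero, regZeta_eq hw0 hw1]
    exact mul_ne_zero (sub_ne_zero.2 hw1) h0
  have := hc.tendsto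
  rwa [hval] at this

lemma norm_natCast_cpow_critPt {n : ℕ} (hn : 1 ≤ n) (ξ : ℝ) :
    ‖(n : ℂ) ^ critPt ξ‖ = (n : ℝ) ^ (1 / 2 : ℝ) := by
  rw [Complex.norm_natCast_cpow_of_pos (by omega), critPt_re]

lemma continuous_natCast_cpow_critPt {n : ℕ} (hn : 1 ≤ n) :
    Continuous fun ξ => (n : ℂ) ^ critPt ξ :=
  continuous_critPt.const_cpow (Or.inl (by exact_mod_cast (by omega : n ≠ 0)))

lemma norm_riemannZeta_critPt_le (hRH : RiemannHypothesis) :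
    ∃ C : ℝ, 0 < C ∧ ∀ ξ, ‖riemannZeta (1 - critPt ξ)‖ ≤ C * critHt ξ ^ (3 / 8 : ℝ) := by
  obtain ⟨C, hC, hζ⟩ := exists_norm_riemannZeta_le (σ := 5 / 4) (by norm_num)
  refine ⟨15 * C, by positivity, fun ξ => ?_⟩
  have hX := two_le_critHt ξ
  have h1 := norm_riemannZeta_le_regZeta_add hRH (ε := 3 / 4) (by norm_num) (by norm_num)
    (one_sub_critPt_re ξ)
  rw [← critHt] at h1
  have h2 := norm_critPt_add_sub_le (ε := 3 / 4) (by norm_num) (by norm_num) ξ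
  have hre : (1 - critPt ξ + (3 / 4 : ℝ)).re = 5 / 4 := by
    rw [Complex.add_re, one_sub_critPt_re, ofReal_re]; norm_num
  have h3 : ‖regZeta (1 - critPt ξ + (3 / 4 : ℝ))‖ ≤ critHt ξ * C := by
    rw [regZeta_eq (ne_zero_of_re_pos' (by rw [hre]; norm_num)), norm_mul]
    · exact mul_le_mul h2 (hζ _ hre.ge) (norm_nonneg _) (by linarith)
    · intro h
      rw [h] at hre
      norm_num at hre
  calc _ ≤ _ := h1
    _ ≤ 15 * critHt ξ ^ ((3 / 4 : ℝ) / 2 - 1) * (critHt ξ * C) := by gcongr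
    _ = _ := by
      rw [Real.rpow_sub_one (by linarith)]
      field_simp
      norm_num

lemma memLp_riemannZeta_div_critPt (hRH : RiemannHypothesis) :
    MemLp (fun ξ => riemannZeta (1 - critPt ξ) / critPt ξ) 2 volume := by
  obtain ⟨C, hC, h⟩ := norm_riemannZeta_critPt_le hRH
  refine ((memLp_critHt_rpow (e := -(5 / 8)) (by norm_num)).const_mul (C * 5)).mono
    (continuous_riemannZeta_critPt.div continuous_critPt critPt_ne_zero).aestronglyMeasurable
    (ae_of_all _ fun ξ => ?_)
  have hX := two_le_critHt ξ
  have h1 := critHt_le ξ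
  have hz := norm_pos_iff.2 (critPt_ne_zero ξ)
  rw [norm_div, Real.norm_of_nonneg (by positivity), div_le_iff₀ hz]
  calc _ ≤ C * critHt ξ ^ (3 / 8 : ℝ) := h ξ
    _ = C * critHt ξ ^ (-(5 / 8) : ℝ) * critHt ξ := by
      rw [show (3 / 8 : ℝ) = -(5 / 8) + 1 by norm_num, Real.rpow_add_one (by linarith)]; ring
    _ ≤ C * critHt ξ ^ (-(5 / 8) : ℝ) * (5 * ‖critPt ξ‖) := by gcongr
    _ = _ := by ring

lemma integrable_mul_riemannZeta_div_critPt (hRH : RiemannHypothesis) {F : ℝ → ℂ}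
    (hF : MemLp F 2 volume) {k : ℕ} (hk : 1 ≤ k) :
    Integrable (fun ξ => F ξ * ((k : ℂ) ^ critPt ξ * (riemannZeta (1 - critPt ξ) / critPt ξ))) := by
  have h1 : Integrable (fun ξ => F ξ * (riemannZeta (1 - critPt ξ) / critPt ξ)) :=
    hF.integrable_mul (memLp_riemannZeta_div_critPt hRH)
  have h2 := h1.bdd_mul (c := (k : ℝ) ^ (1 / 2 : ℝ))
    (continuous_natCast_cpow_critPt hk).aestronglyMeasurable
    (ae_of_all _ fun ξ => (norm_natCast_cpow_critPt hk ξ).le)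
  refine h2.congr (ae_of_all _ fun ξ => ?_)
  ring

lemma integral_mul_zetaRatio_eq (hRH : RiemannHypothesis) {F : ℝ → ℂ} (hF : MemLp F 2 volume)
    {J : ℂ} (hJ : ∀ k : ℕ, 1 ≤ k →
      ∫ ξ, F ξ * ((k : ℂ) ^ critPt ξ * (riemannZeta (1 - critPt ξ) / critPt ξ)) = J)
    {n : ℕ} (hn : 1 ≤ n) {ε : ℝ} (hε : 1 / 2 < ε) :
    ∫ ξ, F ξ * ((n : ℂ) ^ critPt ξ / critPt ξ) * zetaRatio ε ξ = J * (riemannZeta (1 + ε))⁻¹ := by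
  set M : ℕ → ℂ := fun n => ((ArithmeticFunction.moebius n : ℤ) : ℂ) with hM
  set A : ℝ → ℂ := fun ξ =>
    F ξ * ((n : ℂ) ^ critPt ξ * (riemannZeta (1 - critPt ξ) / critPt ξ)) with hA
  have hAint : Integrable A := integrable_mul_riemannZeta_div_critPt hRH hF hn
  have hsum : LSeriesSummable M (1 / 2 + ε : ℝ) :=
    ArithmeticFunction.LSeriesSummable_moebius_iff.2 (by rw [ofReal_re]; linarith)
  have hre : ∀ ξ, (1 - critPt ξ + ε).re = ((1 / 2 + ε : ℝ) : ℂ).re := fun ξ => by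
    rw [Complex.add_re, one_sub_critPt_re, ofReal_re, ofReal_re]
  have hnorm : ∀ ξ k, ‖LSeries.term M (1 - critPt ξ + ε) k‖ =
      ‖LSeries.term M (1 / 2 + ε : ℝ) k‖ := fun ξ k => by
    rw [LSeries.norm_term_eq, LSeries.norm_term_eq, hre]
  have hinv : ∀ s : ℂ, 1 < s.re → LSeries M s = (riemannZeta s)⁻¹ := fun s hs => by
    have h1 : riemannZeta s * LSeries M s = 1 := by
      rw [← LSeries_one_eq_riemannZeta hs]
      exact LSeries_one_mul_Lseries_moebius hs
    exact (inv_eq_of_mul_eq_one_right h1).symm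
  have hcont : ∀ k, Continuous fun ξ => LSeries.term M (1 - critPt ξ + ε) k := fun k => by
    rcases eq_or_ne k 0 with rfl | hk
    · simp only [LSeries.term_zero]; exact continuous_const
    · simp only [LSeries.term_of_ne_zero hk]
      have hk' : (k : ℂ) ≠ 0 := by exact_mod_cast hk
      refine continuous_const.div ?_ fun ξ => by simp [hk']
      exact ((continuous_const.sub continuous_critPt).add continuous_const).const_cpow (Or.inl hk')
  have h_integrable : ∀ k, Integrable (fun ξ => LSeries.term M (1 - critPt ξ + ε) k * A ξ) := fun k =>
    hAint.bdd_mul (c := ‖LSeries.term M (1 / 2 + ε : ℝ) k‖) (hcont k).aestronglyMeasurable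
      (ae_of_all _ fun ξ => (hnorm ξ k).le)
  have hval : ∀ k, ∫ ξ, LSeries.term M (1 - critPt ξ + ε) k * A ξ = LSeries.term M (1 + ε) k * J := by
    intro k
    rcases eq_or_ne k 0 with rfl | hk
    · simp
    have hk' : (k : ℂ) ≠ 0 := by exact_mod_cast hk
    rw [← hJ (n * k) (Nat.mul_pos hn (Nat.pos_of_ne_zero hk)), ← integral_const_mul]
    refine integral_congr_ae (ae_of_all _ fun ξ => ?_)
    simp only [hA, LSeries.term_of_ne_zero hk, Nat.cast_mul]
    rw [natCast_mul_natCast_cpow, show 1 - critPt ξ + ε = (1 + ε) - critPt ξ by ring,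
      Complex.cpow_sub _ _ hk']
    have h1 : (k : ℂ) ^ (1 + ε : ℂ) ≠ 0 := by simp [hk']
    have h2 : (k : ℂ) ^ critPt ξ ≠ 0 := by simp [hk']
    field_simp
  have hsn : Summable fun k => ∫ ξ, ‖LSeries.term M (1 - critPt ξ + ε) k * A ξ‖ := by
    have : (fun k => ∫ ξ, ‖LSeries.term M (1 - critPt ξ + ε) k * A ξ‖) =
        fun k => ‖LSeries.term M (1 / 2 + ε : ℝ) k‖ * ∫ ξ, ‖A ξ‖ := by
      funext k
      rw [← integral_const_mul]
      refine integral_congr_ae (ae_of_all _ fun ξ => ?_)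
      simp only [norm_mul, hnorm]
    rw [this]
    exact hsum.norm.mul_right _
  have key := hasSum_integral_of_summable_integral_norm h_integrable hsn
  have hL : ∫ ξ, F ξ * ((n : ℂ) ^ critPt ξ / critPt ξ) * zetaRatio ε ξ =
      ∫ ξ, ∑' k, LSeries.term M (1 - critPt ξ + ε) k * A ξ := by
    refine integral_congr_ae (ae_of_all _ fun ξ => ?_)
    simp only
    have hre1 : 1 < (1 - critPt ξ + ε).re := by rw [hre, ofReal_re]; linarith
    have h0 : 1 - critPt ξ + ε ≠ 0 := ne_zero_of_re_pos' (by linarith)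
    have h1 : 1 - critPt ξ + ε ≠ 1 := by intro h; rw [h] at hre1; norm_num at hre1
    have hz : riemannZeta (1 - critPt ξ + ε) ≠ 0 := riemannZeta_ne_zero_of_one_le_re hre1.le
    have h2 := sub_ne_zero.2 h1
    rw [tsum_mul_right, ← LSeries, hinv _ hre1, zetaRatio, regZeta_eq h0 h1, hA]
    have := critPt_ne_zero ξ
    field_simp
  rw [hL, ← key.tsum_eq]
  simp only [hval]
  rw [tsum_mul_right, ← LSeries, hinv _ (by simp; linarith), mul_comm]

theorem integral_mul_cpow_div_critPt_eq_zero (hRH : RiemannHypothesis) {F : ℝ → ℂ}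
    (hF : MemLp F 2 volume) (h : ∀ k : ℕ, 2 ≤ k →
      ∫ ξ, F ξ * (((k : ℂ) ^ critPt ξ - 1) * (riemannZeta (1 - critPt ξ) / critPt ξ)) = 0)
    {n : ℕ} (hn : 1 ≤ n) : ∫ ξ, F ξ * ((n : ℂ) ^ critPt ξ / critPt ξ) = 0 := by
  set J := ∫ ξ, F ξ * (riemannZeta (1 - critPt ξ) / critPt ξ) with hJdef
  have hJ : ∀ k : ℕ, 1 ≤ k →
      ∫ ξ, F ξ * ((k : ℂ) ^ critPt ξ * (riemannZeta (1 - critPt ξ) / critPt ξ)) = J := by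
    intro k hk
    rcases hk.eq_or_lt with rfl | hk2
    · simp [hJdef]
    · have h1 := h k hk2
      have i1 := integrable_mul_riemannZeta_div_critPt hRH hF hk
      have i2 := integrable_mul_riemannZeta_div_critPt hRH hF le_rfl
      simp only [Nat.cast_one, one_cpow, one_mul] at i2
      rw [← sub_eq_zero, hJdef, ← integral_sub i1 i2, ← h1]
      refine integral_congr_ae (ae_of_all _ fun ξ => ?_)
      simp only
      ring
  set G : ℝ → ℂ := fun ξ => F ξ * ((n : ℂ) ^ critPt ξ / critPt ξ) with hG
  have hGm : AEStronglyMeasurable G volume := hF.1.mul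
    ((continuous_natCast_cpow_critPt hn).div continuous_critPt critPt_ne_zero).aestronglyMeasurable
  set B : ℝ := 5 * (n : ℝ) ^ (1 / 2 : ℝ) with hB
  have hB0 : 0 ≤ B := by positivity
  have hGb : ∀ ξ, ‖G ξ‖ ≤ B * (‖F ξ‖ * (critHt ξ)⁻¹) := fun ξ => by
    have hX := two_le_critHt ξ
    have h1 := critHt_le ξ
    have hz := norm_pos_iff.2 (critPt_ne_zero ξ)
    have h2 : ‖critPt ξ‖⁻¹ ≤ 5 * (critHt ξ)⁻¹ := by
      rw [inv_le_iff_one_le_mul₀ hz, mul_comm, ← mul_assoc, ← div_eq_mul_inv,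
        le_div_iff₀ (by linarith)]
      linarith
    rw [hG, norm_mul, norm_div, norm_natCast_cpow_critPt hn, div_eq_mul_inv]
    calc _ ≤ ‖F ξ‖ * ((n : ℝ) ^ (1 / 2 : ℝ) * (5 * (critHt ξ)⁻¹)) := by gcongr
      _ = _ := by rw [hB]; ring
  have hGe : ∀ (C e : ℝ) (u : ℝ → ℂ), (∀ ξ, ‖u ξ‖ ≤ C * critHt ξ ^ e) →
      ∀ ξ, ‖G ξ * u ξ‖ ≤ B * C * (‖F ξ‖ * critHt ξ ^ (e - 1)) := fun C e u hu ξ => by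
    have hX := two_le_critHt ξ
    rw [norm_mul]
    calc _ ≤ B * (‖F ξ‖ * (critHt ξ)⁻¹) * (C * critHt ξ ^ e) := by
          gcongr
          · exact hGb ξ
          · exact hu ξ
      _ = _ := by rw [Real.rpow_sub_one (by linarith)]; ring
  set D : ℂ → ℂ := fun ε => ∫ ξ, G ξ * zetaRatio ε ξ with hD
  set φ : ℂ → ℂ := fun ε => D ε - J * (ε / regZeta (1 + ε)) with hφ
  have hRd : ∀ ε : ℂ, 0 ≤ ε.re → DifferentiableAt ℂ (fun ε => J * (ε / regZeta (1 + ε))) ε := by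
    intro ε hε
    have h0 : 0 < (1 + ε).re := by simp; linarith
    have h1 : DifferentiableAt ℂ (fun ε => regZeta (1 + ε)) ε :=
      (differentiableAt_regZeta (ne_zero_of_re_pos' h0)).comp ε (by fun_prop)
    have h2 : regZeta (1 + ε) ≠ 0 := regZeta_ne_zero hRH (by simp; linarith)
    fun_prop (disch := exact h2)
  have han : AnalyticOnNhd ℝ (fun ε : ℝ => φ ε) (Ioo 0 1) := by
    intro ε₀ hε₀
    obtain ⟨η, e, C, hη, he, hball⟩ := exists_norm_zetaRatio_le_of_mem_ball hRH hε₀.1 hε₀.2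
    have hDd : DifferentiableOn ℂ D (Metric.ball (ε₀ : ℂ) η) := by
      refine differentiableOn_integral_of_dominated
        (bound := fun ξ => B * C * (‖F ξ‖ * critHt ξ ^ (e - 1)))
        (fun ξ ε hε => ?_) (fun ε hε => ?_) (fun ε hε => hGe C e _ (hball ε hε).2)
        ((integrable_norm_mul_critHt_rpow hF (by linarith)).const_mul _)
      · exact ((differentiableAt_zetaRatio hRH (hball ε hε).1 ξ).const_mul _).differentiableWithinAt
      · exact hGm.mul (continuous_zetaRatio hRH (hball ε hε).1).aestronglyMeasurable
    have hφd : DifferentiableOn ℂ φ (Metric.ball (ε₀ : ℂ) η) := hDd.sub fun ε hε =>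
      (hRd ε (hball ε hε).1.le).differentiableWithinAt
    have h1 : AnalyticAt ℝ φ (ε₀ : ℂ) :=
      (hφd.analyticAt (Metric.ball_mem_nhds _ hη)).restrictScalars
    exact AnalyticAt.comp (f := fun ε : ℝ => (ε : ℂ)) h1 (Complex.ofRealCLM.analyticAt _)
  have hzero : ∀ ε ∈ Ioo (1 / 2 : ℝ) 1, φ ε = 0 := by
    intro ε hε
    have hε0 : ε ≠ 0 := by linarith [hε.1]
    have h0 : (1 + ε : ℂ) ≠ 0 := ne_zero_of_re_pos' (by simp; linarith [hε.1])
    rw [hφ]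
    simp only
    rw [hD]
    simp only
    rw [integral_mul_zetaRatio_eq hRH hF hJ hn hε.1, regZeta_eq h0 (by simpa using hε0)]
    have : (ε : ℂ) ≠ 0 := by exact_mod_cast hε0
    rw [add_sub_cancel_left, ← div_div, div_self this, one_div, sub_self]
  have heq := han.eqOn_zero_of_preconnected_of_eventuallyEq_zero isPreconnected_Ioo
    (z₀ := 3 / 4) ⟨by norm_num, by norm_num⟩ (by
      filter_upwards [Ioo_mem_nhds (show (1 / 2 : ℝ) < 3 / 4 by norm_num)
        (show (3 / 4 : ℝ) < 1 by norm_num)] with ε hε using hzero ε hε)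
  have hlim1 : Tendsto (fun ε : ℝ => D ε) (𝓝[>] 0) (𝓝 (∫ ξ, G ξ * 1)) := by
    refine tendsto_integral_filter_of_dominated_convergence
      (fun ξ => B * 15 * (‖F ξ‖ * critHt ξ ^ ((1 / 4 : ℝ) - 1))) ?_ ?_
      ((integrable_norm_mul_critHt_rpow hF (by norm_num)).const_mul _) ?_
    · filter_upwards [self_mem_nhdsWithin] with ε hε
      have hε' : (0 : ℝ) < ε := hε
      exact hGm.mul (continuous_zetaRatio hRH (ε := ε) (by simpa)).aestronglyMeasurable
    · filter_upwards [Ioo_mem_nhdsGT (show (0 : ℝ) < 1 / 2 by norm_num)] with ε hε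
      refine ae_of_all _ (hGe 15 (1 / 4) _ fun ξ => ?_)
      refine (norm_zetaRatio_le hRH hε.1 (by linarith [hε.2]) ξ).trans ?_
      gcongr 15 * ?_
      exact Real.rpow_le_rpow_of_exponent_le (by linarith [two_le_critHt ξ]) (by linarith [hε.2])
    · filter_upwards [ae_riemannZeta_critPt_ne_zero] with ξ hξ
      exact ((tendsto_zetaRatio hξ).mono_left nhdsWithin_le_nhds).const_mul _
  have hlim2 : Tendsto (fun ε : ℝ => D ε) (𝓝[>] 0) (𝓝 0) := by
    have h1 : ContinuousAt (fun ε : ℝ => J * ((ε : ℂ) / regZeta (1 + ε))) 0 :=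
      ContinuousAt.comp (g := fun ε : ℂ => J * (ε / regZeta (1 + ε))) (f := fun ε : ℝ => (ε : ℂ))
        (x := 0) (hRd _ (by simp)).continuousAt Complex.continuous_ofReal.continuousAt
    have h2 := h1.tendsto.mono_left (nhdsWithin_le_nhds (s := Ioi 0))
    simp only [ofReal_zero, zero_div, mul_zero] at h2
    refine h2.congr' ?_
    filter_upwards [Ioo_mem_nhdsGT (show (0 : ℝ) < 1 by norm_num)] with ε hε
    exact (sub_eq_zero.1 (heq hε)).symm
  have := tendsto_nhds_unique hlim1 hlim2
  simpa using this

/-- The `n`-th Taylor coefficient of `h_k`. -/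
noncomputable def hCoef (k n : ℕ) : ℝ := harmonic n - harmonic (n / k) - Real.log k

lemma abs_harmonic_sub_log_le (n : ℕ) :
    |(harmonic n : ℝ) - Real.log (n + 1) - Real.eulerMascheroniConstant| ≤ 2 / (n + 1) := by
  have h1 := Real.eulerMascheroniSeq_lt_eulerMascheroniConstant n
  have h2 := Real.eulerMascheroniConstant_lt_eulerMascheroniSeq' n
  have h3 := Real.eulerMascheroniConstant_lt_eulerMascheroniSeq' 1
  rw [Real.eulerMascheroniSeq'_one] at h3
  rw [Real.eulerMascheroniSeq] at h1
  rw [abs_le]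
  have hp : (0:ℝ) < n + 1 := by positivity
  refine ⟨?_, by have : 0 < 2 / ((n:ℝ) + 1) := by positivity
                 linarith⟩
  rcases Nat.eq_zero_or_pos n with rfl | hn
  · norm_num
    linarith
  · rw [Real.eulerMascheroniSeq', if_neg hn.ne'] at h2
    have hn' : (1:ℝ) ≤ n := by exact_mod_cast hn
    have h4 : Real.log (n + 1) - Real.log n ≤ 1 / n := by
      rw [← Real.log_div (by positivity) (by positivity)]
      refine (Real.log_le_sub_one_of_pos (by positivity)).trans (le_of_eq ?_)
      field_simp
      ring
    have h5 : 1 / (n:ℝ) ≤ 2 / (n + 1) := by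
      rw [div_le_div_iff₀ (by positivity) hp]
      linarith
    linarith

lemma abs_hCoef_le {k : ℕ} (hk : 1 ≤ k) (n : ℕ) : |hCoef k n| ≤ (2 + 3 * k) / (n + 1) := by
  have h1 := abs_harmonic_sub_log_le n
  have h2 := abs_harmonic_sub_log_le (n / k)
  set q : ℕ := n / k with hq
  have hk' : (1:ℝ) ≤ k := by exact_mod_cast hk
  have hp : (0:ℝ) < n + 1 := by positivity
  have hpq : (0:ℝ) < q + 1 := by positivity
  have ha : (n:ℝ) + 1 ≤ k * (q + 1) := by
    have := Nat.lt_mul_div_succ n (show 0 < k by omega)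
    exact_mod_cast this
  have hb : (k:ℝ) * (q + 1) ≤ n + k := by
    have := Nat.mul_div_le n k
    have : ((k * (n / k) : ℕ) : ℝ) ≤ n := by exact_mod_cast this
    push_cast at this
    rw [← hq] at this
    linarith
  have h3 : 2 / ((q:ℝ) + 1) ≤ 2 * k / (n + 1) := by
    rw [div_le_div_iff₀ hpq hp]
    linarith
  have h4 : Real.log (n + 1) ≤ Real.log k + Real.log (q + 1) := by
    rw [← Real.log_mul (by positivity) (by positivity)]
    exact Real.log_le_log hp ha
  have h5 : Real.log k + Real.log (q + 1) - Real.log (n + 1) ≤ k / (n + 1) := by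
    rw [← Real.log_mul (by positivity) (by positivity),
      ← Real.log_div (by positivity) (by positivity)]
    refine (Real.log_le_sub_one_of_pos (by positivity)).trans ?_
    rw [div_sub_one hp.ne']
    gcongr
    linarith
  rw [abs_le] at *
  have e : (2 + 3 * (k:ℝ)) / (n + 1) = 2 / (n + 1) + 2 * k / (n + 1) + k / (n + 1) := by ring
  rw [hCoef, e]
  have : 0 ≤ (k:ℝ) / (n + 1) := by positivity
  constructor <;> linarith

lemma harmonic_nonneg (n : ℕ) : (0:ℝ) ≤ harmonic n := by
  rw [harmonic]; push_cast; positivity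

lemma harmonic_eq_sum_Icc_complex (n : ℕ) :
    ((harmonic n : ℝ) : ℂ) = ∑ m ∈ Finset.Icc 1 n, ((m : ℂ)⁻¹) := by
  rw [harmonic_eq_sum_Icc]; push_cast; rfl

lemma exists_harmonic_le_rpow {r : ℝ} (hr : 0 < r) :
    ∃ C : ℝ, ∀ n : ℕ, (harmonic n : ℝ) ≤ C * (n : ℝ) ^ r := by
  refine ⟨1 + 1 / r, fun n => ?_⟩
  rcases Nat.eq_zero_or_pos n with rfl | hn
  · simp [Real.zero_rpow hr.ne']
  have hn' : (1:ℝ) ≤ n := by exact_mod_cast hn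
  refine (harmonic_le_one_add_log n).trans ?_
  have h1 : (1:ℝ) ≤ (n:ℝ) ^ r := Real.one_le_rpow hn' hr.le
  have h2 := Real.log_le_rpow_div (show (0:ℝ) ≤ n by positivity) hr
  have : (1 + 1 / r) * (n:ℝ) ^ r = n ^ r + n ^ r / r := by ring
  linarith

lemma measurable_comp_floor {α : Type*} [MeasurableSpace α] (f : ℕ → α) :
    Measurable (fun t : ℝ => f ⌊t⌋₊) :=
  (measurable_from_top (f := f)).comp Nat.measurable_floor

lemma hasMellin_harmonic_floor {s : ℂ} (hs : 1 < s.re) :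
    HasMellin (fun t : ℝ => ((harmonic ⌊t⌋₊ : ℝ) : ℂ)) (1 - s) (riemannZeta s / (s - 1)) := by
  have hs1 : s - 1 ≠ 0 := by
    intro h; rw [sub_eq_zero] at h; rw [h] at hs; simp at hs
  obtain ⟨C, hC⟩ := exists_harmonic_le_rpow (r := (s.re - 1) / 2) (by linarith)
  have hzero : ∀ t ∈ Ioi (0:ℝ) \ Ioi 1,
      (t : ℂ) ^ ((1 - s) - 1) • ((harmonic ⌊t⌋₊ : ℝ) : ℂ) = 0 ∨ t = 1 := by
    rintro t ⟨h0, h1⟩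
    simp only [mem_Ioi, not_lt] at h0 h1
    rcases h1.lt_or_eq with h | h
    · left; rw [Nat.floor_eq_zero.2 h]; simp
    · right; exact h
  have hC0 : 0 ≤ C := by have := (harmonic_nonneg 1).trans (hC 1); simpa using this
  have h_integrable : IntegrableOn (fun t : ℝ => (t : ℂ) ^ ((1 - s) - 1) • ((harmonic ⌊t⌋₊ : ℝ) : ℂ))
      (Ioi 1) := by
    have hi : IntegrableOn (fun t : ℝ => C * t ^ ((s.re - 1) / 2 - s.re)) (Ioi 1) :=
      (integrableOn_Ioi_rpow_of_lt (by linarith) one_pos).const_mul C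
    refine Integrable.mono' hi ?_ ?_
    · refine Measurable.aestronglyMeasurable ?_
      exact (measurable_ofReal.pow_const _).smul
        (measurable_comp_floor (fun n => ((harmonic n : ℝ) : ℂ)))
    · refine (ae_restrict_iff' measurableSet_Ioi).2 (ae_of_all _ fun t ht => ?_)
      have ht0 : (0:ℝ) < t := one_pos.trans ht
      rw [norm_smul, norm_cpow_eq_rpow_re_of_pos ht0, norm_real, Real.norm_eq_abs,
        abs_of_nonneg (harmonic_nonneg _)]
      have h1 := hC ⌊t⌋₊
      have h2 : ((⌊t⌋₊ : ℝ)) ^ ((s.re - 1) / 2) ≤ t ^ ((s.re - 1) / 2) :=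
        Real.rpow_le_rpow (by positivity) (Nat.floor_le ht0.le) (by linarith)
      calc t ^ ((1 - s) - 1).re * (harmonic ⌊t⌋₊ : ℝ)
          ≤ t ^ ((1 - s) - 1).re * (C * t ^ ((s.re - 1) / 2)) := by
            gcongr; exact h1.trans (by gcongr)
        _ = C * t ^ ((s.re - 1) / 2 - s.re) := by
            rw [show (s.re - 1) / 2 - s.re = ((1 - s) - 1).re + (s.re - 1) / 2 by simp; ring,
              Real.rpow_add ht0]
            ring
  have hae : (Ioi (0:ℝ)).indicator (fun t : ℝ => (t : ℂ) ^ ((1 - s) - 1) •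
      ((harmonic ⌊t⌋₊ : ℝ) : ℂ)) =ᵐ[volume] (Ioi (1:ℝ)).indicator
      (fun t : ℝ => (t : ℂ) ^ ((1 - s) - 1) • ((harmonic ⌊t⌋₊ : ℝ) : ℂ)) := by
    filter_upwards [Measure.ae_ne volume (1:ℝ)] with t ht
    by_cases h1 : t ∈ Ioi (1:ℝ)
    · have : t ∈ Ioi (0:ℝ) := mem_Ioi.2 (one_pos.trans (mem_Ioi.1 h1))
      rw [indicator_of_mem h1, indicator_of_mem this]
    · rw [indicator_of_notMem h1]
      by_cases h0 : t ∈ Ioi (0:ℝ)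
      · rw [indicator_of_mem h0]
        exact (hzero t ⟨h0, h1⟩).resolve_right ht
      · rw [indicator_of_notMem h0]
  refine ⟨?_, ?_⟩
  · rw [MellinConvergent, ← integrable_indicator_iff measurableSet_Ioi]
    exact ((integrable_indicator_iff measurableSet_Ioi).2 h_integrable).congr hae.symm
  · rw [mellin, ← integral_indicator measurableSet_Ioi, integral_congr_ae hae,
      integral_indicator measurableSet_Ioi, eq_div_iff hs1]
    have hterm : ∀ n, LSeries.term (fun m => ((m:ℂ)⁻¹)) (s - 1) n = LSeries.term 1 s n := by
      intro n
      rcases Nat.eq_zero_or_pos n with rfl | hn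
      · simp
      · have : (n:ℂ) ≠ 0 := by exact_mod_cast hn.ne'
        rw [LSeries.term_of_ne_zero hn.ne', LSeries.term_of_ne_zero hn.ne', cpow_sub _ _ this]
        simp [div_div_eq_mul_div, this]
    have hL := LSeries_eq_mul_integral (fun m => ((m:ℂ)⁻¹)) (r := (s.re - 1) / 2)
      (s := s - 1) (by linarith) (by simp; linarith)
      (by
        rw [LSeriesSummable, funext hterm]
        exact LSeriesSummable_one_iff.2 hs)
      (by
        refine IsBigO.of_bound C (Eventually.of_forall fun n => ?_)
        rw [← harmonic_eq_sum_Icc_complex, norm_real, Real.norm_eq_abs,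
          abs_of_nonneg (harmonic_nonneg _), Real.norm_of_nonneg (by positivity)]
        exact hC n)
    rw [← LSeries_one_eq_riemannZeta hs, LSeries, ← tsum_congr hterm, ← LSeries, hL, mul_comm]
    congr 1
    refine setIntegral_congr_fun measurableSet_Ioi fun t _ => ?_
    simp only [harmonic_eq_sum_Icc_complex, smul_eq_mul]
    rw [mul_comm]; congr 2; ring

/-- The step function with values the Taylor coefficients of `h_k`. -/
noncomputable def hStep (k : ℕ) (t : ℝ) : ℂ := (hCoef k ⌊t⌋₊ : ℂ)

lemma measurable_hStep (k : ℕ) : Measurable (hStep k) :=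
  measurable_comp_floor (fun n => (hCoef k n : ℂ))

lemma norm_hStep_le {k : ℕ} (hk : 1 ≤ k) {t : ℝ} (ht : 0 < t) :
    ‖hStep k t‖ ≤ (2 + 3 * k) * t ^ (-(1:ℝ)) := by
  rw [hStep, norm_real, Real.norm_eq_abs, Real.rpow_neg_one, ← div_eq_mul_inv]
  refine (abs_hCoef_le hk _).trans ?_
  gcongr
  exact (Nat.lt_floor_add_one t).le

lemma hCoef_zero (k : ℕ) : hCoef k 0 = - Real.log k := by simp [hCoef]

lemma hStep_of_lt_one (k : ℕ) {t : ℝ} (ht : t < 1) : hStep k t = -(Real.log k : ℂ) := by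
  rw [hStep, Nat.floor_eq_zero.2 ht, hCoef_zero]; push_cast; rfl

lemma integral_hStep_of_one_lt_re {k : ℕ} (hk : 1 ≤ k) {s : ℂ} (hs : 1 < s.re) :
    (s - 1) * ∫ t in Ioi (1:ℝ), hStep k t * (t:ℂ) ^ (-s) =
      (1 - (k:ℂ) ^ (1 - s)) * riemannZeta s - Real.log k := by
  have hs1 : s - 1 ≠ 0 := by
    intro h; rw [sub_eq_zero] at h; rw [h] at hs; simp at hs
  have hk0 : (0:ℝ) < k := by exact_mod_cast hk
  have hki : (0:ℝ) < (k:ℝ)⁻¹ := inv_pos.2 hk0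
  have h1 := hasMellin_harmonic_floor hs
  have h2c := (MellinConvergent.comp_mul_left hki).2 h1.1
  have h2 := mellin_comp_mul_left (fun t : ℝ => ((harmonic ⌊t⌋₊ : ℝ) : ℂ)) (1 - s) hki
  have h3 := hasMellin_sub h1.1 h2c
  rw [h2, h1.2] at h3
  have hpow : (((k:ℝ)⁻¹ : ℝ) : ℂ) ^ (-(1 - s)) = (k:ℂ) ^ (1 - s) := by
    rw [cpow_neg, ofReal_inv, inv_cpow _ _ (by
      rw [ofReal_natCast, natCast_arg]; exact Real.pi_pos.ne), inv_inv, ofReal_natCast]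
  rw [hpow] at h3
  have hfl : ∀ t : ℝ, ⌊(k:ℝ)⁻¹ * t⌋₊ = ⌊t⌋₊ / k := by
    intro t
    rw [inv_mul_eq_div, Nat.floor_div_natCast]
  simp only [hfl] at h3
  obtain ⟨h3c, h3v⟩ := h3
  have hsub : Ioi (1:ℝ) ⊆ Ioi 0 := Ioi_subset_Ioi zero_le_one
  have h4 : ∫ t in Ioi (1:ℝ), (t:ℂ) ^ ((1 - s) - 1) •
      (((harmonic ⌊t⌋₊ : ℝ) : ℂ) - ((harmonic (⌊t⌋₊ / k) : ℝ) : ℂ)) =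
      riemannZeta s / (s - 1) - (k:ℂ) ^ (1 - s) • (riemannZeta s / (s - 1)) := by
    rw [← h3v, mellin]
    symm
    refine setIntegral_eq_of_subset_of_ae_sdiff_eq_zero measurableSet_Ioi.nullMeasurableSet hsub ?_
    filter_upwards [Measure.ae_ne volume (1:ℝ)] with t ht hmem
    have : t < 1 := lt_of_le_of_ne (by simpa using hmem.2) ht
    rw [Nat.floor_eq_zero.2 this]; simp
  have h5 : IntegrableOn (fun t : ℝ => (t:ℂ) ^ (-s)) (Ioi 1) :=
    integrableOn_Ioi_cpow_of_lt (by simpa using hs) one_pos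
  have h6 := integral_Ioi_cpow_of_lt (a := -s) (by simpa using hs) one_pos
  have h7 : ∫ t in Ioi (1:ℝ), hStep k t * (t:ℂ) ^ (-s) =
      (∫ t in Ioi (1:ℝ), (t:ℂ) ^ ((1 - s) - 1) •
      (((harmonic ⌊t⌋₊ : ℝ) : ℂ) - ((harmonic (⌊t⌋₊ / k) : ℝ) : ℂ))) -
      ∫ t in Ioi (1:ℝ), Real.log k * (t:ℂ) ^ (-s) := by
    rw [← integral_sub (h3c.mono_set hsub) (h5.const_mul _)]
    refine setIntegral_congr_fun measurableSet_Ioi fun t _ => ?_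
    simp only [hStep, hCoef, smul_eq_mul]
    rw [show (1 - s) - 1 = -s by ring]
    push_cast
    ring
  rw [h7, h4, integral_const_mul, h6]
  have : -s + 1 ≠ 0 := fun h => hs1 (by linear_combination -h)
  simp only [ofReal_one, one_cpow, smul_eq_mul]
  field_simp
  ring

lemma integral_hStep {k : ℕ} (hk : 1 ≤ k) {s : ℂ} (hs : 0 < s.re) (hs1 : s ≠ 1) :
    (s - 1) * ∫ t in Ioi (1:ℝ), hStep k t * (t:ℂ) ^ (-s) =
      (1 - (k:ℂ) ^ (1 - s)) * riemannZeta s - Real.log k := by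
  have hk0 : (k:ℂ) ≠ 0 := by exact_mod_cast (by omega : k ≠ 0)
  have key := eqOn_re_pos_of_eqOn_re_gt_one
    (f := fun s => (s - 1) * ((s - 1) * ∫ t in Ioi (1:ℝ), hStep k t * (t:ℂ) ^ (-s)))
    (g := fun s => (1 - (k:ℂ) ^ (1 - s)) * regZeta s - (s - 1) * Real.log k) ?_ ?_ ?_ hs
  · rw [regZeta_eq (ne_zero_of_re_pos' hs) hs1] at key
    exact mul_left_cancel₀ (sub_ne_zero.2 hs1) (by rw [key]; ring)
  · intro z hz
    have := differentiableAt_tailIntegral (measurable_hStep k)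
      (fun t ht => norm_hStep_le hk (one_pos.trans ht)) (s := z) (by simpa using hz)
    exact (differentiableAt_id.sub_const 1).mul ((differentiableAt_id.sub_const 1).mul this)
  · intro z hz
    have h1 := differentiableAt_regZeta (ne_zero_of_re_pos' hz)
    have h2 : DifferentiableAt ℂ (fun s : ℂ => (k:ℂ) ^ (1 - s)) z :=
      ((differentiableAt_const _).sub differentiableAt_id).const_cpow (Or.inl hk0)
    exact ((h2.const_sub 1).mul h1).sub ((differentiableAt_id.sub_const 1).mul_const _)
  · intro z hz
    have hz1 : z ≠ 1 := by rintro rfl; simp at hz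
    rw [integral_hStep_of_one_lt_re hk hz, regZeta_eq (ne_zero_of_re_pos' (by linarith)) hz1]
    ring

lemma integrableOn_hStep_mul_cpow {k : ℕ} (hk : 1 ≤ k) {s : ℂ} (hs : 0 < s.re) :
    IntegrableOn (fun t : ℝ => hStep k t * (t:ℂ) ^ (-s)) (Ioi 1) := by
  have hi : IntegrableOn (fun t : ℝ => (2 + 3 * (k:ℝ)) * t ^ (-1 - s.re)) (Ioi 1) :=
    (integrableOn_Ioi_rpow_of_lt (by linarith) one_pos).const_mul _
  refine Integrable.mono' hi ((measurable_hStep k).mul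
    (measurable_ofReal.pow_const _)).aestronglyMeasurable ?_
  refine (ae_restrict_iff' measurableSet_Ioi).2 (ae_of_all _ fun t ht => ?_)
  have ht0 : (0:ℝ) < t := one_pos.trans ht
  rw [norm_mul, norm_cpow_eq_rpow_re_of_pos ht0, sub_eq_add_neg, Real.rpow_add ht0, ← mul_assoc]
  exact mul_le_mul_of_nonneg_right (norm_hStep_le hk ht0) (by positivity)

lemma hasMellin_hStep {k : ℕ} (hk : 1 ≤ k) {z : ℂ} (hz0 : 0 < z.re) (hz1 : z.re < 1) :
    HasMellin (hStep k) z (((k:ℂ) ^ z - 1) * (riemannZeta (1 - z) / z)) := by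
  have hz : z ≠ 0 := ne_zero_of_re_pos' hz0
  have h1 := integral_hStep hk (s := 1 - z) (by simpa using hz1) (by simpa using hz)
  have h2 := integrableOn_hStep_mul_cpow hk (s := 1 - z) (by simpa using hz1)
  have h3 := (hasMellin_const_smul (hasMellin_one_Ioc hz0).1 (-(Real.log k : ℂ)))
  rw [(hasMellin_one_Ioc hz0).2] at h3
  have h4 : HasMellin ((Ioi (1:ℝ)).indicator (hStep k)) z
      (∫ t in Ioi (1:ℝ), hStep k t * (t:ℂ) ^ (-(1 - z))) := by
    have e : (fun t : ℝ => (t:ℂ) ^ (z - 1) • (Ioi (1:ℝ)).indicator (hStep k) t) =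
        (Ioi (1:ℝ)).indicator (fun t => hStep k t * (t:ℂ) ^ (-(1 - z))) := by
      ext t
      by_cases ht : t ∈ Ioi (1:ℝ)
      · rw [indicator_of_mem ht, indicator_of_mem ht, smul_eq_mul, mul_comm, neg_sub]
      · rw [indicator_of_notMem ht, indicator_of_notMem ht, smul_zero]
    have hinter : Ioi (0:ℝ) ∩ Ioi 1 = Ioi 1 := inter_eq_right.2 (Ioi_subset_Ioi zero_le_one)
    refine ⟨?_, ?_⟩
    · rw [MellinConvergent, e]
      exact ((integrable_indicator_iff measurableSet_Ioi).2 h2).integrableOn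
    · rw [mellin, e, setIntegral_indicator measurableSet_Ioi, hinter]
  have h5 := hasMellin_add h3.1 h4.1
  rw [h3.2, h4.2] at h5
  have hae : ∀ᵐ t ∂volume.restrict (Ioi (0:ℝ)),
      -(Real.log k : ℂ) • (Ioc (0:ℝ) 1).indicator (fun _ => (1:ℂ)) t +
        (Ioi (1:ℝ)).indicator (hStep k) t = hStep k t := by
    refine (ae_restrict_iff' measurableSet_Ioi).2 ?_
    filter_upwards [Measure.ae_ne volume (1:ℝ)] with t ht ht0
    rcases lt_or_gt_of_ne ht with h | h
    · rw [indicator_of_mem (show t ∈ Ioc (0:ℝ) 1 from ⟨ht0, h.le⟩),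
        indicator_of_notMem (show t ∉ Ioi (1:ℝ) from fun h' => lt_asymm h h'), hStep_of_lt_one k h]
      simp
    · rw [indicator_of_notMem (show t ∉ Ioc (0:ℝ) 1 from fun h' => h.not_ge h'.2),
        indicator_of_mem (show t ∈ Ioi (1:ℝ) from h)]
      simp
  refine ⟨(integrable_congr (hae.mono fun t ht => ?_)).1 h5.1, ?_⟩
  · simp only [ht]
  · have : mellin (hStep k) z = -(Real.log k : ℂ) • (1 / z) +
        ∫ t in Ioi (1:ℝ), hStep k t * (t:ℂ) ^ (-(1 - z)) := by
      rw [← h5.2]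
      exact integral_congr_ae (hae.mono fun t ht => by simp only [ht])
    rw [this]
    have e1 : (1 - z) - 1 = -z := by ring
    have e2 : 1 - (1 - z) = z := by ring
    rw [e1, e2] at h1
    simp only [smul_eq_mul]
    field_simp
    linear_combination -h1

lemma hasMellin_indicator_Ioo {n : ℕ} (hn : 1 ≤ n) {z : ℂ} (hz : 0 < z.re) :
    HasMellin ((Ioo (0:ℝ) n).indicator fun _ => (1:ℂ)) z ((n:ℂ) ^ z / z) := by
  have hn0 : (0:ℝ) < (n:ℝ)⁻¹ := by positivity
  have h1 := hasMellin_one_Ioc hz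
  have h2 := (MellinConvergent.comp_mul_left hn0).2 h1.1
  have h3 := mellin_comp_mul_left (indicator (Ioc (0:ℝ) 1) (fun _ => (1:ℂ))) z hn0
  have hpow : (((n:ℝ)⁻¹ : ℝ) : ℂ) ^ (-z) = (n:ℂ) ^ z := by
    rw [cpow_neg, ofReal_inv, inv_cpow _ _ (by
      rw [ofReal_natCast, natCast_arg]; exact Real.pi_pos.ne), inv_inv, ofReal_natCast]
  have hae : ∀ᵐ t ∂volume.restrict (Ioi (0:ℝ)), indicator (Ioc (0:ℝ) 1) (fun _ => (1:ℂ))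
      ((n:ℝ)⁻¹ * t) = (Ioo (0:ℝ) n).indicator (fun _ => (1:ℂ)) t := by
    refine ae_restrict_of_ae ?_
    have hn1 : (0:ℝ) < n := by positivity
    filter_upwards [Measure.ae_ne volume (n:ℝ)] with t ht
    simp only [indicator, mem_Ioc, mem_Ioo]
    congr 1
    rw [inv_mul_le_iff₀ hn1, mul_one, le_iff_lt_or_eq, mul_pos_iff_of_pos_left hn0]
    simp [ht]
  refine ⟨(integrable_congr (hae.mono fun t ht => ?_)).1 h2, ?_⟩
  · simp only [ht]
  · rw [h1.2, hpow] at h3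
    rw [div_eq_mul_one_div, ← smul_eq_mul, ← h3]
    exact integral_congr_ae (hae.mono fun t ht => by simp only [ht])

section FourierPlancherel

open scoped FourierTransform SchwartzMap ContDiff

lemma fourier_toLp_ae_eq {f : ℝ → ℂ} (hf : Integrable f) (hf2 : MemLp f 2 volume) :
    ((𝓕 (hf2.toLp f) : Lp ℂ 2 (volume : Measure ℝ)) : ℝ → ℂ) =ᵐ[volume] 𝓕 f := by
  have hcont : Continuous (𝓕 f) := VectorFourier.fourierIntegral_continuous
    Real.continuous_fourierChar (by exact (innerSL ℝ).continuous₂) hf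
  refine ae_eq_of_integral_contDiff_smul_eq
    ((Lp.memLp (𝓕 (hf2.toLp f))).locallyIntegrable (by norm_num))
    hcont.locallyIntegrable fun g hg hgs => ?_
  have hgs' : HasCompactSupport (fun x => (g x : ℂ)) :=
    hgs.comp_left (g := fun x : ℝ => (x : ℂ)) (by simp)
  have hg' : ContDiff ℝ ∞ (fun x => (g x : ℂ)) := ofRealCLM.contDiff.comp hg
  set G : 𝓢(ℝ, ℂ) := hgs'.toSchwartzMap hg' with hG
  have hGa : ∀ x, G x = (g x : ℂ) := fun x => rfl
  have h1 := DFunLike.congr_fun (Lp.fourier_toTemperedDistribution_eq (hf2.toLp f)) G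
  rw [TemperedDistribution.fourier_apply, Lp.toTemperedDistribution_apply,
    Lp.toTemperedDistribution_apply] at h1
  have h2 : ∫ x, (𝓕 G) x • (hf2.toLp f) x = ∫ x, (𝓕 (G : ℝ → ℂ)) x • f x := by
    refine integral_congr_ae ?_
    filter_upwards [hf2.coeFn_toLp] with x hx
    rw [hx, SchwartzMap.fourier_coe]
  have h3 : ∫ ξ, (𝓕 (G : ℝ → ℂ)) ξ • f ξ = ∫ x, G x • (𝓕 f) x := by
    have := VectorFourier.integral_fourierIntegral_smul_eq_flip (L := innerₗ ℝ) (μ := volume)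
      (ν := volume) (f := (G : ℝ → ℂ)) (g := f) Real.continuous_fourierChar
      continuous_inner G.integrable hf
    rw [flip_innerₗ] at this
    exact this
  rw [h2, h3] at h1
  simpa [hGa] using h1.symm

/-- Parseval's formula, in bilinear form. -/
lemma exists_memLp_integral_mul_fourier {β : ℝ → ℂ} (hβ : MemLp β 2 volume) :
    ∃ F : ℝ → ℂ, MemLp F 2 volume ∧ ∀ f : ℝ → ℂ, Integrable f → MemLp f 2 volume →
      ∫ ξ, F ξ * 𝓕 f ξ = ∫ u, β u * f u := by
  set b : Lp ℂ 2 (volume : Measure ℝ) := (hβ.star).toLp (star β) with hb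
  refine ⟨star (𝓕 b : Lp ℂ 2 (volume : Measure ℝ)), (Lp.memLp _).star, fun f hf hf2 => ?_⟩
  have h := Lp.inner_fourier_eq b (hf2.toLp f)
  rw [L2.inner_def, L2.inner_def] at h
  have h1 : ∫ u, inner ℂ (b u) (hf2.toLp f u) = ∫ u, β u * f u := by
    refine integral_congr_ae ?_
    filter_upwards [hf2.coeFn_toLp, (hβ.star).coeFn_toLp] with u h1 h2
    rw [h1, hb, h2]
    simp [mul_comm]
  rw [← h1, ← h]
  refine integral_congr_ae ?_
  filter_upwards [fourier_toLp_ae_eq hf hf2] with ξ hξ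
  rw [hξ]
  simp [mul_comm]

lemma hasDerivWithinAt_rexp_neg (x : ℝ) :
    HasDerivWithinAt (fun x => Real.exp (-x)) (-Real.exp (-x)) univ x := by
  have := ((Real.hasDerivAt_exp (-x)).comp x (hasDerivAt_neg x)).hasDerivWithinAt (s := univ)
  rwa [mul_neg_one] at this

lemma image_rexp_neg : (fun x => Real.exp (-x)) '' univ = Ioi 0 := by
  rw [← Real.range_exp, image_univ]
  exact neg_surjective.range_comp Real.exp

lemma injOn_rexp_neg : univ.InjOn (fun x : ℝ => Real.exp (-x)) := fun x _ y _ h => by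
  simpa using h

lemma integral_exp_neg_mul_comp {E : Type*} [NormedAddCommGroup E] [NormedSpace ℝ E]
    (g : ℝ → E) :
    ∫ u : ℝ, Real.exp (-u) • g (Real.exp (-u)) = ∫ t in Ioi (0:ℝ), g t := by
  rw [← image_rexp_neg, integral_image_eq_integral_abs_deriv_smul MeasurableSet.univ
    (fun x _ => hasDerivWithinAt_rexp_neg x) injOn_rexp_neg]
  simp

lemma integrable_exp_neg_mul_comp_iff {E : Type*} [NormedAddCommGroup E] [NormedSpace ℝ E]
    (g : ℝ → E) :
    Integrable (fun u : ℝ => Real.exp (-u) • g (Real.exp (-u))) ↔ IntegrableOn g (Ioi 0) := by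
  rw [← image_rexp_neg, integrableOn_image_iff_integrableOn_abs_deriv_smul MeasurableSet.univ
    (fun x _ => hasDerivWithinAt_rexp_neg x) injOn_rexp_neg]
  simp

lemma exp_neg_half_sq (u : ℝ) :
    Real.exp (-(1/2) * u) * Real.exp (-(1/2) * u) = Real.exp (-u) := by
  rw [← Real.exp_add]; ring_nf

lemma memLp_exp_neg_half_comp {B : ℝ → ℂ} (hBm : Measurable B)
    (hB : MemLp B 2 (volume.restrict (Ioi 0))) :
    MemLp (fun u : ℝ => Real.exp (-(1/2) * u) • B (Real.exp (-u))) 2 volume := by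
  have hm : Measurable (fun u : ℝ => Real.exp (-(1/2) * u) • B (Real.exp (-u))) := by fun_prop
  rw [memLp_two_iff_integrable_sq_norm hm.aestronglyMeasurable]
  have h := (integrable_exp_neg_mul_comp_iff (fun t => ‖B t‖ ^ 2)).2
    ((memLp_two_iff_integrable_sq_norm hBm.aestronglyMeasurable).1 hB)
  refine h.congr (ae_of_all _ fun u => ?_)
  simp only [smul_eq_mul, norm_smul, Real.norm_eq_abs, Real.abs_exp, mul_pow]
  rw [← exp_neg_half_sq]
  ring

/-- Parseval's formula for the Mellin transform on the critical line. -/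
lemma exists_memLp_integral_mul_mellin {B : ℝ → ℂ} (hBm : Measurable B)
    (hB : MemLp B 2 (volume.restrict (Ioi 0))) :
    ∃ F : ℝ → ℂ, MemLp F 2 volume ∧ ∀ A : ℝ → ℂ, Measurable A → MellinConvergent A (1/2) →
      MemLp A 2 (volume.restrict (Ioi 0)) →
      ∫ ξ, F ξ * mellin A (critPt ξ) = ∫ t in Ioi (0:ℝ), B t * A t := by
  obtain ⟨F, hF, h⟩ := exists_memLp_integral_mul_fourier (memLp_exp_neg_half_comp hBm hB)
  refine ⟨F, hF, fun A hAm hA1 hA2 => ?_⟩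
  have hi : Integrable (fun u : ℝ => Real.exp (-(1/2) * u) • A (Real.exp (-u))) := by
    refine ((integrable_exp_neg_mul_comp_iff _).2 hA1).congr (ae_of_all _ fun u => ?_)
    simp only
    rw [show ((1:ℂ)/2 - 1) = ((-(1/2) : ℝ) : ℂ) by push_cast; ring,
      ← ofReal_cpow (Real.exp_pos _).le, ← Real.exp_mul, coe_smul, smul_smul, ← Real.exp_add]
    congr 2; ring
  have h1 := h _ hi (memLp_exp_neg_half_comp hAm hA2)
  rw [← integral_exp_neg_mul_comp]
  have hm : ∀ ξ, mellin A (critPt ξ) =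
      𝓕 (fun u : ℝ => Real.exp (-(1/2) * u) • A (Real.exp (-u))) ξ := by
    intro ξ
    rw [mellin_eq_fourier, critPt_re, critPt_im, mul_div_cancel_left₀ _ (by positivity)]
  simp only [hm, h1]
  congr 1 with u
  rw [← exp_neg_half_sq u]
  simp only [real_smul]
  push_cast
  ring

end FourierPlancherel

lemma map_floor_volume_restrict_Ioi :
    Measure.map (fun t : ℝ => ⌊t⌋₊) (volume.restrict (Ioi 0)) = Measure.count := by
  rw [Measure.ext_iff_singleton]
  intro n
  rw [Measure.count_singleton, Measure.map_apply Nat.measurable_floor (measurableSet_singleton n),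
    restrict_Ioi_eq_restrict_Ici, Measure.restrict_apply (Nat.measurable_floor
    (measurableSet_singleton n))]
  have : (fun t : ℝ => ⌊t⌋₊) ⁻¹' {n} ∩ Ici 0 = Ico (n:ℝ) (n + 1) := by
    ext t
    simp only [mem_inter_iff, mem_preimage, mem_singleton_iff, mem_Ici, mem_Ico]
    constructor
    · rintro ⟨h, h0⟩
      exact (Nat.floor_eq_iff h0).1 h
    · rintro h
      have h0 : 0 ≤ t := (Nat.cast_nonneg n).trans h.1
      exact ⟨(Nat.floor_eq_iff h0).2 h, h0⟩
  rw [this, Real.volume_Ico]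
  simp

lemma integrableOn_comp_floor_iff {E : Type*} [NormedAddCommGroup E] [NormedSpace ℝ E]
    {f : ℕ → E} : IntegrableOn (fun t : ℝ => f ⌊t⌋₊) (Ioi 0) ↔ Summable fun n => ‖f n‖ := by
  rw [← integrable_count_iff, ← map_floor_volume_restrict_Ioi,
    integrable_map_measure (by fun_prop) (by fun_prop)]
  rfl

lemma integral_comp_floor {f : ℕ → ℂ} (hf : Summable fun n => ‖f n‖) :
    ∫ t in Ioi (0:ℝ), f ⌊t⌋₊ = ∑' n, f n := by
  rw [← integral_map (f := f) (φ := fun t : ℝ => ⌊t⌋₊) (by fun_prop) (by fun_prop),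
    map_floor_volume_restrict_Ioi, integral_countable (integrable_count_iff.2 hf)]
  simp [Measure.real]

lemma memLp_comp_floor {f : ℕ → ℂ} (hf : Summable fun n => ‖f n‖ ^ 2) :
    MemLp (fun t : ℝ => f ⌊t⌋₊) 2 (volume.restrict (Ioi 0)) := by
  rw [memLp_two_iff_integrable_sq_norm (measurable_comp_floor f).aestronglyMeasurable]
  exact integrableOn_comp_floor_iff (f := fun n => ‖f n‖ ^ 2).2 (by simpa using hf)

lemma summable_hCoef_sq {k : ℕ} (hk : 1 ≤ k) : Summable fun n => ‖(hCoef k n : ℂ)‖ ^ 2 := by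
  have h1 : Summable fun n : ℕ => (2 + 3 * (k:ℝ)) ^ 2 * (1 / ((n + 1 : ℕ) : ℝ) ^ 2) :=
    ((summable_nat_add_iff 1).2 (Real.summable_one_div_nat_pow.2 one_lt_two)).mul_left _
  refine Summable.of_nonneg_of_le (fun n => by positivity) (fun n => ?_) h1
  rw [norm_real, Real.norm_eq_abs, mul_one_div, ← div_pow]
  refine pow_le_pow_left₀ (abs_nonneg _) ?_ 2
  push_cast
  exact abs_hCoef_le hk n

lemma summable_norm_mul_of_sq {f g : ℕ → ℂ} (hf : Summable fun n => ‖f n‖ ^ 2)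
    (hg : Summable fun n => ‖g n‖ ^ 2) : Summable fun n => ‖f n * g n‖ := by
  refine Summable.of_nonneg_of_le (fun n => norm_nonneg _) (fun n => ?_) (hf.add hg)
  rw [norm_mul]
  nlinarith [sq_nonneg (‖f n‖ - ‖g n‖), norm_nonneg (f n), norm_nonneg (g n)]

/-- Under the Riemann Hypothesis, the coefficient sequences of the `h_k` are complete in `ℓ²`. -/
theorem eq_zero_of_tsum_mul_hCoef_eq_zero (hRH : RiemannHypothesis) {b : ℕ → ℂ}
    (hb : Summable fun n => ‖b n‖ ^ 2)
    (h : ∀ k : ℕ, 2 ≤ k → ∑' n, b n * (hCoef k n : ℂ) = 0) (n : ℕ) : b n = 0 := by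
  obtain ⟨F, hF, hP⟩ := exists_memLp_integral_mul_mellin (measurable_comp_floor b)
    (memLp_comp_floor hb)
  have hre : ∀ ξ, (critPt ξ).re = 1 / 2 := fun ξ => critPt_re ξ
  have h1 : ∀ k : ℕ, 2 ≤ k →
      ∫ ξ, F ξ * (((k:ℂ) ^ critPt ξ - 1) * (riemannZeta (1 - critPt ξ) / critPt ξ)) = 0 := by
    intro k hk
    have hk1 : 1 ≤ k := by omega
    have h2 := hP (hStep k) (measurable_hStep k)
      (hasMellin_hStep hk1 (z := 1/2) (by norm_num) (by norm_num)).1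
      (memLp_comp_floor (summable_hCoef_sq hk1))
    have h3 : ∀ ξ, mellin (hStep k) (critPt ξ) =
        ((k:ℂ) ^ critPt ξ - 1) * (riemannZeta (1 - critPt ξ) / critPt ξ) := fun ξ =>
      (hasMellin_hStep hk1 (by rw [hre]; norm_num) (by rw [hre]; norm_num)).2
    simp only [h3] at h2
    rw [h2, ← h k hk]
    exact integral_comp_floor (summable_norm_mul_of_sq hb (summable_hCoef_sq hk1))
  have hsum : ∀ m : ℕ, ∑ j ∈ Finset.range m, b j = 0 := by
    intro m
    rcases Nat.eq_zero_or_pos m with rfl | hm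
    · simp
    have h2 := integral_mul_cpow_div_critPt_eq_zero hRH hF h1 hm
    have hc : ∀ t ∈ Ioi (0:ℝ), (Ioo (0:ℝ) m).indicator (fun _ => (1:ℂ)) t =
        (fun j : ℕ => if j < m then (1:ℂ) else 0) ⌊t⌋₊ := by
      intro t ht
      simp only [indicator, mem_Ioo, Nat.floor_lt (mem_Ioi.1 ht).le, mem_Ioi.1 ht, true_and]
    have hs1 : Summable fun j : ℕ => ‖(if j < m then (1:ℂ) else 0)‖ ^ 2 := by
      refine summable_of_ne_finset_zero (s := Finset.range m) fun j hj => ?_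
      rw [Finset.mem_range] at hj
      simp [hj]
    have hL := memLp_comp_floor hs1
    have hL' : MemLp ((Ioo (0:ℝ) m).indicator (fun _ => (1:ℂ))) 2 (volume.restrict (Ioi 0)) :=
      hL.ae_eq ((ae_restrict_iff' measurableSet_Ioi).2 (ae_of_all _ fun t ht => (hc t ht).symm))
    have h3 := hP _ (measurable_const.indicator measurableSet_Ioo)
      (hasMellin_indicator_Ioo hm (z := 1/2) (by norm_num)).1 hL'
    have h4 : ∀ ξ, mellin ((Ioo (0:ℝ) m).indicator (fun _ => (1:ℂ))) (critPt ξ) =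
        (m:ℂ) ^ critPt ξ / critPt ξ := fun ξ =>
      (hasMellin_indicator_Ioo hm (by rw [hre]; norm_num)).2
    simp only [h4] at h3
    rw [h2, setIntegral_congr_fun measurableSet_Ioi
      (g := fun t => (fun j : ℕ => b j * if j < m then (1:ℂ) else 0) ⌊t⌋₊)
      (fun t ht => by simp only [hc t ht])] at h3
    rw [integral_comp_floor (summable_norm_mul_of_sq hb hs1)] at h3
    rw [tsum_eq_sum (s := Finset.range m) (fun j hj => by
      rw [Finset.mem_range] at hj; simp [hj])] at h3
    rw [h3]
    refine Finset.sum_congr rfl fun j hj => ?_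
    rw [if_pos (Finset.mem_range.1 hj), mul_one]
  have h2 := hsum (n + 1)
  rwa [Finset.sum_range_succ, hsum n, zero_add] at h2

lemma iUnion_Ico_natCast : (⋃ n : ℕ, Ico (n:ℝ) (n + 1)) = Ici 0 := by
  ext t
  simp only [mem_iUnion, mem_Ico, mem_Ici]
  constructor
  · rintro ⟨n, h, -⟩
    exact (Nat.cast_nonneg n).trans h
  · intro h
    exact ⟨⌊t⌋₊, Nat.floor_le h, Nat.lt_floor_add_one t⟩

lemma pairwise_disjoint_Ico_natCast :
    Pairwise (Function.onFun Disjoint fun n : ℕ => Ico (n:ℝ) (n + 1)) := by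
  intro m n hmn
  rw [Function.onFun, Set.disjoint_left]
  rintro t ⟨h1, h2⟩ ⟨h3, h4⟩
  have h5 : (m:ℝ) < n + 1 := h1.trans_lt h4
  have h6 : (n:ℝ) < m + 1 := h3.trans_lt h2
  have h7 : m < n + 1 := by exact_mod_cast h5
  have h8 : n < m + 1 := by exact_mod_cast h6
  omega

/-- A zero of `ζ` to the right of the critical line yields a nonzero element of `ℓ²`
annihilating all coefficient sequences of the `h_k`. -/
lemma exists_annihilator {s : ℂ} (hs : riemannZeta s = 0) (h2 : 1 / 2 < s.re) :
    ∃ v : ℕ → ℂ, (Summable fun n => ‖v n‖ ^ 2) ∧ v 0 ≠ 0 ∧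
      ∀ k : ℕ, 2 ≤ k → ∑' n, v n * (hCoef k n : ℂ) = 0 := by
  have h1 : s.re < 1 := by
    by_contra! h
    exact riemannZeta_ne_zero_of_one_le_re h hs
  have hz0 : 0 < (1 - s).re := by simpa using h1
  have hz1 : (1 - s).re < 1 := by simp; linarith
  refine ⟨fun n => ∫ t in Ico (n:ℝ) (n + 1), (t:ℂ) ^ (-s), ?_, ?_, ?_⟩
  · rw [← summable_nat_add_iff 1]
    have hS : Summable fun n : ℕ => 1 / ((n + 1 : ℕ) : ℝ) ^ (2 * s.re) :=
      (summable_nat_add_iff 1).2 (Real.summable_one_div_nat_rpow.2 (by linarith))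
    refine Summable.of_nonneg_of_le (fun n => by positivity) (fun n => ?_) hS
    have hn : (0:ℝ) < ((n + 1 : ℕ) : ℝ) := by positivity
    have := norm_setIntegral_le_of_norm_le_const (μ := volume)
      (s := Ico ((n + 1 : ℕ) : ℝ) ((n + 1 : ℕ) + 1)) (f := fun t : ℝ => (t:ℂ) ^ (-s))
      (C := ((n + 1 : ℕ) : ℝ) ^ (-s.re)) (by simp) (fun t ht => by
        rw [norm_cpow_eq_rpow_re_of_pos (hn.trans_le ht.1), neg_re]
        exact Real.rpow_le_rpow_of_nonpos hn ht.1 (by linarith))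
    rw [Measure.real, Real.volume_Ico, add_sub_cancel_left, ENNReal.toReal_ofReal zero_le_one,
      mul_one] at this
    calc _ ≤ (((n + 1 : ℕ) : ℝ) ^ (-s.re)) ^ 2 := by gcongr
      _ = _ := by
        rw [← Real.rpow_natCast, ← Real.rpow_mul hn.le, one_div, ← Real.rpow_neg hn.le]
        congr 1; push_cast; ring
  · have h3 := (hasMellin_one_Ioc hz0).2
    have h4 : ∫ t in Ico ((0:ℕ):ℝ) ((0:ℕ) + 1), (t:ℂ) ^ (-s) = 1 / (1 - s) := by
      rw [← h3, mellin]
      simp_rw [← indicator_smul]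
      rw [setIntegral_indicator measurableSet_Ioc,
        (inter_eq_right.2 fun t ht => ht.1 : Ioi (0:ℝ) ∩ Ioc 0 1 = Ioc 0 1), Nat.cast_zero, zero_add,
        integral_Ico_eq_integral_Ioo, integral_Ioc_eq_integral_Ioo]
      refine setIntegral_congr_fun measurableSet_Ioo fun t _ => ?_
      simp
    simp only [h4]
    exact one_div_ne_zero (ne_zero_of_re_pos' hz0)
  · intro k hk
    have h3 := hasMellin_hStep (k := k) (by omega) hz0 hz1
    rw [show (1:ℂ) - (1 - s) = s by ring, hs, zero_div, mul_zero] at h3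
    have h4 : HasSum (fun n : ℕ => ∫ t in Ico (n:ℝ) (n + 1), (t:ℂ) ^ ((1 - s) - 1) • hStep k t)
        (∫ t in ⋃ n : ℕ, Ico (n:ℝ) (n + 1), (t:ℂ) ^ ((1 - s) - 1) • hStep k t) := by
      refine hasSum_integral_iUnion (fun n => measurableSet_Ico) pairwise_disjoint_Ico_natCast ?_
      rw [iUnion_Ico_natCast, integrableOn_Ici_iff_integrableOn_Ioi]
      exact h3.1
    rw [iUnion_Ico_natCast, integral_Ici_eq_integral_Ioi, ← mellin, h3.2] at h4
    rw [← h4.tsum_eq]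
    refine tsum_congr fun n => ?_
    rw [← integral_mul_const]
    refine setIntegral_congr_fun measurableSet_Ico fun t ht => ?_
    have : ⌊t⌋₊ = n := (Nat.floor_eq_iff ((Nat.cast_nonneg n).trans ht.1)).2 ht
    simp only [hStep, this, smul_eq_mul]
    congr 2; ring

lemma exists_zero_of_not_riemannHypothesis (h : ¬ RiemannHypothesis) :
    ∃ s : ℂ, riemannZeta s = 0 ∧ 1 / 2 < s.re := by
  unfold RiemannHypothesis at h
  push Not at h
  obtain ⟨s, hs, htriv, hs1, hre⟩ := h
  rcases lt_or_gt_of_ne hre with h | h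
  · have hne : ∀ n : ℕ, 1 - s ≠ -n := by
      intro n hn
      have := congrArg re hn
      simp at this
      have : (0:ℝ) ≤ n := by positivity
      linarith
    have hs0 : s ≠ 0 := by
      rintro rfl
      rw [riemannZeta_zero] at hs
      norm_num at hs
    have h1 := riemannZeta_one_sub hne (by simpa using hs0)
    rw [sub_sub_cancel, hs] at h1
    have hG := Gamma_ne_zero hne
    have hp : (2 * (Real.pi:ℂ)) ^ (-(1 - s)) ≠ 0 := by
      rw [Ne, cpow_eq_zero_iff, not_and_or]
      left
      norm_num [Real.pi_ne_zero]
    have h2 : Complex.cos (Real.pi * (1 - s) / 2) = 0 ∨ riemannZeta (1 - s) = 0 := by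
      simpa [hp, hG] using h1.symm
    rcases h2 with h2 | h2
    · exfalso
      obtain ⟨m, hm⟩ := Complex.cos_eq_zero_iff.1 h2
      have hpi : (Real.pi:ℂ) ≠ 0 := by exact_mod_cast Real.pi_ne_zero
      have h3 : s = -2 * m := by
        have : (Real.pi:ℂ) * (1 - s) = Real.pi * (2 * m + 1) := by linear_combination 2 * hm
        have := mul_left_cancel₀ hpi this
        linear_combination -this
      have h4 : 0 ≤ m := by
        by_contra! hneg
        have h5 := congrArg re h3
        have h6 : (m:ℝ) ≤ -1 := by exact_mod_cast (by omega : m ≤ -1)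
        simp at h5
        linarith
      obtain ⟨n, rfl⟩ := Int.eq_ofNat_of_zero_le h4
      rcases n with _ | n
      · simp at h3; exact hs0 h3
      · exact htriv n (by rw [h3]; push_cast; ring)
    · exact ⟨1 - s, h2, by simp; linarith⟩
  · exact ⟨s, hs, h⟩

instance instFactTwoPiPos : Fact (0 < 2 * Real.pi) := ⟨Real.two_pi_pos⟩

lemma measurable_exp_mul_I : Measurable (fun θ : ℝ => Complex.exp (θ * Complex.I)) := by fun_prop

lemma continuous_coe_toCircle :
    Continuous (fun x : AddCircle (2 * Real.pi) => (AddCircle.toCircle x : ℂ)) :=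
  continuous_subtype_val.comp AddCircle.continuous_toCircle

lemma measurePreserving_toCircle :
    MeasurePreserving (fun x : AddCircle (2 * Real.pi) => (AddCircle.toCircle x : ℂ))
      AddCircle.haarAddCircle mCirc := by
  have hm : Measurable (fun x : AddCircle (2 * Real.pi) => (AddCircle.toCircle x : ℂ)) :=
    continuous_coe_toCircle.measurable
  refine ⟨hm, ?_⟩
  have h1 : (AddCircle.haarAddCircle : Measure (AddCircle (2 * Real.pi))) =
      (ENNReal.ofReal (2 * Real.pi))⁻¹ • volume := by
    rw [AddCircle.volume_eq_smul_haarAddCircle, smul_smul, ENNReal.inv_mul_cancel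
      (by simpa using Real.pi_pos) ENNReal.ofReal_ne_top, one_smul]
  have h2 := (AddCircle.measurePreserving_mk (2 * Real.pi) 0).map_eq
  rw [h1, Measure.map_smul, mCirc, ← h2, Measure.map_map hm (AddCircle.measurable_mk'), zero_add]
  congr 2
  ext θ
  simp only [Function.comp_apply]
  rw [AddCircle.toCircle_apply_mk, Circle.coe_exp, div_self (by positivity), one_mul]

instance instIsProbabilityMeasureMCirc : IsProbabilityMeasure mCirc :=
  measurePreserving_toCircle.map_eq ▸
    Measure.isProbabilityMeasure_map measurePreserving_toCircle.measurable.aemeasurable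

lemma ae_mCirc_of_forall_Ioc {p : ℂ → Prop} (hp : MeasurableSet {z | p z})
    (h : ∀ᵐ θ : ℝ, p (Complex.exp (θ * Complex.I))) : ∀ᵐ ω ∂mCirc, p ω := by
  rw [mCirc]
  refine Measure.ae_smul_measure ?_ _
  rw [ae_map_iff measurable_exp_mul_I.aemeasurable hp]
  exact ae_restrict_of_ae h

lemma ae_norm_eq_one : ∀ᵐ ω ∂mCirc, ‖ω‖ = 1 :=
  ae_mCirc_of_forall_Ioc (measurableSet_eq_fun measurable_norm measurable_const)
    (ae_of_all _ fun θ => norm_exp_ofReal_mul_I θ)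

lemma ae_pow_ne_one {k : ℕ} (hk : 1 ≤ k) : ∀ᵐ ω ∂mCirc, ω ^ k ≠ 1 := by
  refine ae_mCirc_of_forall_Ioc (p := fun ω => ω ^ k ≠ 1)
    (measurableSet_eq_fun (measurable_id.pow_const k) measurable_const).compl ?_
  have hc : (range fun n : ℤ => (n * (2 * Real.pi) / k : ℝ)).Countable := countable_range _
  filter_upwards [hc.ae_notMem volume] with θ hθ h
  rw [← Complex.exp_nat_mul, Complex.exp_eq_one_iff] at h
  obtain ⟨n, hn⟩ := h
  refine hθ ⟨n, ?_⟩
  have hk0 : (k:ℝ) ≠ 0 := by exact_mod_cast (by omega : k ≠ 0)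
  have h2 : ((k:ℝ) : ℂ) * θ = n * (2 * Real.pi) := by
    apply mul_right_cancel₀ I_ne_zero
    push_cast
    linear_combination hn
  have h3 : (k:ℝ) * θ = n * (2 * Real.pi) := by exact_mod_cast h2
  simp only
  rw [← h3, mul_div_cancel_left₀ _ hk0]

lemma ae_ne_one : ∀ᵐ ω ∂mCirc, ω ≠ 1 := by simpa using ae_pow_ne_one le_rfl

lemma integrable_mCirc_of_circleIntegrable {f : ℂ → ℝ} (hf : Measurable f)
    (h : CircleIntegrable f 0 1) : Integrable f mCirc := by
  rw [mCirc]
  refine Integrable.smul_measure ?_ (by simpa using Real.pi_pos)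
  rw [integrable_map_measure hf.aestronglyMeasurable measurable_exp_mul_I.aemeasurable]
  have := h
  rw [CircleIntegrable, intervalIntegrable_iff_integrableOn_Ioc_of_le Real.two_pi_pos.le] at this
  refine this.congr (ae_of_all _ fun θ => ?_)
  simp [circleMap]

lemma measurable_zpow (n : ℤ) : Measurable (fun ω : ℂ => ω ^ n) := by fun_prop

lemma memLp_zpow (n : ℤ) : MemLp (fun ω : ℂ => ω ^ n) 2 mCirc := by
  refine MemLp.of_bound (measurable_zpow n).aestronglyMeasurable 1 ?_
  filter_upwards [ae_norm_eq_one] with ω hω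
  rw [norm_zpow, hω, one_zpow]

/-- The monomial `ω ^ n` as an element of `L²(𝕋)`. -/
noncomputable def mono (n : ℤ) : Lp ℂ 2 mCirc := (memLp_zpow n).toLp _

lemma coeFn_mono (n : ℤ) : (mono n : ℂ → ℂ) =ᵐ[mCirc] fun ω => ω ^ n := (memLp_zpow n).coeFn_toLp

/-- Composition with the parametrization of the circle. -/
noncomputable def toAddCircle : Lp ℂ 2 mCirc →ₗᵢ[ℂ]
    Lp ℂ 2 (AddCircle.haarAddCircle : Measure (AddCircle (2 * Real.pi))) :=
  Lp.compMeasurePreservingₗᵢ ℂ _ measurePreserving_toCircle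

lemma toAddCircle_mono (n : ℤ) : toAddCircle (mono n) = fourierLp 2 n := by
  have h : toAddCircle (mono n) = ((memLp_zpow n).comp_measurePreserving
      measurePreserving_toCircle).toLp _ := Lp.toLp_compMeasurePreserving _ _
  rw [h]
  refine Lp.ext ?_
  filter_upwards [MemLp.coeFn_toLp ((memLp_zpow n).comp_measurePreserving
    measurePreserving_toCircle), coeFn_fourierLp (T := 2 * Real.pi) 2 n] with x h1 h2
  rw [h1, h2, Function.comp_apply, fourier_apply, AddCircle.toCircle_zsmul, Circle.coe_zpow]

lemma orthonormal_mono : Orthonormal ℂ mono := by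
  rw [← toAddCircle.orthonormal_comp_iff]
  have : toAddCircle ∘ mono = fourierLp 2 := funext toAddCircle_mono
  rw [this]
  exact orthonormal_fourier

/-- The monomials form a Hilbert basis of `L²(𝕋)`. -/
noncomputable def monoBasis : HilbertBasis ℤ ℂ (Lp ℂ 2 mCirc) :=
  HilbertBasis.mkOfOrthogonalEqBot orthonormal_mono <| by
    rw [Submodule.eq_bot_iff]
    intro f hf
    rw [Submodule.mem_orthogonal] at hf
    have h0 : fourierBasis.repr (toAddCircle f) = 0 := by
      ext n
      rw [HilbertBasis.repr_apply_apply, coe_fourierBasis, ← toAddCircle_mono,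
        LinearIsometry.inner_map_map, hf _ (Submodule.subset_span (mem_range_self n))]
      rfl
    have h1 : toAddCircle f = 0 := by simpa using h0
    exact toAddCircle.injective (by rw [h1, map_zero])

@[simp] lemma coe_monoBasis : ⇑monoBasis = mono := HilbertBasis.coe_mkOfOrthogonalEqBot _ _

lemma inner_mono (n : ℤ) (f : Lp ℂ 2 mCirc) :
    inner ℂ (mono n) f = ∫ ω, f ω * ω ^ (-n) ∂mCirc := by
  rw [L2.inner_def]
  refine integral_congr_ae ?_
  filter_upwards [coeFn_mono n, ae_norm_eq_one] with ω h1 h2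
  rw [h1, RCLike.inner_apply, map_zpow₀, zpow_neg, ← inv_zpow]
  congr 2
  rw [Complex.inv_def, normSq_eq_norm_sq, h2]
  simp

/-- The Hardy space as a submodule. -/
noncomputable def hardy : Submodule ℂ (Lp ℂ 2 mCirc) :=
  (Submodule.span ℂ (mono '' {n : ℤ | n < 0}))ᗮ

lemma mem_hardy_iff {f : Lp ℂ 2 mCirc} : f ∈ hardy ↔ ∀ n : ℤ, n < 0 → inner ℂ (mono n) f = 0 := by
  rw [hardy, Submodule.mem_orthogonal]
  constructor
  · intro h n hn
    exact h _ (Submodule.subset_span (mem_image_of_mem _ hn))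
  · intro h u hu
    induction hu using Submodule.span_induction with
    | mem x hx => obtain ⟨n, hn, rfl⟩ := hx; exact h n hn
    | zero => simp
    | add x y _ _ hx hy => rw [inner_add_left, hx, hy, add_zero]
    | smul a x _ hx => rw [inner_smul_left, hx, mul_zero]

lemma coe_hardy : (hardy : Set (Lp ℂ 2 mCirc)) = H2 := by
  ext f
  simp only [SetLike.mem_coe, mem_hardy_iff, H2, mem_ofPred_eq, inner_mono]

lemma integral_zpow (n : ℤ) : ∫ ω : ℂ, ω ^ n ∂mCirc = if n = 0 then 1 else 0 := by
  have h := (orthonormal_iff_ite.1 orthonormal_mono) 0 n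
  rw [inner_mono] at h
  simp only [neg_zero, zpow_zero, mul_one] at h
  rw [integral_congr_ae (coeFn_mono n)] at h
  rw [h]
  simp [eq_comm]

lemma integrable_zpow (n : ℤ) : Integrable (fun ω : ℂ => ω ^ n) mCirc :=
  (memLp_zpow n).integrable one_le_two

lemma integral_log_one_sub_mul {k : ℕ} (hk : 1 ≤ k) (n : ℕ) {r : ℝ} (hr0 : 0 ≤ r) (hr1 : r < 1) :
    ∫ ω : ℂ, Complex.log (1 - r * ω ^ k) * ω ^ (-(n:ℤ)) ∂mCirc =
      -(if k ∣ n then (r:ℂ) ^ (n / k) / ((n / k : ℕ) : ℂ) else 0) := by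
  set F : ℕ → ℂ → ℂ := fun j ω => ((r:ℂ) ^ j / (j:ℂ)) * ω ^ ((k:ℤ) * j - n) with hF
  have hFi : ∀ j, Integrable (F j) mCirc := fun j => (integrable_zpow _).const_mul _
  have hFn : ∀ j, ∫ ω, ‖F j ω‖ ∂mCirc = r ^ j / j := by
    intro j
    have : (fun ω => ‖F j ω‖) =ᵐ[mCirc] fun _ => r ^ j / j := by
      filter_upwards [ae_norm_eq_one] with ω hω
      simp [hF, norm_zpow, hω, abs_of_nonneg hr0]
    rw [integral_congr_ae this]
    simp
  have hFs : Summable fun j => ∫ ω, ‖F j ω‖ ∂mCirc := by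
    simp_rw [hFn]
    refine Summable.of_nonneg_of_le (fun j => by positivity) (fun j => ?_)
      (summable_geometric_of_lt_one hr0 hr1)
    rcases Nat.eq_zero_or_pos j with rfl | hj
    · simp
    · exact div_le_self (by positivity) (by exact_mod_cast hj)
  have h1 := hasSum_integral_of_summable_integral_norm hFi hFs
  have h2 : (fun ω => ∑' j, F j ω) =ᵐ[mCirc]
      fun ω => -(Complex.log (1 - r * ω ^ k) * ω ^ (-(n:ℤ))) := by
    filter_upwards [ae_norm_eq_one] with ω hω
    have hω0 : ω ≠ 0 := by rintro rfl; simp at hω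
    have hz : ‖(r:ℂ) * ω ^ k‖ < 1 := by simpa [hω, abs_of_nonneg hr0] using hr1
    have := ((hasSum_taylorSeries_neg_log hz).mul_right (ω ^ (-(n:ℤ)))).tsum_eq
    rw [← neg_mul, ← this]
    refine tsum_congr fun j => ?_
    simp only [hF]
    rw [sub_eq_add_neg, zpow_add₀ hω0, zpow_mul, zpow_natCast, zpow_natCast, mul_pow]
    ring
  rw [integral_congr_ae h2, integral_neg] at h1
  have h3 : HasSum (fun j => ∫ ω, F j ω ∂mCirc)
      (if k ∣ n then (r:ℂ) ^ (n / k) / ((n / k : ℕ) : ℂ) else 0) := by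
    have h4 : ∀ j, ∫ ω, F j ω ∂mCirc = if (k:ℤ) * j - n = 0 then (r:ℂ) ^ j / (j:ℂ) else 0 := by
      intro j
      simp only [hF]
      rw [integral_const_mul, integral_zpow]
      simp
    simp_rw [h4]
    split_ifs with hd
    · obtain ⟨q, rfl⟩ := hd
      rw [Nat.mul_div_cancel_left _ (by omega)]
      convert hasSum_ite_eq q ((r:ℂ) ^ q / (q:ℂ)) using 2 with j
      have : (k:ℤ) * j - (k * q : ℕ) = 0 ↔ j = q := by
        push_cast
        rw [← mul_sub, mul_eq_zero, sub_eq_zero]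
        constructor
        · rintro (h | h) <;> omega
        · rintro rfl; exact Or.inr rfl
      by_cases h : j = q
      · subst h; simp
      · rw [if_neg (this.not.2 h), if_neg h]
    · convert hasSum_zero using 2 with j
      rw [if_neg]
      intro h
      exact hd ⟨j, by zify; omega⟩
  rw [← h1.unique h3, neg_neg]

lemma norm_log_le_abs_log_norm_add_pi (z : ℂ) : ‖Complex.log z‖ ≤ |Real.log ‖z‖| + Real.pi := by
  refine (norm_le_abs_re_add_abs_im _).trans ?_
  rw [log_re, log_im]
  exact add_le_add le_rfl (abs_arg_le_pi z)

lemma norm_log_one_sub_mul_le {r : ℝ} (hr0 : 0 ≤ r) (hr1 : r ≤ 1) {w : ℂ} (hw : ‖w‖ = 1)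
    (hw1 : w ≠ 1) :
    ‖Complex.log (1 - r * w)‖ ≤ |Real.log ‖1 - w‖| + (Real.log 2 + Real.pi) := by
  refine (norm_log_le_abs_log_norm_add_pi _).trans ?_
  have hp : 0 < ‖1 - w‖ := norm_pos_iff.2 (sub_ne_zero.2 hw1.symm)
  have hrw : ‖(r:ℂ) * w‖ = r := by simp [hw, abs_of_nonneg hr0]
  have h1 : ‖1 - (r:ℂ) * w‖ ≤ 2 := by
    refine (norm_sub_le _ _).trans ?_
    rw [hrw, norm_one]; linarith
  have h2 : 1 - r ≤ ‖1 - (r:ℂ) * w‖ := by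
    have := norm_sub_norm_le (1:ℂ) (r * w)
    rwa [hrw, norm_one] at this
  have h3 : ‖1 - w‖ ≤ 2 * ‖1 - (r:ℂ) * w‖ := by
    have h4 : 1 - w = (1 - (r:ℂ) * w) - ((1 - r : ℝ) : ℂ) * w := by push_cast; ring
    have h5 : ‖((1 - r : ℝ) : ℂ) * w‖ = 1 - r := by
      rw [norm_mul, hw, mul_one, norm_real, Real.norm_of_nonneg (by linarith)]
    calc ‖1 - w‖ ≤ ‖1 - (r:ℂ) * w‖ + ‖((1 - r : ℝ) : ℂ) * w‖ := by rw [h4]; exact norm_sub_le _ _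
      _ ≤ _ := by rw [h5]; linarith
  have h6 : 0 < ‖1 - (r:ℂ) * w‖ := by linarith
  have h7 : Real.log ‖1 - (r:ℂ) * w‖ ≤ Real.log 2 := Real.log_le_log h6 h1
  have h8 : Real.log ‖1 - w‖ ≤ Real.log 2 + Real.log ‖1 - (r:ℂ) * w‖ := by
    rw [← Real.log_mul (by norm_num) h6.ne']
    exact Real.log_le_log hp h3
  have h9 : |Real.log ‖1 - (r:ℂ) * w‖| ≤ |Real.log ‖1 - w‖| + Real.log 2 := by
    rw [abs_le]
    constructor
    · linarith [neg_abs_le (Real.log ‖1 - w‖)]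
    · linarith [abs_nonneg (Real.log ‖1 - w‖)]
  linarith

lemma integrable_logBound (k : ℕ) :
    Integrable (fun ω : ℂ => |Real.log ‖1 - ω ^ k‖| + (Real.log 2 + Real.pi)) mCirc := by
  refine Integrable.add ?_ (integrable_const _)
  refine Integrable.abs (integrable_mCirc_of_circleIntegrable (by fun_prop) ?_)
  refine MeromorphicOn.circleIntegrable_log_norm (f := fun ω : ℂ => 1 - ω ^ k) ?_
  intro z _
  fun_prop

lemma one_sub_mem_slitPlane {w : ℂ} (hw : ‖w‖ = 1) (hw1 : w ≠ 1) : 1 - w ∈ slitPlane := by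
  refine Or.inl ?_
  have h1 : w.re ≤ 1 := hw ▸ re_le_norm w
  have h2 : w.re ≠ 1 := by
    intro h
    apply hw1
    have h3 := sq_norm_sub_sq_re w
    rw [hw, h] at h3
    have h4 : w.im = 0 := by nlinarith
    exact Complex.ext h h4
  rw [sub_re, one_re]
  linarith [lt_of_le_of_ne h1 h2]

lemma integrable_log_one_sub_pow {k : ℕ} (hk : 1 ≤ k) (n : ℤ) :
    Integrable (fun ω : ℂ => Complex.log (1 - ω ^ k) * ω ^ n) mCirc := by
  refine (integrable_logBound k).mono' (by fun_prop) ?_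
  filter_upwards [ae_norm_eq_one, ae_pow_ne_one hk] with ω h1 h2
  rw [norm_mul, norm_zpow, h1, one_zpow, mul_one]
  simpa using norm_log_one_sub_mul_le zero_le_one le_rfl (by simp [h1]) h2

lemma integral_log_one_sub_pow {k : ℕ} (hk : 1 ≤ k) (n : ℕ) :
    ∫ ω : ℂ, Complex.log (1 - ω ^ k) * ω ^ (-(n:ℤ)) ∂mCirc =
      -(if k ∣ n then 1 / ((n / k : ℕ) : ℂ) else 0) := by
  have hev : ∀ᶠ r : ℝ in 𝓝[<] 1, 0 ≤ r ∧ r < 1 := by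
    filter_upwards [self_mem_nhdsWithin,
      mem_nhdsWithin_of_mem_nhds (Ioi_mem_nhds (zero_lt_one' ℝ))] with r h1 h2
    exact ⟨le_of_lt h2, h1⟩
  have h1 : Tendsto (fun r : ℝ => ∫ ω : ℂ, Complex.log (1 - r * ω ^ k) * ω ^ (-(n:ℤ)) ∂mCirc)
      (𝓝[<] 1) (𝓝 (∫ ω : ℂ, Complex.log (1 - ω ^ k) * ω ^ (-(n:ℤ)) ∂mCirc)) := by
    refine tendsto_integral_filter_of_dominated_convergence _
      (Eventually.of_forall fun r => by fun_prop) ?_ (integrable_logBound k) ?_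
    · filter_upwards [hev] with r hr
      filter_upwards [ae_norm_eq_one, ae_pow_ne_one hk] with ω h1 h2
      rw [norm_mul, norm_zpow, h1, one_zpow, mul_one]
      exact norm_log_one_sub_mul_le hr.1 hr.2.le (by simp [h1]) h2
    · filter_upwards [ae_norm_eq_one, ae_pow_ne_one hk] with ω h1 h2
      refine Tendsto.mul_const _ ?_
      refine Tendsto.clog ?_ (one_sub_mem_slitPlane (by simp [h1]) h2)
      have : Continuous fun r : ℝ => 1 - (r:ℂ) * ω ^ k := by fun_prop
      simpa using (this.tendsto 1).mono_left nhdsWithin_le_nhds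
  have h2 : Tendsto (fun r : ℝ => -(if k ∣ n then (r:ℂ) ^ (n / k) / ((n / k : ℕ) : ℂ) else 0))
      (𝓝[<] 1) (𝓝 (-(if k ∣ n then 1 / ((n / k : ℕ) : ℂ) else 0))) := by
    refine Tendsto.neg ?_
    split_ifs
    · have : Continuous fun r : ℝ => (r:ℂ) ^ (n / k) / ((n / k : ℕ) : ℂ) := by fun_prop
      simpa using (this.tendsto 1).mono_left nhdsWithin_le_nhds
    · exact tendsto_const_nhds
  refine tendsto_nhds_unique_of_eventuallyEq h1 h2 ?_
  filter_upwards [hev] with r hr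
  exact integral_log_one_sub_mul hk n hr.1 hr.2

lemma integral_gFun {k : ℕ} (hk : 1 ≤ k) (n : ℕ) :
    ∫ ω : ℂ, gFun k ω * ω ^ (-(n:ℤ)) ∂mCirc =
      1 / (n:ℂ) - (if k ∣ n then 1 / ((n / k : ℕ) : ℂ) else 0)
        - (if n = 0 then (Real.log k : ℂ) else 0) := by
  have h1 := integrable_log_one_sub_pow hk (-(n:ℤ))
  have h2 := integrable_log_one_sub_pow le_rfl (-(n:ℤ))
  have h3 := (integrable_zpow (-(n:ℤ))).const_mul (Real.log k : ℂ)
  have e1 := integral_log_one_sub_pow hk n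
  have e2 := integral_log_one_sub_pow le_rfl n
  simp only [pow_one, one_dvd, if_true, Nat.div_one] at h2 e2
  simp only [gFun, sub_mul]
  have e3 := integral_sub (h1.sub h2) h3
  simp only [Pi.sub_apply] at e3
  rw [e3, integral_sub h1 h2, e1, e2, integral_const_mul, integral_zpow]
  simp only [neg_eq_zero, Nat.cast_eq_zero, mul_ite, mul_one, mul_zero]
  ring

lemma integrable_mul_zpow (f : Lp ℂ 2 mCirc) (n : ℤ) :
    Integrable (fun ω => f ω * ω ^ n) mCirc := by
  have := (Lp.memLp f).integrable_mul (memLp_zpow n)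
  exact this

lemma inner_mono_sub_inner_mono {k : ℕ} {f : Lp ℂ 2 mCirc}
    (hf : (f : ℂ → ℂ) =ᵐ[mCirc] hFun k) (n : ℤ) :
    inner ℂ (mono n) f - inner ℂ (mono (n - 1)) f = ∫ ω : ℂ, gFun k ω * ω ^ (-n) ∂mCirc := by
  rw [inner_mono, inner_mono, ← integral_sub (integrable_mul_zpow _ _) (integrable_mul_zpow _ _)]
  refine integral_congr_ae ?_
  filter_upwards [hf, ae_norm_eq_one, ae_ne_one] with ω h1 h2 h3
  have hω0 : ω ≠ 0 := by rintro rfl; simp at h2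
  have : (1 - ω) ≠ 0 := sub_ne_zero.2 h3.symm
  rw [h1, hFun, show -(n - 1) = -n + 1 by ring, zpow_add₀ hω0, zpow_one]
  field_simp

lemma hCoef_succ (k n : ℕ) :
    (hCoef k (n + 1) : ℂ) = hCoef k n + (1 / ((n + 1 : ℕ) : ℂ)
      - if k ∣ n + 1 then 1 / (((n + 1) / k : ℕ) : ℂ) else 0) := by
  rw [hCoef, hCoef, Nat.succ_div]
  split_ifs with h
  · push_cast [harmonic_succ]
    ring
  · push_cast [harmonic_succ]
    simp only [add_zero, sub_zero]
    ring

lemma inner_mono_natCast {k : ℕ} (hk : 2 ≤ k) {f : Lp ℂ 2 mCirc}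
    (hf : (f : ℂ → ℂ) =ᵐ[mCirc] hFun k) (hf2 : f ∈ H2) (n : ℕ) :
    inner ℂ (mono n) f = (hCoef k n : ℂ) := by
  induction n with
  | zero =>
    have h := inner_mono_sub_inner_mono hf ((0:ℕ):ℤ)
    rw [integral_gFun (by omega) 0] at h
    rw [← coe_hardy] at hf2
    rw [mem_hardy_iff.1 hf2 (((0:ℕ):ℤ) - 1) (by norm_num), sub_zero] at h
    rw [h, hCoef_zero]
    simp
  | succ n ih =>
    have h := inner_mono_sub_inner_mono hf ((n + 1 : ℕ):ℤ)
    rw [integral_gFun (by omega) (n + 1), show ((n + 1 : ℕ):ℤ) - 1 = n by push_cast; ring, ih] at h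
    rw [hCoef_succ, ← sub_eq_iff_eq_add', h]
    simp

lemma hasSum_inner_of_mem_hardy {k : ℕ} (hk : 2 ≤ k) {f g : Lp ℂ 2 mCirc}
    (hf : (f : ℂ → ℂ) =ᵐ[mCirc] hFun k) (hf2 : f ∈ H2) (hg : g ∈ hardy) :
    HasSum (fun n : ℕ => inner ℂ (mono n) g * (hCoef k n : ℂ)) (inner ℂ f g) := by
  have h := monoBasis.hasSum_inner_mul_inner f g
  rw [coe_monoBasis, ← (Nat.cast_injective (R := ℤ)).hasSum_iff] at h
  · refine h.congr_fun fun n => ?_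
    rw [Function.comp_apply, ← inner_conj_symm f, inner_mono_natCast hk hf hf2, conj_ofReal,
      mul_comm]
  · intro n hn
    have hn0 : n < 0 := by
      by_contra! hn0
      exact hn ⟨n.toNat, Int.toNat_of_nonneg hn0⟩
    rw [mem_hardy_iff.1 hg n hn0, mul_zero]

lemma eq_zero_of_inner_mono_natCast_eq_zero {g : Lp ℂ 2 mCirc} (hg : g ∈ hardy)
    (h : ∀ n : ℕ, inner ℂ (mono n) g = 0) : g = 0 := by
  refine monoBasis.repr.injective ?_
  rw [map_zero]
  ext n
  rw [HilbertBasis.repr_apply_apply, coe_monoBasis]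
  rcases lt_or_ge n 0 with hn | hn
  · exact mem_hardy_iff.1 hg n hn
  · lift n to ℕ using hn
    exact h n

lemma summable_norm_inner_mono_sq (g : Lp ℂ 2 mCirc) :
    Summable fun n : ℕ => ‖inner ℂ (mono n) g‖ ^ 2 := by
  have h := orthonormal_mono.inner_products_summable (x := g)
  exact h.comp_injective Nat.cast_injective

/-- The element of the Hardy space with prescribed square-summable coefficients. -/
lemma exists_mem_hardy_inner_mono {v : ℕ → ℂ} (hv : Summable fun n => ‖v n‖ ^ 2) :
    ∃ g ∈ hardy, ∀ n : ℕ, inner ℂ (mono n) g = v n := by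
  set w : ℤ → ℂ := fun n => if 0 ≤ n then v n.toNat else 0 with hw
  have hs : Summable fun n : ℤ => ‖w n‖ ^ 2 := by
    rw [← (Nat.cast_injective (R := ℤ)).summable_iff]
    · simpa [hw, Function.comp_def] using hv
    · intro n hn
      have hn0 : ¬ 0 ≤ n := fun hn0 => hn ⟨n.toNat, Int.toNat_of_nonneg hn0⟩
      simp [hw, hn0]
  have hm : Memℓp w 2 := by
    refine memℓp_gen ?_
    simpa using hs
  have hc : ∀ n, inner ℂ (mono n) (monoBasis.repr.symm ⟨w, hm⟩) = w n := by
    intro n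
    rw [← coe_monoBasis, ← HilbertBasis.repr_apply_apply, LinearIsometryEquiv.apply_symm_apply]
  refine ⟨monoBasis.repr.symm ⟨w, hm⟩, mem_hardy_iff.2 fun n hn => ?_, fun n => ?_⟩
  · rw [hc]; simp [hw, hn]
  · rw [hc]; simp [hw]

lemma mono_natCast_mem_hardy (n : ℕ) : mono n ∈ hardy := by
  rw [mem_hardy_iff]
  intro m hm
  rw [orthonormal_iff_ite.1 orthonormal_mono, if_neg (by omega)]

end HardyRH

open HardyRH

/-- The Riemann Hypothesis holds if and only if the linear span `𝒩` of the
functions `h_k`, `k ≥ 2`, is dense in the Hardy space `H²`. -/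
theorem rh_iff_span_hk_dense
    (hk : ℕ → Lp ℂ 2 mCirc)
    (hk_ae : ∀ k, 2 ≤ k → (hk k : ℂ → ℂ) =ᵐ[mCirc] hFun k)
    (hk_mem : ∀ k, 2 ≤ k → hk k ∈ H2) :
    RiemannHypothesis ↔
      closure ((Submodule.span ℂ (hk '' {k : ℕ | 2 ≤ k}) : Submodule ℂ (Lp ℂ 2 mCirc)) :
        Set (Lp ℂ 2 mCirc)) = H2 := by
  set K : Submodule ℂ (Lp ℂ 2 mCirc) := Submodule.span ℂ (hk '' {k : ℕ | 2 ≤ k}) with hK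
  have hclosed : IsClosed (hardy : Set (Lp ℂ 2 mCirc)) := Submodule.isClosed_orthogonal _
  have hsub : K.topologicalClosure ≤ hardy := by
    refine K.topologicalClosure_minimal (Submodule.span_le.2 ?_) hclosed
    rintro _ ⟨k, hk2, rfl⟩
    rw [coe_hardy]
    exact hk_mem k hk2
  rw [← coe_hardy, ← Submodule.topologicalClosure_coe, SetLike.coe_set_eq]
  constructor
  · intro hRH
    refine le_antisymm hsub fun f hf => ?_
    have : CompleteSpace K.topologicalClosure :=
      K.isClosed_topologicalClosure.completeSpace_coe
    set p := K.topologicalClosure.starProjection f with hp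
    have hpm : p ∈ K.topologicalClosure := Submodule.starProjection_apply_mem _ _
    have hg : f - p ∈ hardy := hardy.sub_mem hf (hsub hpm)
    have hort : f - p ∈ K.topologicalClosureᗮ := Submodule.sub_starProjection_mem_orthogonal _
    have hzero : f - p = 0 := by
      refine eq_zero_of_inner_mono_natCast_eq_zero hg
        (eq_zero_of_tsum_mul_hCoef_eq_zero hRH (summable_norm_inner_mono_sq _) fun k hk2 => ?_)
      rw [(hasSum_inner_of_mem_hardy hk2 (hk_ae k hk2) (hk_mem k hk2) hg).tsum_eq]
      exact hort _ (K.le_topologicalClosure (Submodule.subset_span ⟨k, hk2, rfl⟩))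
    rw [sub_eq_zero.1 hzero]
    exact hpm
  · intro h
    by_contra hRH
    obtain ⟨s, hs, hs2⟩ := exists_zero_of_not_riemannHypothesis hRH
    obtain ⟨v, hv, hv0, hvk⟩ := exists_annihilator hs hs2
    obtain ⟨g, hg, hgv⟩ := exists_mem_hardy_inner_mono hv
    have hKg : K ≤ (Submodule.span ℂ {g})ᗮ := by
      refine Submodule.span_le.2 ?_
      rintro _ ⟨k, hk2, rfl⟩
      rw [SetLike.mem_coe, Submodule.mem_orthogonal_singleton_iff_inner_left,
        ← (hasSum_inner_of_mem_hardy hk2 (hk_ae k hk2) (hk_mem k hk2) hg).tsum_eq]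
      simpa only [hgv] using hvk k hk2
    have hle := K.topologicalClosure_minimal hKg (Submodule.isClosed_orthogonal _)
    have h0 : mono ((0:ℕ):ℤ) ∈ (Submodule.span ℂ {g})ᗮ :=
      hle (h ▸ mono_natCast_mem_hardy 0)
    rw [Submodule.mem_orthogonal_singleton_iff_inner_left, hgv] at h0
    exact hv0 h0
end

section
/- The linear span of the boundary functions {g_k : k ≥ 2} is dense in the Hardy space H², i.e., its closure in L²(𝕋, m) equals the whole subspace of functions with vanishing negative Fourier coefficients. -/
open MeasureTheory Complex

open Filter Topology ArithmeticFunction AddCircle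

lemma norm_div_natCast_le (z : ℂ) (n : ℕ) : ‖z / n‖ ≤ ‖z‖ ^ 2 + 1 / (n : ℝ) ^ 2 := by
  rw [norm_div, Complex.norm_natCast, div_eq_mul_inv, one_div, ← inv_pow]
  nlinarith [sq_nonneg (‖z‖ - (n : ℝ)⁻¹), sq_nonneg ‖z‖, sq_nonneg ((n : ℝ)⁻¹)]

section DilatedSums

variable {a : ℕ → ℂ}

lemma summable_norm_sq_dilate (ha : Summable fun n => ‖a n‖ ^ 2) {k : ℕ} (hk : k ≠ 0) :
    Summable fun n => ‖a (k * n)‖ ^ 2 :=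
  ha.comp_injective (mul_right_injective₀ hk)

lemma summable_norm_dilate_div (ha : Summable fun n => ‖a n‖ ^ 2) {k : ℕ} (hk : k ≠ 0) :
    Summable fun n : ℕ => ‖a (k * n) / n‖ :=
  .of_nonneg_of_le (fun _ => norm_nonneg _) (fun _ => norm_div_natCast_le _ _)
    ((summable_norm_sq_dilate ha hk).add (Real.summable_one_div_nat_pow.2 one_lt_two))

lemma norm_tsum_dilate_div_le (ha : Summable fun n => ‖a n‖ ^ 2) {k : ℕ} (hk : k ≠ 0) :
    ‖∑' n : ℕ, a (k * n) / n‖ ≤ ∑' n, ‖a n‖ ^ 2 + ∑' n : ℕ, 1 / (n : ℝ) ^ 2 := by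
  have h2 : Summable fun n : ℕ => 1 / (n : ℝ) ^ 2 := Real.summable_one_div_nat_pow.2 one_lt_two
  have hk2 := summable_norm_sq_dilate ha hk
  calc ‖∑' n : ℕ, a (k * n) / n‖ ≤ ∑' n : ℕ, ‖a (k * n) / n‖ :=
        norm_tsum_le_tsum_norm (summable_norm_dilate_div ha hk)
    _ ≤ ∑' n : ℕ, (‖a (k * n)‖ ^ 2 + 1 / (n : ℝ) ^ 2) :=
        (summable_norm_dilate_div ha hk).tsum_le_tsum (fun _ => norm_div_natCast_le _ _)
          (hk2.add h2)
    _ = ∑' n, ‖a (k * n)‖ ^ 2 + ∑' n : ℕ, 1 / (n : ℝ) ^ 2 := hk2.tsum_add h2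
    _ ≤ _ := add_le_add
        (tsum_comp_le_tsum_of_inj ha (fun _ => sq_nonneg _) (mul_right_injective₀ hk)) le_rfl

lemma sum_divisors_moebius_ite_dvd {P m : ℕ} (hP : P ≠ 0) :
    ∑ d ∈ P.divisors, (if d ∣ m then (moebius d : ℂ) else 0) =
      if Nat.Coprime P m then 1 else 0 := by
  have hg : P.gcd m ≠ 0 := Nat.gcd_ne_zero_left hP
  have hfilter : P.divisors.filter (· ∣ m) = (P.gcd m).divisors := by
    ext d
    simp [Nat.dvd_gcd_iff, hP]
  rw [← Finset.sum_filter, hfilter]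
  have h := coe_mul_zeta_apply (R := ℂ) (f := ↑moebius) (x := P.gcd m)
  rw [coe_moebius_mul_coe_zeta, one_apply] at h
  exact h.symm

lemma tsum_dilate_mul_div (a : ℕ → ℂ) (k : ℕ) {d : ℕ} (hd : d ≠ 0) :
    (∑' n : ℕ, a (k * d * n) / n) / d = ∑' m : ℕ, if d ∣ m then a (k * m) / m else 0 := by
  rw [← (mul_right_injective₀ hd).tsum_eq (f := fun m : ℕ => if d ∣ m then a (k * m) / m else 0),
    ← tsum_div_const]
  · refine tsum_congr fun n => ?_
    simp only [dvd_mul_right, if_true, Nat.cast_mul, div_div, mul_assoc, mul_comm (n : ℂ)]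
  · intro m hm
    by_contra hne
    refine hm (if_neg fun ⟨n, hn⟩ => hne ⟨n, hn.symm⟩)

lemma sum_divisors_moebius_mul_tsum_dilate (ha : Summable fun n => ‖a n‖ ^ 2) {k P : ℕ}
    (hk : k ≠ 0) (hP : P ≠ 0) :
    ∑ d ∈ P.divisors, (moebius d : ℂ) / d * ∑' n : ℕ, a (k * d * n) / n =
      ∑' m : ℕ, if Nat.Coprime P m then a (k * m) / m else 0 := by
  have hs := (summable_norm_dilate_div ha hk).of_norm
  have hterm : ∀ d ∈ P.divisors, (moebius d : ℂ) / d * ∑' n : ℕ, a (k * d * n) / n =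
      ∑' m : ℕ, (if d ∣ m then (moebius d : ℂ) else 0) * (a (k * m) / m) := by
    intro d hd
    rw [div_mul_eq_mul_div, mul_div_assoc,
      tsum_dilate_mul_div a k (Nat.pos_of_mem_divisors hd).ne', ← tsum_mul_left]
    refine tsum_congr fun m => ?_
    split_ifs <;> simp
  have hsum : ∀ d ∈ P.divisors,
      Summable fun m : ℕ => (if d ∣ m then (moebius d : ℂ) else 0) * (a (k * m) / m) := by
    intro d _
    refine ((hs.indicator {m | d ∣ m}).mul_left (moebius d : ℂ)).congr fun m => ?_
    by_cases h : d ∣ m <;> simp [h]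
  rw [Finset.sum_congr rfl hterm, ← Summable.tsum_finsetSum hsum]
  refine tsum_congr fun m => ?_
  rw [← Finset.sum_mul, sum_divisors_moebius_ite_dvd hP]
  split_ifs <;> simp

lemma tendsto_tsum_coprime_factorial (ha : Summable fun n => ‖a n‖ ^ 2) {k : ℕ} (hk : k ≠ 0) :
    Tendsto (fun N : ℕ => ∑' m : ℕ, if Nat.Coprime N.factorial m then a (k * m) / m else 0)
      atTop (𝓝 (a k)) := by
  have hone : ∑' m : ℕ, (if m = 1 then a (k * m) / m else 0) = a k := by
    rw [tsum_ite_eq]; simp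
  rw [← hone]
  refine tendsto_tsum_of_dominated_convergence (summable_norm_dilate_div ha hk) (fun m => ?_)
    (.of_forall fun N m => ?_)
  · refine tendsto_const_nhds.congr' ?_
    filter_upwards [eventually_ge_atTop m] with N hN
    rcases eq_or_ne m 0 with rfl | hm0
    · simp
    have : Nat.Coprime N.factorial m ↔ m = 1 :=
      ⟨fun h => Nat.Coprime.eq_one_of_dvd h.symm (Nat.dvd_factorial (Nat.pos_of_ne_zero hm0) hN),
        fun h => h ▸ Nat.coprime_one_right _⟩
    simp only [this]
  · split_ifs
    · exact le_rfl
    · rw [norm_zero]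
      exact norm_nonneg _

/-- A square-summable sequence whose dilated sums `∑ a (k n) / n` depend on `k` only through
`log k`, with slope `-a 0`, vanishes. -/
lemma eq_zero_of_tsum_dilate_div (ha : Summable fun n => ‖a n‖ ^ 2)
    (h : ∀ k : ℕ, k ≠ 0 →
      ∑' n : ℕ, a (k * n) / n = ∑' n : ℕ, a n / n - (Real.log k : ℂ) * a 0) (n : ℕ) :
    a n = 0 := by
  have hzero : a 0 = 0 := by
    by_contra h0
    set C := ∑' n, ‖a n‖ ^ 2 + ∑' n : ℕ, 1 / (n : ℝ) ^ 2
    have hlog : Tendsto (fun k : ℕ => Real.log k * ‖a 0‖) atTop atTop :=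
      (Real.tendsto_log_atTop.comp tendsto_natCast_atTop_atTop).atTop_mul_const
        (norm_pos_iff.2 h0)
    obtain ⟨k, hk, hk1⟩ := ((hlog.eventually_gt_atTop (C + C)).and (eventually_ge_atTop 1)).exists
    have h1 := norm_tsum_dilate_div_le ha one_ne_zero
    have h2 := norm_tsum_dilate_div_le ha (Nat.one_le_iff_ne_zero.1 hk1)
    simp only [one_mul] at h1
    have h3 : (Real.log k : ℂ) * a 0 = ∑' n : ℕ, a n / n - ∑' n : ℕ, a (k * n) / n := by
      rw [h k (Nat.one_le_iff_ne_zero.1 hk1)]; ring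
    have h4 := (congrArg norm h3).trans_le ((norm_sub_le _ _).trans (add_le_add h1 h2))
    rw [norm_mul, Complex.norm_real, Real.norm_of_nonneg (Real.log_natCast_nonneg k)] at h4
    exact absurd hk (not_lt.2 h4)
  have hlim : ∀ k : ℕ, k ≠ 0 → Tendsto (fun N : ℕ =>
      ∑ d ∈ N.factorial.divisors, (moebius d : ℂ) / d * ∑' n : ℕ, a n / n) atTop (𝓝 (a k)) := by
    intro k hk
    refine (tendsto_tsum_coprime_factorial ha hk).congr fun N => ?_
    rw [← sum_divisors_moebius_mul_tsum_dilate ha hk N.factorial_ne_zero]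
    refine Finset.sum_congr rfl fun d hd => ?_
    rw [h (k * d) (mul_ne_zero hk (Nat.pos_of_mem_divisors hd).ne'), hzero, mul_zero, sub_zero]
  rcases eq_or_ne n 0 with rfl | hn
  · exact hzero
  have hconst : Tendsto (fun k => ‖a k‖ ^ 2) atTop (𝓝 (‖a n‖ ^ 2)) := by
    refine tendsto_const_nhds.congr' ?_
    filter_upwards [eventually_ge_atTop 1] with k hk
    rw [tendsto_nhds_unique (hlim n hn) (hlim k (Nat.one_le_iff_ne_zero.1 hk))]
  simpa using tendsto_nhds_unique hconst ha.tendsto_atTop_zero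

end DilatedSums

section HilbertSpace

variable {E : Type*} [NormedAddCommGroup E] [InnerProductSpace ℂ E] {v : ℕ → E} {c : ℕ → ℂ}

lemma Orthonormal.hasSum_norm_sq {ι : Type*} {v : ι → E} (hv : Orthonormal ℂ v) {c : ι → ℂ} {F : E}
    (hF : HasSum (fun n => c n • v n) F) : HasSum (fun n => ‖c n‖ ^ 2) (‖F‖ ^ 2) := by
  refine (hF.norm.pow 2).congr fun s => ?_
  rw [@norm_sq_eq_re_inner ℂ, hv.inner_sum]
  simp [Complex.conj_mul', ← Complex.ofReal_pow]

lemma Orthonormal.tendsto_abel (hv : Orthonormal ℂ v) (hc : Summable fun n => ‖c n‖ ^ 2) {F : E}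
    (hF : HasSum (fun n => c n • v n) F) {r : ℕ → ℝ} (hr : ∀ j, r j ∈ Set.Icc (0 : ℝ) 1)
    (hr1 : Tendsto r atTop (𝓝 1)) {G : ℕ → E}
    (hG : ∀ j, HasSum (fun n => ((r j : ℂ) ^ n * c n) • v n) (G j)) :
    Tendsto G atTop (𝓝 F) := by
  have hdiff : ∀ j, HasSum (fun n => ‖((r j : ℂ) ^ n - 1) * c n‖ ^ 2) (‖G j - F‖ ^ 2) := by
    intro j
    refine hv.hasSum_norm_sq (((hG j).sub hF).congr_fun ?_)
    intro n
    rw [← sub_smul, sub_mul, one_mul]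
  have hlim : Tendsto (fun j => ∑' n, ‖((r j : ℂ) ^ n - 1) * c n‖ ^ 2) atTop
      (𝓝 (∑' _ : ℕ, (0 : ℝ))) := by
    refine tendsto_tsum_of_dominated_convergence hc (fun n => ?_) (.of_forall fun j n => ?_)
    · have h1 : Tendsto (fun j => (r j : ℂ)) atTop (𝓝 1) :=
        (Complex.continuous_ofReal.tendsto' 1 1 Complex.ofReal_one).comp hr1
      simpa using ((((h1.pow n).sub_const 1).mul_const (c n)).norm.pow 2)
    · have h1 : ‖(r j : ℂ) ^ n - 1‖ ≤ 1 := by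
        rw [← Complex.ofReal_pow, ← Complex.ofReal_one, ← Complex.ofReal_sub, Complex.norm_real,
          Real.norm_eq_abs, abs_le]
        have := pow_nonneg (hr j).1 n
        have := pow_le_one₀ (n := n) (hr j).1 (hr j).2
        constructor <;> linarith
      rw [Real.norm_of_nonneg (sq_nonneg _), norm_mul, mul_pow]
      exact mul_le_of_le_one_left (sq_nonneg _) (pow_le_one₀ (norm_nonneg _) h1)
  rw [tendsto_iff_norm_sub_tendsto_zero]
  simp only [(hdiff _).tsum_eq, tsum_zero] at hlim
  simpa using hlim.sqrt

end HilbertSpace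

section Circle

lemma fourier_eq_toCircle_zpow {T : ℝ} (n : ℤ) (x : AddCircle T) :
    fourier n x = (toCircle x : ℂ) ^ n := by
  rw [fourier_apply, toCircle_zsmul, Circle.coe_zpow]

variable {T : ℝ} [hT : Fact (0 < T)]

instance nullSingletonClass_haarAddCircle :
    NullSingletonClass (haarAddCircle : Measure (AddCircle T)) where
  measure_singleton x := by
    have h : (volume : Measure (AddCircle T)) {x} = 0 := by
      rw [← Metric.closedBall_zero, AddCircle.volume_closedBall]
      simp [hT.out.le]
    rw [volume_eq_smul_haarAddCircle, Measure.smul_apply, smul_eq_mul] at h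
    exact (mul_eq_zero.1 h).resolve_left (by simpa using hT.out)

lemma ae_toCircle_pow_ne_one {k : ℕ} (hk : k ≠ 0) :
    ∀ᵐ x : AddCircle T ∂haarAddCircle, (toCircle x : ℂ) ^ k ≠ 1 := by
  have hinj : Function.Injective fun x : AddCircle T => (toCircle x : ℂ) :=
    Subtype.val_injective.comp (injective_toCircle hT.out.ne')
  have hfin : {x : AddCircle T | (toCircle x : ℂ) ^ k = 1}.Finite := by
    refine Set.Finite.subset ((Polynomial.nthRoots k (1 : ℂ)).toFinset.finite_toSet.preimage
      hinj.injOn) fun x hx => ?_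
    simpa [Polynomial.mem_nthRoots (Nat.pos_of_ne_zero hk)] using hx
  have hnull : (haarAddCircle (T := T)) {x : AddCircle T | (toCircle x : ℂ) ^ k = 1} = 0 :=
    hfin.measure_zero _
  simpa [ae_iff] using hnull

lemma one_sub_mem_slitPlane {w : ℂ} (hw : ‖w‖ ≤ 1) (hw1 : w ≠ 1) : 1 - w ∈ slitPlane := by
  refine Complex.mem_slitPlane_iff.2 ?_
  by_contra! h
  have hre : w.re = 1 := le_antisymm ((Complex.re_le_norm w).trans hw) (by simpa using h.1)
  exact hw1 (Complex.ext hre (by simpa using h.2))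

/-- The `L²` expansion of the boundary function `log (1 - z ^ k)`. -/
lemma exists_hasSum_log_one_sub_pow {k : ℕ} (hk : k ≠ 0) :
    ∃ F : Lp ℂ 2 (haarAddCircle (T := T)),
      HasSum (fun n : ℕ => (-(1 / (n : ℂ))) • fourierLp (T := T) 2 ((k * n : ℕ) : ℤ)) F ∧
      F =ᵐ[haarAddCircle] fun x => log (1 - (toCircle x : ℂ) ^ k) := by
  have hv : Orthonormal ℂ fun n : ℕ => fourierLp (T := T) 2 ((k * n : ℕ) : ℤ) :=
    orthonormal_fourier.comp _ (Nat.cast_injective.comp (mul_right_injective₀ hk))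
  have hc : Summable fun n : ℕ => ‖-(1 / (n : ℂ))‖ ^ 2 := by
    simp
  have hsum : Summable fun n : ℕ => (-(1 / (n : ℂ))) • fourierLp (T := T) 2 ((k * n : ℕ) : ℤ) :=
    (hv.orthogonalFamily.summable_iff_norm_sq_summable _).2 hc
  obtain ⟨F, hF⟩ := hsum
  refine ⟨F, hF, ?_⟩
  set r : ℕ → ℝ := fun j => 1 - 1 / ((j : ℝ) + 1)
  have hr0 : ∀ j, 0 ≤ r j := fun j =>
    sub_nonneg.2 (div_le_one_of_le₀ (by linarith [j.cast_nonneg (α := ℝ)]) (by positivity))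
  have hr1 : ∀ j, r j < 1 := fun j => sub_lt_self _ (by positivity)
  have hlim : Tendsto r atTop (𝓝 1) := by
    simpa [r] using tendsto_one_div_add_atTop_nhds_zero_nat.const_sub (1 : ℝ)
  have hlt : ∀ j (x : AddCircle T), ‖(r j : ℂ) * (toCircle x : ℂ) ^ k‖ < 1 := fun j x => by
    simpa [abs_of_nonneg (hr0 j), Circle.norm_coe] using hr1 j
  let H : ℕ → C(AddCircle T, ℂ) := fun j =>
    ⟨fun x => log (1 - r j * (toCircle x : ℂ) ^ k), by
      refine Continuous.clog (by fun_prop) fun x => ?_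
      exact one_sub_mem_slitPlane (hlt j x).le fun h => (hlt j x).ne (by simp [h])⟩
  have hH : ∀ j, HasSum (fun n : ℕ => ((r j : ℂ) ^ n * -(1 / (n : ℂ))) •
      (fourier ((k * n : ℕ) : ℤ) : C(AddCircle T, ℂ))) (H j) := by
    intro j
    have hs : Summable fun n : ℕ => ((r j : ℂ) ^ n * -(1 / (n : ℂ))) •
        (fourier ((k * n : ℕ) : ℤ) : C(AddCircle T, ℂ)) := by
      refine .of_norm_bounded (summable_geometric_of_lt_one (hr0 j) (hr1 j)) fun n => ?_
      rw [norm_smul, fourier_norm, mul_one, norm_mul, norm_pow, Complex.norm_real,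
        Real.norm_of_nonneg (hr0 j)]
      refine mul_le_of_le_one_right (pow_nonneg (hr0 j) n) ?_
      simpa using Nat.cast_inv_le_one (α := ℝ) n
    convert hs.hasSum
    ext x
    have hlog := (hasSum_taylorSeries_neg_log (hlt j x)).neg
    rw [neg_neg] at hlog
    refine hlog.unique ((ContinuousMap.hasSum_apply hs.hasSum x).congr_fun fun n => ?_)
    simp only [ContinuousMap.smul_apply, fourier_eq_toCircle_zpow, zpow_natCast, smul_eq_mul,
      mul_pow, pow_mul]
    ring
  have hG : ∀ j, HasSum (fun n : ℕ => ((r j : ℂ) ^ n * -(1 / (n : ℂ))) •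
      fourierLp (T := T) 2 ((k * n : ℕ) : ℤ)) (ContinuousMap.toLp 2 haarAddCircle ℂ (H j)) := by
    intro j
    simpa only [map_smul, Function.comp_def] using
      (hH j).mapL (ContinuousMap.toLp (E := ℂ) 2 haarAddCircle ℂ)
  obtain ⟨ns, hns, hae⟩ := (tendstoInMeasure_of_tendsto_Lp
    (hv.tendsto_abel hc hF (fun j => ⟨hr0 j, (hr1 j).le⟩) hlim hG)).exists_seq_tendsto_ae
  have hcoe : ∀ᵐ x : AddCircle T ∂haarAddCircle, ∀ j,
      ContinuousMap.toLp 2 haarAddCircle ℂ (H j) x = H j x :=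
    ae_all_iff.2 fun j => ContinuousMap.coeFn_toLp _ _
  filter_upwards [hae, hcoe, ae_toCircle_pow_ne_one hk] with x hx hxc hne
  refine tendsto_nhds_unique hx ?_
  simp only [hxc]
  have hslit : 1 - (toCircle x : ℂ) ^ k ∈ slitPlane :=
    one_sub_mem_slitPlane (by simp [Circle.norm_coe]) hne
  have h1 : Tendsto (fun i => (1 : ℂ) - r (ns i) * (toCircle x : ℂ) ^ k) atTop
      (𝓝 (1 - (toCircle x : ℂ) ^ k)) := by
    have := ((Complex.continuous_ofReal.tendsto 1).comp (hlim.comp hns.tendsto_atTop))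
    simpa using (this.mul_const ((toCircle x : ℂ) ^ k)).const_sub 1
  exact h1.clog hslit

end Circle

section Transfer

local instance fact_two_pi_pos : Fact (0 < 2 * Real.pi) := ⟨Real.two_pi_pos⟩

lemma mCirc_eq_map_toCircle :
    Measure.map (fun x : AddCircle (2 * Real.pi) => (toCircle x : ℂ)) haarAddCircle = mCirc := by
  have hhaar : (haarAddCircle : Measure (AddCircle (2 * Real.pi))) =
      (ENNReal.ofReal (2 * Real.pi))⁻¹ • volume := by
    rw [volume_eq_smul_haarAddCircle, smul_smul, ENNReal.inv_mul_cancel, one_smul]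
    · simpa using Real.pi_pos
    · exact ENNReal.ofReal_ne_top
  have hcont : Measurable fun x : AddCircle (2 * Real.pi) => (toCircle x : ℂ) :=
    (continuous_subtype_val.comp continuous_toCircle).measurable
  rw [hhaar, Measure.map_smul, ← (AddCircle.measurePreserving_mk (2 * Real.pi) 0).map_eq,
    Measure.map_map hcont (AddCircle.measurePreserving_mk (2 * Real.pi) 0).measurable, zero_add]
  unfold mCirc
  congr 2
  ext θ
  have h : 2 * Real.pi / (2 * Real.pi) * θ = θ := by
    rw [div_self Real.two_pi_pos.ne', one_mul]
  exact (congrArg Subtype.val (toCircle_apply_mk θ)).trans (by rw [h, Circle.coe_exp])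

lemma measurePreserving_toCircle :
    MeasurePreserving (fun x : AddCircle (2 * Real.pi) => (toCircle x : ℂ)) haarAddCircle mCirc :=
  ⟨(continuous_subtype_val.comp continuous_toCircle).measurable, mCirc_eq_map_toCircle⟩

/-- Composition with the parametrization `toCircle`, as an isometry of `L²` spaces. -/
noncomputable def toCircleₗᵢ :
    Lp ℂ 2 mCirc →ₗᵢ[ℂ] Lp ℂ 2 (haarAddCircle : Measure (AddCircle (2 * Real.pi))) :=
  Lp.compMeasurePreservingₗᵢ ℂ _ measurePreserving_toCircle

lemma coeFn_toCircleₗᵢ (f : Lp ℂ 2 mCirc) :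
    toCircleₗᵢ f =ᵐ[haarAddCircle] fun x => f (toCircle x : ℂ) :=
  Lp.coeFn_compMeasurePreserving f measurePreserving_toCircle

lemma inner_fourierLp_toCircleₗᵢ (f : Lp ℂ 2 mCirc) (n : ℤ) :
    inner ℂ (fourierLp 2 n) (toCircleₗᵢ f) = ∫ ω : ℂ, f ω * ω ^ (-n) ∂mCirc := by
  have hemb : MeasurableEmbedding fun x : AddCircle (2 * Real.pi) => (toCircle x : ℂ) :=
    ((continuous_subtype_val.comp continuous_toCircle).isClosedEmbedding
      (Subtype.val_injective.comp (injective_toCircle Real.two_pi_pos.ne'))).measurableEmbedding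
  rw [← coe_fourierBasis, ← HilbertBasis.repr_apply_apply, fourierBasis_repr,
    ← measurePreserving_toCircle.integral_comp hemb]
  refine integral_congr_ae ?_
  filter_upwards [coeFn_toCircleₗᵢ f] with x hx
  rw [hx, fourier_eq_toCircle_zpow, smul_eq_mul, mul_comm]

/-- The Hardy space as a closed subspace. -/
noncomputable def H2Submodule : Submodule ℂ (Lp ℂ 2 mCirc) :=
  ⨅ n : {n : ℤ // n < 0},
    LinearMap.ker ((innerSL ℂ (fourierLp 2 n.1)).comp toCircleₗᵢ.toContinuousLinearMap).toLinearMap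

lemma mem_H2Submodule {f : Lp ℂ 2 mCirc} :
    f ∈ H2Submodule ↔ ∀ n : ℤ, n < 0 → inner ℂ (fourierLp 2 n) (toCircleₗᵢ f) = 0 := by
  simp [H2Submodule, Submodule.mem_iInf]

lemma coe_H2Submodule : (H2Submodule : Set (Lp ℂ 2 mCirc)) = H2 := by
  ext f
  simp only [SetLike.mem_coe, mem_H2Submodule, inner_fourierLp_toCircleₗᵢ, H2, Set.mem_ofPred_eq]

lemma isClosed_H2 : IsClosed H2 := by
  rw [← coe_H2Submodule, H2Submodule, Submodule.coe_iInf]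
  exact isClosed_iInter fun n => ContinuousLinearMap.isClosed_ker _

lemma inner_gFun_eq {k : ℕ} (hk : k ≠ 0) {g : Lp ℂ 2 mCirc} (hg : g =ᵐ[mCirc] gFun k)
    (f : Lp ℂ 2 mCirc) :
    inner ℂ f g =
      -(∑' n : ℕ, inner ℂ (toCircleₗᵢ f) (fourierLp 2 ((k * n : ℕ) : ℤ)) / (n : ℂ)) +
      ∑' n : ℕ, inner ℂ (toCircleₗᵢ f) (fourierLp 2 (n : ℤ)) / (n : ℂ) -
      (Real.log k : ℂ) * inner ℂ (toCircleₗᵢ f) (fourierLp 2 0) := by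
  obtain ⟨F, hF, hFae⟩ := exists_hasSum_log_one_sub_pow (T := 2 * Real.pi) hk
  obtain ⟨G, hG, hGae⟩ := exists_hasSum_log_one_sub_pow (T := 2 * Real.pi) one_ne_zero
  have hdecomp : toCircleₗᵢ g = F - G - (Real.log k : ℂ) • fourierLp 2 0 := by
    refine Lp.ext ?_
    filter_upwards [coeFn_toCircleₗᵢ g, measurePreserving_toCircle.quasiMeasurePreserving.ae hg,
      hFae, hGae, Lp.coeFn_sub (F - G) ((Real.log k : ℂ) • fourierLp 2 0), Lp.coeFn_sub F G,
      Lp.coeFn_smul (Real.log k : ℂ) (fourierLp (T := 2 * Real.pi) 2 0),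
      coeFn_fourierLp (T := 2 * Real.pi) 2 0] with x h1 h2 h3 h4 h5 h6 h7 h8
    rw [h1, h2, h5, Pi.sub_apply, h6, Pi.sub_apply, h3, h4, h7, Pi.smul_apply, h8, gFun,
      fourier_zero, pow_one, smul_eq_mul, mul_one]
  have hexp : ∀ {l : ℕ} {L : Lp ℂ 2 (haarAddCircle : Measure (AddCircle (2 * Real.pi)))},
      HasSum (fun n : ℕ => (-(1 / (n : ℂ))) • fourierLp 2 ((l * n : ℕ) : ℤ)) L →
      inner ℂ (toCircleₗᵢ f) L =
        -(∑' n : ℕ, inner ℂ (toCircleₗᵢ f) (fourierLp 2 ((l * n : ℕ) : ℤ)) / (n : ℂ)) := by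
    intro l L hL
    rw [← innerSL_apply_apply ℂ, ← (hL.mapL (innerSL ℂ (toCircleₗᵢ f))).tsum_eq, ← tsum_neg]
    refine tsum_congr fun n => ?_
    simp only [map_smul, innerSL_apply_apply, smul_eq_mul]
    ring
  rw [← toCircleₗᵢ.inner_map_map, hdecomp, inner_sub_right, inner_sub_right, inner_smul_right,
    hexp hF, hexp hG]
  simp only [one_mul]
  ring

lemma eq_zero_of_mem_H2_of_inner_gFun {gk : ℕ → Lp ℂ 2 mCirc}
    (gk_ae : ∀ k, 2 ≤ k → (gk k : ℂ → ℂ) =ᵐ[mCirc] gFun k) {f : Lp ℂ 2 mCirc} (hf : f ∈ H2)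
    (horth : ∀ k, 2 ≤ k → inner ℂ f (gk k) = 0) : f = 0 := by
  have hnonneg : ∀ n : ℕ, inner ℂ (toCircleₗᵢ f) (fourierLp 2 (n : ℤ)) = 0 := by
    refine eq_zero_of_tsum_dilate_div
      (a := fun n : ℕ => inner ℂ (toCircleₗᵢ f) (fourierLp 2 (n : ℤ))) ?_ fun k hk => ?_
    · simpa only [norm_inner_symm, Function.comp_def] using
        (orthonormal_fourier.comp _ Nat.cast_injective).inner_products_summable (toCircleₗᵢ f)
    · rcases eq_or_ne k 1 with rfl | hk1
      · simp
      have hk2 : 2 ≤ k := by omega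
      have h := inner_gFun_eq hk (gk_ae k hk2) f
      rw [horth k hk2] at h
      simp only [Nat.cast_zero]
      linear_combination h
  refine toCircleₗᵢ.injective ((?_ : toCircleₗᵢ f = 0).trans toCircleₗᵢ.map_zero.symm)
  refine fourierBasis.repr.injective (lp.ext (funext fun n => ?_))
  rw [_root_.map_zero, lp.coeFn_zero, Pi.zero_apply, HilbertBasis.repr_apply_apply,
    coe_fourierBasis]
  rcases lt_or_ge n 0 with hn | hn
  · exact mem_H2Submodule.1 (coe_H2Submodule.ge hf) n hn
  · lift n to ℕ using hn
    exact inner_eq_zero_symm.1 (hnonneg n)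

end Transfer

/-- The linear span of the boundary functions `g_k`, `k ≥ 2`, is dense in the
Hardy space `H²`. -/
theorem span_gk_dense
    (gk : ℕ → Lp ℂ 2 mCirc)
    (gk_ae : ∀ k, 2 ≤ k → (gk k : ℂ → ℂ) =ᵐ[mCirc] gFun k)
    (gk_mem : ∀ k, 2 ≤ k → gk k ∈ H2) :
    closure ((Submodule.span ℂ (gk '' {k : ℕ | 2 ≤ k}) : Submodule ℂ (Lp ℂ 2 mCirc)) :
      Set (Lp ℂ 2 mCirc)) = H2 := by
  set S := Submodule.span ℂ (gk '' {k : ℕ | 2 ≤ k})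
  have hS : S ≤ H2Submodule := Submodule.span_le.2 <| by
    rintro _ ⟨k, hk, rfl⟩
    exact coe_H2Submodule.ge (gk_mem k hk)
  have hle : S.topologicalClosure ≤ H2Submodule :=
    Submodule.topologicalClosure_minimal _ hS (coe_H2Submodule ▸ isClosed_H2)
  have hbot : S.topologicalClosureᗮ ⊓ H2Submodule = ⊥ := by
    refine (Submodule.eq_bot_iff _).2 fun f hf => ?_
    refine eq_zero_of_mem_H2_of_inner_gFun gk_ae (coe_H2Submodule.le hf.2) fun k hk => ?_
    exact (Submodule.mem_orthogonal' _ f).1 hf.1 _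
      (S.le_topologicalClosure (Submodule.subset_span ⟨k, hk, rfl⟩))
  have heq := Submodule.sup_orthogonal_inf_of_hasOrthogonalProjection hle
  rw [hbot, sup_bot_eq] at heq
  rw [← Submodule.topologicalClosure_coe, heq, coe_H2Submodule]
end
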